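/- Assume that through each point of an analytic surface in ℝ³ one can draw two transversal parabolic arcs with axes parallel to the z-axis, fully contained in the surface and analytically depending on the point. Assume that these two arcs lie neither in the same isotropic sphere nor in the same plane. Assume that through each point in some dense subset of the surface one can draw only finitely many (not nested) arcs of isotropic circles and line segments contained in the surface. Then the surface, possibly besides a one-dimensional subset, has a parametrization Φ(u,v) = (P(u,v)/R(u,v), Q(u,v)/R(u,v), Z(u,v)/R(u,v)²) for some polynomials P, Q, R ∈ ℝ_{1,1} and Z ∈ ℝ_{2,2} with R ≠ 0, such that the parabolic arcs are the curves u = const and v = const. -/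

import Mathlib

open MvPolynomial Set

noncomputable section

/-- We use `ℝ × ℝ × ℝ` as a model of `ℝ³`, with coordinates `p.1, p.2.1, p.2.2`. -/
abbrev R3 : Type := ℝ × ℝ × ℝ

/-- The ring `ℝ[u,v]`, where `u` is the variable `X 0` and `v` is the variable `X 1`. -/
abbrev RP2 : Type := MvPolynomial (Fin 2) ℝ

/-- `F ∈ ℝ_{i,j}`, i.e. `deg_u F ≤ i` and `deg_v F ≤ j`. -/
def MemR (i j : ℕ) (F : RP2) : Prop := F.degreeOf 0 ≤ i ∧ F.degreeOf 1 ≤ j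

/-- Evaluation of `F ∈ ℝ[u,v]` at `(u,v)`. -/
def pev (F : RP2) (u v : ℝ) : ℝ := MvPolynomial.eval ![u, v] F

/-- A parabola in `ℝ³` with axis parallel to the `z`-axis. -/
def IsVerticalParabola (C : Set R3) : Prop :=
  ∃ x0 y0 dx dy a b c : ℝ, a ≠ 0 ∧ (dx, dy) ≠ (0, 0) ∧
    C = Set.range fun t : ℝ => (x0 + t * dx, y0 + t * dy, a * t ^ 2 + b * t + c)

/-- An ellipse in `ℝ³` whose orthogonal projection to the plane `Oxy` is a circle. -/
def IsIsotropicEllipse (C : Set R3) : Prop :=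
  ∃ x0 y0 r a b c : ℝ, 0 < r ∧
    C = {p : R3 | (p.1 - x0) ^ 2 + (p.2.1 - y0) ^ 2 = r ^ 2 ∧
          p.2.2 = a * p.1 + b * p.2.1 + c}

/-- An isotropic circle in `ℝ³`. -/
def IsIsotropicCircle (C : Set R3) : Prop := IsVerticalParabola C ∨ IsIsotropicEllipse C

/-- An isotropic sphere in `ℝ³`: a paraboloid of revolution with vertical axis or a
circular cylinder with vertical axis. -/
def IsIsotropicSphere (S : Set R3) : Prop :=
  (∃ a b c d : ℝ, a ≠ 0 ∧
      S = {p : R3 | p.2.2 = a * (p.1 ^ 2 + p.2.1 ^ 2) + b * p.1 + c * p.2.1 + d}) ∨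
  (∃ x0 y0 r : ℝ, 0 < r ∧ S = {p : R3 | (p.1 - x0) ^ 2 + (p.2.1 - y0) ^ 2 = r ^ 2})

/-- A plane in `ℝ³`. -/
def IsPlane3 (S : Set R3) : Prop :=
  ∃ a b c d : ℝ, (a, b, c) ≠ (0, 0, 0) ∧
    S = {p : R3 | a * p.1 + b * p.2.1 + c * p.2.2 = d}

/-- A line in `ℝ³`. -/
def IsLine3 (C : Set R3) : Prop :=
  ∃ p v : R3, v ≠ 0 ∧ C = Set.range fun t : ℝ => p + t • v

/-- An arc of the curve `C` through the point `q`, contained in the set `S`. -/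
def ArcThroughIn (C : Set R3) (q : R3) (S : Set R3) : Prop :=
  ∃ γ : ℝ → R3, ContinuousOn γ (Set.Ioo (-1 : ℝ) 1) ∧ Set.InjOn γ (Set.Ioo (-1 : ℝ) 1) ∧
    γ 0 = q ∧ γ '' Set.Ioo (-1 : ℝ) 1 ⊆ C ∩ S

/-- The rational parametrization `(P/R, Q/R, Z/R²)` of a surface in `ℝ³`. -/
def Phi3 (P Q R Z : RP2) (w : ℝ × ℝ) : R3 :=
  (pev P w.1 w.2 / pev R w.1 w.2, pev Q w.1 w.2 / pev R w.1 w.2,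
    pev Z w.1 w.2 / (pev R w.1 w.2) ^ 2)

end

/-! ### Vectors in `ℝ³` with homogeneous coordinates -/

/-- The dot product of two vectors. -/
def dt (x y : Fin 3 → ℝ) : ℝ := x 0 * y 0 + x 1 * y 1 + x 2 * y 2

/-- The cross product of two vectors. -/
def cr (x y : Fin 3 → ℝ) : Fin 3 → ℝ :=
  ![x 1 * y 2 - x 2 * y 1, x 2 * y 0 - x 0 * y 2, x 0 * y 1 - x 1 * y 0]

/-- The determinant of three vectors. -/
def det3 (x y z : Fin 3 → ℝ) : ℝ := dt x (cr y z)

/-- The ternary quadratic form with the given coefficients. -/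
def qf (c : Fin 6 → ℝ) (x : Fin 3 → ℝ) : ℝ :=
  c 0 * x 0 ^ 2 + c 1 * x 1 ^ 2 + c 2 * x 2 ^ 2 + c 3 * (x 0 * x 1) + c 4 * (x 0 * x 2) +
    c 5 * (x 1 * x 2)

@[simp] lemma cr_zero (x y : Fin 3 → ℝ) : cr x y 0 = x 1 * y 2 - x 2 * y 1 := rfl
@[simp] lemma cr_one (x y : Fin 3 → ℝ) : cr x y 1 = x 2 * y 0 - x 0 * y 2 := rfl
@[simp] lemma cr_two (x y : Fin 3 → ℝ) : cr x y 2 = x 0 * y 1 - x 1 * y 0 := rfl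

lemma vec3_ext {x y : Fin 3 → ℝ} (h0 : x 0 = y 0) (h1 : x 1 = y 1) (h2 : x 2 = y 2) : x = y := by
  ext i; fin_cases i <;> assumption

lemma dt_self_eq_zero {x : Fin 3 → ℝ} (h : dt x x = 0) : x = 0 := by
  unfold dt at h
  refine vec3_ext ?_ ?_ ?_ <;> simp <;>
    nlinarith [sq_nonneg (x 0), sq_nonneg (x 1), sq_nonneg (x 2)]

/-- A binary quadratic form takes linearly dependent values at four points. -/
lemma qf_four_points (c : Fin 6 → ℝ) (M A B C D : Fin 3 → ℝ) :
    qf c (cr A M) * (det3 M B C * det3 M B D * det3 M C D)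
      - qf c (cr B M) * (det3 M A C * det3 M A D * det3 M C D)
      + qf c (cr C M) * (det3 M A B * det3 M A D * det3 M B D)
      - qf c (cr D M) * (det3 M A B * det3 M A C * det3 M B C) = 0 := by
  simp only [qf, det3, dt, cr_zero, cr_one, cr_two]
  ring

/-! ### Polynomial functions and irreducible cones -/

/-- A function on `ℝ³` given by a polynomial. -/
def PolyFun (f : (Fin 3 → ℝ) → ℝ) : Prop :=
  ∃ P : MvPolynomial (Fin 3) ℝ, ∀ x, eval x P = f x

namespace PolyFun

variable {f g : (Fin 3 → ℝ) → ℝ} {F G K : (Fin 3 → ℝ) → Fin 3 → ℝ}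

lemma const (c : ℝ) : PolyFun fun _ => c := ⟨C c, fun x => by simp⟩

lemma coord (i : Fin 3) : PolyFun fun x => x i := ⟨X i, fun x => by simp⟩

lemma add (hf : PolyFun f) (hg : PolyFun g) : PolyFun fun x => f x + g x := by
  obtain ⟨P, hP⟩ := hf
  obtain ⟨Q, hQ⟩ := hg
  exact ⟨P + Q, fun x => by simp [hP, hQ]⟩

lemma sub (hf : PolyFun f) (hg : PolyFun g) : PolyFun fun x => f x - g x := by
  obtain ⟨P, hP⟩ := hf
  obtain ⟨Q, hQ⟩ := hg
  exact ⟨P - Q, fun x => by simp [hP, hQ]⟩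

lemma mul (hf : PolyFun f) (hg : PolyFun g) : PolyFun fun x => f x * g x := by
  obtain ⟨P, hP⟩ := hf
  obtain ⟨Q, hQ⟩ := hg
  exact ⟨P * Q, fun x => by simp [hP, hQ]⟩

lemma pow (hf : PolyFun f) (n : ℕ) : PolyFun fun x => f x ^ n := by
  obtain ⟨P, hP⟩ := hf
  exact ⟨P ^ n, fun x => by simp [hP]⟩

lemma ofPoly (P : MvPolynomial (Fin 3) ℝ) : PolyFun fun x => eval x P := ⟨P, fun _ => rfl⟩

lemma dt (hf : ∀ i, PolyFun fun x => F x i) (hg : ∀ i, PolyFun fun x => G x i) :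
    PolyFun fun x => _root_.dt (F x) (G x) :=
  (((hf 0).mul (hg 0)).add ((hf 1).mul (hg 1))).add ((hf 2).mul (hg 2))

lemma cr (hf : ∀ i, PolyFun fun x => F x i) (hg : ∀ i, PolyFun fun x => G x i) (i : Fin 3) :
    PolyFun fun x => _root_.cr (F x) (G x) i := by
  fin_cases i
  · exact ((hf 1).mul (hg 2)).sub ((hf 2).mul (hg 1))
  · exact ((hf 2).mul (hg 0)).sub ((hf 0).mul (hg 2))
  · exact ((hf 0).mul (hg 1)).sub ((hf 1).mul (hg 0))

lemma det3 (hf : ∀ i, PolyFun fun x => F x i) (hg : ∀ i, PolyFun fun x => G x i)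
    (hh : ∀ i, PolyFun fun x => K x i) : PolyFun fun x => _root_.det3 (F x) (G x) (K x) :=
  dt hf (cr hg hh)

lemma qf (c : Fin 6 → ℝ) (hf : ∀ i, PolyFun fun x => F x i) :
    PolyFun fun x => _root_.qf c (F x) :=
  ((((((const _).mul ((hf 0).pow 2)).add ((const _).mul ((hf 1).pow 2))).add
    ((const _).mul ((hf 2).pow 2))).add ((const _).mul ((hf 0).mul (hf 1)))).add
    ((const _).mul ((hf 0).mul (hf 2)))).add ((const _).mul ((hf 1).mul (hf 2)))

end PolyFun

/-- A cone on which the product of two polynomials vanishes only if one of them does. -/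
structure IrrCone (S : Set (Fin 3 → ℝ)) : Prop where
  nonempty : S.Nonempty
  smul_mem : ∀ x ∈ S, ∀ c : ℝ, c • x ∈ S
  prime : ∀ P Q : MvPolynomial (Fin 3) ℝ, (∀ x ∈ S, eval x P * eval x Q = 0) →
    (∀ x ∈ S, eval x P = 0) ∨ ∀ x ∈ S, eval x Q = 0

/-- A set of homogeneous covectors that is not contained in a pencil. -/
def NonPencil (S : Set (Fin 3 → ℝ)) : Prop := ∀ k : Fin 3 → ℝ, k ≠ 0 → ∃ x ∈ S, dt k x ≠ 0

/-- The ideal of polynomials vanishing on a set. -/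
noncomputable abbrev vI (S : Set (Fin 3 → ℝ)) : Ideal (MvPolynomial (Fin 3) ℝ) := vanishingIdeal ℝ S

lemma mem_vI {S : Set (Fin 3 → ℝ)} {P : MvPolynomial (Fin 3) ℝ} :
    P ∈ vI S ↔ ∀ x ∈ S, eval x P = 0 := by
  simp [aeval_eq_eval]

namespace IrrCone

variable {S : Set (Fin 3 → ℝ)}

lemma exists_ne (hS : IrrCone S) {f g : (Fin 3 → ℝ) → ℝ} (hf : PolyFun f) (hg : PolyFun g)
    (hf' : ∃ x ∈ S, f x ≠ 0) (hg' : ∃ x ∈ S, g x ≠ 0) : ∃ x ∈ S, f x ≠ 0 ∧ g x ≠ 0 := by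
  obtain ⟨P, hP⟩ := hf
  obtain ⟨Q, hQ⟩ := hg
  by_contra! h
  rcases hS.prime P Q (fun x hx => by
    rw [hP, hQ, mul_eq_zero]
    by_cases h' : f x = 0
    · exact Or.inl h'
    · exact Or.inr (h x hx h')) with h1 | h1
  · obtain ⟨x, hx, hne⟩ := hf'
    exact hne (by rw [← hP, h1 x hx])
  · obtain ⟨x, hx, hne⟩ := hg'
    exact hne (by rw [← hQ, h1 x hx])

lemma vI_isPrime (hS : IrrCone S) : (vI S).IsPrime := by
  refine ⟨fun h => ?_, fun {P Q} h => ?_⟩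
  · obtain ⟨x, hx⟩ := hS.nonempty
    have := mem_vI.1 ((Ideal.eq_top_iff_one _).1 h) x hx
    exact one_ne_zero ((map_one _).symm.trans this)
  · simp only [mem_vI, eval_mul] at h ⊢
    exact hS.prime P Q h

/-- An irreducible polynomial vanishing on a two-dimensional cone divides every other such
polynomial. -/
lemma dvd_of_vanish (hS : IrrCone S) {x y : Fin 3 → ℝ} (hx : x ∈ S) (hy : y ∈ S)
    (hxy : cr x y ≠ 0) {G E : MvPolynomial (Fin 3) ℝ} (hG : Irreducible G)
    (hGS : ∀ z ∈ S, eval z G = 0) (hES : ∀ z ∈ S, eval z E = 0) : G ∣ E := by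
  by_contra hdvd
  let ρ : MvPolynomial (Fin 3) ℝ →+* Polynomial ℝ :=
    (aeval fun i => Polynomial.C (x i) * Polynomial.X).toRingHom
  have hρ : ∀ P s, (ρ P).eval s = eval (s • x) P := by
    intro P s
    change Polynomial.eval s (aeval _ P) = _
    induction P using MvPolynomial.induction_on with
    | C a => simp
    | add p q hp hq => simp [hp, hq]
    | mul_X p i hp =>
      rw [map_mul, aeval_X, Polynomial.eval_mul, hp, eval_mul, eval_X, Polynomial.eval_mul,
        Polynomial.eval_C, Polynomial.eval_X, Pi.smul_apply, smul_eq_mul, mul_comm s]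
  let lin (k : Fin 3 → ℝ) : MvPolynomial (Fin 3) ℝ := C (k 0) * X 0 + C (k 1) * X 1 + C (k 2) * X 2
  have hlin : ∀ k z, eval z (lin k) = dt k z := by
    intro k z; simp only [lin, dt, map_add, map_mul, eval_C, eval_X]
  let p0 : PrimeSpectrum (MvPolynomial (Fin 3) ℝ) := ⟨⊥, Ideal.isPrime_bot⟩
  let p1 : PrimeSpectrum (MvPolynomial (Fin 3) ℝ) :=
    ⟨Ideal.span {G}, (Ideal.span_singleton_prime hG.ne_zero).2 hG.prime⟩
  let p2 : PrimeSpectrum (MvPolynomial (Fin 3) ℝ) := ⟨vI S, hS.vI_isPrime⟩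
  let p3 : PrimeSpectrum (MvPolynomial (Fin 3) ℝ) := ⟨RingHom.ker ρ, RingHom.ker_isPrime ρ⟩
  let p4 : PrimeSpectrum (MvPolynomial (Fin 3) ℝ) :=
    ⟨RingHom.ker (eval (0 : Fin 3 → ℝ)), RingHom.ker_isPrime _⟩
  have h01 : p0 < p1 := by
    change (⊥ : Ideal _) < Ideal.span {G}
    rw [bot_lt_iff_ne_bot, Ne, Ideal.span_singleton_eq_bot]
    exact hG.ne_zero
  have h12 : p1 < p2 := by
    change Ideal.span {G} < vI S
    refine lt_of_le_of_ne ?_ fun h => hdvd ?_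
    · rw [Ideal.span_singleton_le_iff_mem]
      exact mem_vI.2 hGS
    · rw [← Ideal.mem_span_singleton, h]
      exact mem_vI.2 hES
  have h23 : p2 < p3 := by
    change vI S < RingHom.ker ρ
    refine lt_of_le_of_ne (fun P hP => ?_) fun h => ?_
    · rw [RingHom.mem_ker]
      refine Polynomial.funext fun s => ?_
      rw [hρ, mem_vI.1 hP _ (hS.smul_mem x hx s), Polynomial.eval_zero]
    · have hm : lin (cr x (cr x y)) ∈ RingHom.ker ρ := by
        rw [RingHom.mem_ker]
        refine Polynomial.funext fun s => ?_
        rw [hρ, hlin, Polynomial.eval_zero]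
        simp only [dt, cr_zero, cr_one, cr_two, Pi.smul_apply, smul_eq_mul]
        ring
      rw [← h] at hm
      have := mem_vI.1 hm y hy
      rw [hlin] at this
      refine hxy (dt_self_eq_zero ?_)
      have e : dt (cr x y) (cr x y) = - dt (cr x (cr x y)) y := by
        simp only [dt, cr_zero, cr_one, cr_two]; ring
      rw [e, this, neg_zero]
  have h34 : p3 < p4 := by
    change RingHom.ker ρ < RingHom.ker (eval (0 : Fin 3 → ℝ))
    refine lt_of_le_of_ne (fun P hP => ?_) fun h => ?_
    · rw [RingHom.mem_ker] at hP ⊢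
      have := hρ P 0
      rw [hP] at this
      simpa using this.symm
    · have hm : lin x ∈ RingHom.ker (eval (0 : Fin 3 → ℝ)) := by
        rw [RingHom.mem_ker, hlin]
        simp [dt]
      rw [← h, RingHom.mem_ker] at hm
      have := hρ (lin x) 1
      rw [hm, hlin, one_smul] at this
      refine hxy ?_
      rw [dt_self_eq_zero (x := x) (by simpa using this.symm)]
      refine vec3_ext ?_ ?_ ?_ <;> simp
  let s : LTSeries (PrimeSpectrum (MvPolynomial (Fin 3) ℝ)) :=
    { length := 4
      toFun := ![p0, p1, p2, p3, p4]
      step := by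
        intro i
        fin_cases i
        · exact h01
        · exact h12
        · exact h23
        · exact h34 }
  have h := Order.LTSeries.length_le_krullDim s
  have h3 : Order.krullDim (PrimeSpectrum (MvPolynomial (Fin 3) ℝ)) = 3 := by
    have := MvPolynomial.ringKrullDim_of_isNoetherianRing (R := ℝ) (ι := Fin 3)
    rw [ringKrullDim_eq_zero_of_field] at this
    simpa [ringKrullDim] using this
  rw [h3] at h
  have : (4 : ℕ) ≤ 3 := by exact_mod_cast h
  omega

end IrrCone

lemma MvPolynomial.IsHomogeneous.eval_smul_vec {G : MvPolynomial (Fin 3) ℝ} {n : ℕ}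
    (hG : G.IsHomogeneous n) (s : ℝ) (x : Fin 3 → ℝ) : eval (s • x) G = s ^ n * eval x G := by
  rw [eval_eq', eval_eq', Finset.mul_sum]
  refine Finset.sum_congr rfl fun d hd => ?_
  have h := hG.degree_eq_sum_deg_support hd
  have h' : ∑ i ∈ d.support, d i = ∑ i, d i :=
    Finset.sum_subset (Finset.subset_univ _) fun i _ hi => by simpa using hi
  rw [h'] at h
  simp only [Pi.smul_apply, smul_eq_mul, mul_pow, Finset.prod_mul_distrib,
    Finset.prod_pow_eq_pow_sum]
  rw [h]
  ring

namespace IrrCone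

variable {S : Set (Fin 3 → ℝ)}

lemma eval_homogeneousComponent_eq_zero (hS : IrrCone S) {P : MvPolynomial (Fin 3) ℝ}
    (hP : ∀ x ∈ S, eval x P = 0) (n : ℕ) : ∀ x ∈ S, eval x (homogeneousComponent n P) = 0 := by
  intro x hx
  let R : Polynomial ℝ := ∑ i ∈ Finset.range (P.totalDegree + 1),
    Polynomial.C (eval x (homogeneousComponent i P)) * Polynomial.X ^ i
  have hR : R = 0 := by
    refine Polynomial.funext fun s => ?_
    have h := hP _ (hS.smul_mem x hx s)
    rw [← sum_homogeneousComponent P, map_sum] at h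
    simp only [R, Polynomial.eval_finsetSum, Polynomial.eval_mul, Polynomial.eval_C,
      Polynomial.eval_pow, Polynomial.eval_X, Polynomial.eval_zero]
    rw [← h]
    refine Finset.sum_congr rfl fun i _ => ?_
    rw [(homogeneousComponent_isHomogeneous i P).eval_smul_vec, mul_comm]
  by_cases hn : n ∈ Finset.range (P.totalDegree + 1)
  · have := congrArg (fun Q => Polynomial.coeff Q n) hR
    simpa [R, Polynomial.finsetSum_coeff, Polynomial.coeff_C_mul, Polynomial.coeff_X_pow,
      Nat.lt_succ_iff, Finset.mem_range.1 hn] using this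
  · rw [homogeneousComponent_eq_zero, map_zero]
    simp at hn
    omega

lemma exists_irreducible (hS : IrrCone S)
    (h : ∃ P : MvPolynomial (Fin 3) ℝ, P ≠ 0 ∧ ∀ x ∈ S, eval x P = 0) :
    ∃ (G : MvPolynomial (Fin 3) ℝ) (d : ℕ), Irreducible G ∧ G.IsHomogeneous d ∧ 1 ≤ d ∧
      ∀ x ∈ S, eval x G = 0 := by
  have key : ∀ P : MvPolynomial (Fin 3) ℝ, P ≠ 0 → (∀ x ∈ S, eval x P = 0) →
      ∃ n ≤ P.totalDegree, ∃ G : MvPolynomial (Fin 3) ℝ, G ≠ 0 ∧ G.IsHomogeneous n ∧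
        ∀ x ∈ S, eval x G = 0 := by
    intro P h0 hP
    have : ∃ n ∈ Finset.range (P.totalDegree + 1), homogeneousComponent n P ≠ 0 := by
      by_contra! hc
      exact h0 (by rw [← sum_homogeneousComponent P, Finset.sum_eq_zero hc])
    obtain ⟨n, hn, hne⟩ := this
    exact ⟨n, Nat.lt_succ_iff.1 (Finset.mem_range.1 hn), _, hne,
      homogeneousComponent_isHomogeneous n P, hS.eval_homogeneousComponent_eq_zero hP n⟩
  have hex : ∃ n, ∃ G : MvPolynomial (Fin 3) ℝ, G ≠ 0 ∧ G.IsHomogeneous n ∧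
      ∀ x ∈ S, eval x G = 0 := by
    obtain ⟨P, h0, hP⟩ := h
    obtain ⟨n, -, hn⟩ := key P h0 hP
    exact ⟨n, hn⟩
  classical
  obtain ⟨x, hx⟩ := hS.nonempty
  obtain ⟨G, hG0, hGh, hGS⟩ := Nat.find_spec hex
  have hmin : ∀ P : MvPolynomial (Fin 3) ℝ, P ≠ 0 → (∀ x ∈ S, eval x P = 0) →
      Nat.find hex ≤ P.totalDegree := fun P h0 hP => by
    obtain ⟨n, hn, hn'⟩ := key P h0 hP
    exact (Nat.find_min' hex hn').trans hn
  have hunit : ∀ a : MvPolynomial (Fin 3) ℝ, (∀ x ∈ S, eval x a = 0) → ¬ IsUnit a := by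
    intro a ha hu
    have := hu.map (eval x)
    rw [ha x hx] at this
    exact not_isUnit_zero this
  have hconst : ∀ a b : MvPolynomial (Fin 3) ℝ, G = a * b → (∀ x ∈ S, eval x a = 0) →
      IsUnit b := by
    intro a b hab ha
    have ha0 : a ≠ 0 := by rintro rfl; exact hG0 (by rw [hab, zero_mul])
    have hb0 : b ≠ 0 := by rintro rfl; exact hG0 (by rw [hab, mul_zero])
    have h1 := hmin a ha0 ha
    have h2 := totalDegree_mul_of_isDomain ha0 hb0
    rw [← hab, hGh.totalDegree hG0] at h2
    have h3 : b.totalDegree = 0 := by omega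
    rw [totalDegree_eq_zero_iff_eq_C] at h3
    rw [h3]
    refine IsUnit.map C (isUnit_iff_ne_zero.2 fun h => hb0 ?_)
    rw [h3, h, map_zero]
  refine ⟨G, Nat.find hex, ⟨hunit G hGS, fun {a b} hab => ?_⟩, hGh, ?_, hGS⟩
  · rcases hS.prime a b (fun y hy => by rw [← eval_mul, ← hab, hGS y hy]) with ha | hb
    · exact Or.inr (hconst a b hab ha)
    · exact Or.inl (hconst b a (by rw [hab, mul_comm]) hb)
  · by_contra hd
    have hd0 : G.totalDegree = 0 := by rw [hGh.totalDegree hG0]; omega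
    rw [totalDegree_eq_zero_iff_eq_C] at hd0
    have := hGS x hx
    rw [hd0, eval_C] at this
    exact hG0 (by rw [hd0, this, map_zero])

end IrrCone

/-- Restriction of polynomials to the line `A + t B`. -/
noncomputable def lineHom (A B : Fin 3 → ℝ) : MvPolynomial (Fin 3) ℝ →+* Polynomial ℝ :=
  (aeval fun i => Polynomial.C (A i) + Polynomial.C (B i) * Polynomial.X).toRingHom

lemma eval_lineHom (A B : Fin 3 → ℝ) (P : MvPolynomial (Fin 3) ℝ) (t : ℝ) :
    (lineHom A B P).eval t = eval (A + t • B) P := by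
  change Polynomial.eval t (aeval _ P) = _
  induction P using MvPolynomial.induction_on with
  | C a => simp
  | add p q hp hq => simp [hp, hq]
  | mul_X p i hp =>
    rw [map_mul, aeval_X, Polynomial.eval_mul, hp, eval_mul, eval_X, Polynomial.eval_add,
      Polynomial.eval_mul, Polynomial.eval_C, Polynomial.eval_C, Polynomial.eval_X, Pi.add_apply,
      Pi.smul_apply, smul_eq_mul, mul_comm t]

/-- The derivative of a polynomial at `A` along `B`. -/
noncomputable def dirD (G : MvPolynomial (Fin 3) ℝ) (A B : Fin 3 → ℝ) : ℝ :=
  dt B fun k => eval A (pderiv k G)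

lemma derivative_lineHom (A B : Fin 3 → ℝ) (P : MvPolynomial (Fin 3) ℝ) :
    (Polynomial.derivative (lineHom A B P)).eval 0 = dirD P A B := by
  have hX : ∀ i, lineHom A B (X i) = Polynomial.C (A i) + Polynomial.C (B i) * Polynomial.X :=
    fun i => by simp [lineHom]
  unfold dirD dt
  induction P using MvPolynomial.induction_on with
  | C a =>
    have : lineHom A B (C a) = Polynomial.C a := by simp [lineHom]
    simp [this]
  | add p q hp hq =>
    rw [map_add, Polynomial.derivative_add, Polynomial.eval_add, hp, hq]
    simp only [map_add]
    ring
  | mul_X p i hp =>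
    have h0 : (lineHom A B p).eval 0 = eval A p := by simp [eval_lineHom]
    rw [map_mul, Polynomial.derivative_mul, Polynomial.eval_add, Polynomial.eval_mul,
      Polynomial.eval_mul, hp, h0, hX]
    simp only [pderiv_mul, pderiv_X, map_add, map_mul, eval_X]
    fin_cases i <;> simp <;> ring

section Delta

variable {SA SB : Set (Fin 3 → ℝ)} {H : (Fin 3 → ℝ) → ℝ} {a b : (Fin 3 → ℝ) → Fin 6 → ℝ}
  {G : MvPolynomial (Fin 3) ℝ} {A B : Fin 3 → ℝ}

lemma exists_four_points_poly (c1 c2 c3 c4 : Fin 6 → ℝ) (L1 L2 L3 L4 : Fin 3 → ℝ) :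
    ∃ E : MvPolynomial (Fin 3) ℝ, ∀ M, eval M E =
      qf c1 (cr L1 M) * (det3 M L2 L3 * det3 M L2 L4 * det3 M L3 L4)
      - qf c2 (cr L2 M) * (det3 M L1 L3 * det3 M L1 L4 * det3 M L3 L4)
      + qf c3 (cr L3 M) * (det3 M L1 L2 * det3 M L1 L4 * det3 M L2 L4)
      - qf c4 (cr L4 M) * (det3 M L1 L2 * det3 M L1 L3 * det3 M L2 L3) := by
  have hM : ∀ i, PolyFun fun M => M i := PolyFun.coord
  have hc : ∀ (L : Fin 3 → ℝ) i, PolyFun fun _ => L i := fun L i => PolyFun.const _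
  have hd : ∀ L L', PolyFun fun M => det3 M L L' := fun L L' => PolyFun.det3 hM (hc L) (hc L')
  have hq : ∀ c L, PolyFun fun M => qf c (cr L M) := fun c L => PolyFun.qf c (PolyFun.cr (hc L) hM)
  exact ((((hq _ _).mul (((hd _ _).mul (hd _ _)).mul (hd _ _))).sub
    ((hq _ _).mul (((hd _ _).mul (hd _ _)).mul (hd _ _)))).add
    ((hq _ _).mul (((hd _ _).mul (hd _ _)).mul (hd _ _)))).sub
    ((hq _ _).mul (((hd _ _).mul (hd _ _)).mul (hd _ _)))

lemma four_points_on_line (c1 c2 c3 c4 : Fin 6 → ℝ) (L1 L2 L3 L4 : Fin 3 → ℝ) (t : ℝ) :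
    qf c1 (cr L1 (L1 + t • L2)) * (det3 (L1 + t • L2) L2 L3 * det3 (L1 + t • L2) L2 L4 *
        det3 (L1 + t • L2) L3 L4)
      - qf c2 (cr L2 (L1 + t • L2)) * (det3 (L1 + t • L2) L1 L3 * det3 (L1 + t • L2) L1 L4 *
        det3 (L1 + t • L2) L3 L4)
      + qf c3 (cr L3 (L1 + t • L2)) * (det3 (L1 + t • L2) L1 L2 * det3 (L1 + t • L2) L1 L4 *
        det3 (L1 + t • L2) L2 L4)
      - qf c4 (cr L4 (L1 + t • L2)) * (det3 (L1 + t • L2) L1 L2 * det3 (L1 + t • L2) L1 L3 *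
        det3 (L1 + t • L2) L2 L3) =
    (qf c1 (cr L1 L2) - qf c2 (cr L1 L2)) * det3 L1 L2 L3 * det3 L1 L2 L4 *
      (t ^ 2 * (det3 L1 L3 L4 + t * det3 L2 L3 L4)) := by
  have e12 : det3 (L1 + t • L2) L1 L2 = 0 := by
    simp only [det3, dt, cr_zero, cr_one, cr_two, Pi.add_apply, Pi.smul_apply, smul_eq_mul]; ring
  have e1 : ∀ L, det3 (L1 + t • L2) L2 L = det3 L1 L2 L := fun L => by
    simp only [det3, dt, cr_zero, cr_one, cr_two, Pi.add_apply, Pi.smul_apply, smul_eq_mul]; ring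
  have e2 : ∀ L, det3 (L1 + t • L2) L1 L = - t * det3 L1 L2 L := fun L => by
    simp only [det3, dt, cr_zero, cr_one, cr_two, Pi.add_apply, Pi.smul_apply, smul_eq_mul]; ring
  have e3 : det3 (L1 + t • L2) L3 L4 = det3 L1 L3 L4 + t * det3 L2 L3 L4 := by
    simp only [det3, dt, Pi.add_apply, Pi.smul_apply, smul_eq_mul]; ring
  have q1 : qf c1 (cr L1 (L1 + t • L2)) = t ^ 2 * qf c1 (cr L1 L2) := by
    simp only [qf, cr_zero, cr_one, cr_two, Pi.add_apply, Pi.smul_apply, smul_eq_mul]; ring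
  have q2 : qf c2 (cr L2 (L1 + t • L2)) = qf c2 (cr L1 L2) := by
    simp only [qf, cr_zero, cr_one, cr_two, Pi.add_apply, Pi.smul_apply, smul_eq_mul]; ring
  rw [e12, e3, e1, e1, e2, e2, q1, q2]
  ring

lemma NonPencil.exists_ne_ne (hA : IrrCone SA) (hn : NonPencil SA) {k l : Fin 3 → ℝ} (hk : k ≠ 0)
    (hl : l ≠ 0) : ∃ x ∈ SA, dt k x ≠ 0 ∧ dt l x ≠ 0 :=
  hA.exists_ne (PolyFun.dt (fun _ => PolyFun.const _) PolyFun.coord)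
    (PolyFun.dt (fun _ => PolyFun.const _) PolyFun.coord) (hn k hk) (hn l hl)

lemma det3_eq_dt_cr (x y z : Fin 3 → ℝ) : det3 x y z = dt (cr x y) z := by
  simp only [det3, dt, cr_zero, cr_one, cr_two]; ring

/-- If two forms disagree at `A × B`, then the equation of the dual curve restricts to a monomial
on the line `A + t B`. -/
lemma restrict_monomial (hA : IrrCone SA) (hn : NonPencil SA)
    (hdvd : ∀ P : MvPolynomial (Fin 3) ℝ, (∀ M ∈ SB, eval M P = 0) → G ∣ P)
    (ha : ∀ L ∈ SA, ∀ M ∈ SB, H (cr L M) = qf (a L) (cr L M))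
    (hb : ∀ M ∈ SB, ∀ L ∈ SA, H (cr L M) = qf (b M) (cr L M))
    (hAS : A ∈ SA) (hBS : B ∈ SA) (hδ : qf (a A) (cr A B) ≠ qf (a B) (cr A B)) :
    ∃ κ : ℝ, κ ≠ 0 ∧ ∃ i ≤ 2, ∀ t : ℝ, eval (A + t • B) G = κ * t ^ i := by
  have hAB : cr A B ≠ 0 := by
    intro h
    refine hδ ?_
    rw [h]
    simp [qf]
  have key : ∀ C ∈ SA, ∀ D ∈ SA, det3 A B C ≠ 0 → det3 A B D ≠ 0 →
      lineHom A B G ∣ Polynomial.X ^ 2 *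
        (Polynomial.C (det3 A C D) + Polynomial.C (det3 B C D) * Polynomial.X) := by
    intro L3 h3 L4 h4 n3 n4
    obtain ⟨E, hE⟩ := exists_four_points_poly (a A) (a B) (a L3) (a L4) A B L3 L4
    have hdiv : lineHom A B G ∣ lineHom A B E := by
      refine map_dvd _ (hdvd E fun M hM => ?_)
      rw [hE, ← ha A hAS M hM, ← ha B hBS M hM, ← ha L3 h3 M hM, ← ha L4 h4 M hM, hb M hM A hAS,
        hb M hM B hBS, hb M hM L3 h3, hb M hM L4 h4]
      exact qf_four_points _ _ _ _ _ _
    have hEq : lineHom A B E =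
        Polynomial.C ((qf (a A) (cr A B) - qf (a B) (cr A B)) * det3 A B L3 * det3 A B L4) *
        (Polynomial.X ^ 2 *
        (Polynomial.C (det3 A L3 L4) + Polynomial.C (det3 B L3 L4) * Polynomial.X)) := by
      refine Polynomial.funext fun t => ?_
      rw [eval_lineHom, hE, four_points_on_line]
      simp only [Polynomial.eval_mul, Polynomial.eval_C, Polynomial.eval_pow, Polynomial.eval_X,
        Polynomial.eval_add]
      ring
    rw [hEq] at hdiv
    have hu : IsUnit (Polynomial.C
        ((qf (a A) (cr A B) - qf (a B) (cr A B)) * det3 A B L3 * det3 A B L4)) :=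
      Polynomial.isUnit_C.2 (isUnit_iff_ne_zero.2
        (mul_ne_zero (mul_ne_zero (sub_ne_zero.2 hδ) n3) n4))
    exact (hu.dvd_mul_left).1 hdiv
  obtain ⟨L3, h3, n3⟩ := hn _ hAB
  have h30 : L3 ≠ 0 := by rintro rfl; simp [dt] at n3
  obtain ⟨k, hk, hk3⟩ : ∃ k : Fin 3 → ℝ, k ≠ 0 ∧ dt k L3 = 0 := by
    by_cases h : L3 0 = 0 ∧ L3 1 = 0
    · exact ⟨![1, 0, 0], fun h => by simpa using congrFun h 0, by simp [dt, h.1]⟩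
    · refine ⟨![L3 1, - L3 0, 0], fun h' => h ⟨by simpa using congrFun h' 1,
        by simpa using congrFun h' 0⟩, by simp [dt]; ring⟩
  obtain ⟨L4, h4, n4, hk4⟩ := NonPencil.exists_ne_ne hA hn hAB hk
  have h34 : cr L3 L4 ≠ 0 := by
    intro h
    have e : cr k (cr L3 L4) = dt k L4 • L3 - dt k L3 • L4 := by
      refine vec3_ext ?_ ?_ ?_ <;> simp [dt] <;> ring
    rw [h, hk3, zero_smul, sub_zero] at e
    have e' : cr k 0 = 0 := by refine vec3_ext ?_ ?_ ?_ <;> simp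
    rw [e', eq_comm, smul_eq_zero] at e
    exact e.elim hk4 h30
  obtain ⟨L5, h5, n5, n345⟩ := NonPencil.exists_ne_ne hA hn hAB h34
  rw [← det3_eq_dt_cr] at n3 n4 n5 n345
  have d4 := key L3 h3 L4 h4 n3 n4
  have d5 := key L3 h3 L5 h5 n3 n5
  have plucker : det3 A L3 L4 * det3 B L3 L5 - det3 B L3 L4 * det3 A L3 L5
      = det3 A B L3 * det3 L3 L4 L5 := by
    simp only [det3, dt, cr_zero, cr_one, cr_two]; ring
  have hX : lineHom A B G ∣ Polynomial.C (det3 A B L3 * det3 L3 L4 L5) * Polynomial.X ^ 2 := by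
    have := dvd_sub (d4.mul_left (Polynomial.C (det3 B L3 L5)))
      (d5.mul_left (Polynomial.C (det3 B L3 L4)))
    convert this using 1
    rw [← plucker]
    simp only [map_sub, map_mul]
    ring
  have hu : IsUnit (Polynomial.C (det3 A B L3 * det3 L3 L4 L5)) :=
    Polynomial.isUnit_C.2 (isUnit_iff_ne_zero.2 (mul_ne_zero n3 n345))
  rw [hu.dvd_mul_left, dvd_prime_pow Polynomial.prime_X] at hX
  obtain ⟨i, hi, u, hu⟩ := hX
  obtain ⟨r, hr, hr'⟩ := Polynomial.isUnit_iff.1 u.isUnit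
  have hr0 : r ≠ 0 := hr.ne_zero
  refine ⟨r⁻¹, inv_ne_zero hr0, i, hi, fun t => ?_⟩
  have h := congrArg (Polynomial.eval t) hu
  rw [← hr', Polynomial.eval_mul, eval_lineHom, Polynomial.eval_C, Polynomial.eval_pow,
    Polynomial.eval_X] at h
  rw [← h]
  field_simp

variable {d : ℕ}

/-- The exponents of the two monomials add up to the degree. -/
lemma exponents_add (hG : G.IsHomogeneous d) {κ κ' : ℝ} (hκ : κ ≠ 0) {i j : ℕ}
    (h1 : ∀ t : ℝ, eval (A + t • B) G = κ * t ^ i) (h2 : ∀ t : ℝ, eval (B + t • A) G = κ' * t ^ j) :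
    i + j = d := by
  have e1 := h1 1
  have e2 := h2 1
  rw [one_smul, one_pow, mul_one] at e1 e2
  rw [add_comm, e1] at e2
  have e3 := h1 2
  have e4 := h2 (1 / 2)
  have e : A + (2 : ℝ) • B = (2 : ℝ) • (B + (1 / 2 : ℝ) • A) := by
    rw [smul_add, smul_smul]; norm_num; exact add_comm _ _
  rw [e, hG.eval_smul_vec, e4, ← e2] at e3
  have : (2 : ℝ) ^ d = 2 ^ (i + j) := by
    rw [pow_add]
    have h2j : ((1 / 2 : ℝ)) ^ j * 2 ^ j = 1 := by rw [← mul_pow]; norm_num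
    have : κ * 2 ^ d * ((1 / 2) ^ j * 2 ^ j) = κ * (2 ^ i * 2 ^ j) := by
      linear_combination 2 ^ j * e3
    rw [h2j, mul_one] at this
    exact mul_left_cancel₀ hκ this
  exact (pow_right_injective₀ (by norm_num) (by norm_num) this).symm

lemma forms_agree_of_not_vanish (hA : IrrCone SA) (hn : NonPencil SA)
    (hdvd : ∀ P : MvPolynomial (Fin 3) ℝ, (∀ M ∈ SB, eval M P = 0) → G ∣ P)
    (ha : ∀ L ∈ SA, ∀ M ∈ SB, H (cr L M) = qf (a L) (cr L M))
    (hb : ∀ M ∈ SB, ∀ L ∈ SA, H (cr L M) = qf (b M) (cr L M))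
    (hG : G.IsHomogeneous d) (hd : 1 ≤ d)
    (hAS : A ∈ SA) (hBS : B ∈ SA) (hGA : eval A G ≠ 0) (hGB : eval B G ≠ 0) :
    qf (a A) (cr A B) = qf (a B) (cr A B) := by
  by_contra hδ
  have hsymm : ∀ c, qf c (cr B A) = qf c (cr A B) := fun c => by
    simp only [qf, cr_zero, cr_one, cr_two]; ring
  obtain ⟨κ, hκ, i, hi, h1⟩ := restrict_monomial hA hn hdvd ha hb hAS hBS hδ
  obtain ⟨κ', hκ', j, hj, h2⟩ := restrict_monomial hA hn hdvd ha hb hBS hAS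
    (by rw [hsymm, hsymm]; exact Ne.symm hδ)
  have h := exponents_add hG hκ h1 h2
  have hi0 : i = 0 := by
    by_contra h0
    have := h1 0
    rw [zero_smul, add_zero, zero_pow h0, mul_zero] at this
    exact hGA this
  have hj0 : j = 0 := by
    by_contra h0
    have := h2 0
    rw [zero_smul, add_zero, zero_pow h0, mul_zero] at this
    exact hGB this
  omega

lemma forms_agree_of_vanish (hA : IrrCone SA) (hn : NonPencil SA)
    (hdvd : ∀ P : MvPolynomial (Fin 3) ℝ, (∀ M ∈ SB, eval M P = 0) → G ∣ P)
    (ha : ∀ L ∈ SA, ∀ M ∈ SB, H (cr L M) = qf (a L) (cr L M))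
    (hb : ∀ M ∈ SB, ∀ L ∈ SA, H (cr L M) = qf (b M) (cr L M))
    (hG : G.IsHomogeneous d) (hd : d ≠ 2)
    (hAS : A ∈ SA) (hBS : B ∈ SA) (hGA : dirD G A B ≠ 0) (hGB : dirD G B A ≠ 0)
    (hA0 : eval A G = 0) (hB0 : eval B G = 0) :
    qf (a A) (cr A B) = qf (a B) (cr A B) := by
  by_contra hδ
  have hsymm : ∀ c, qf c (cr B A) = qf c (cr A B) := fun c => by
    simp only [qf, cr_zero, cr_one, cr_two]; ring
  obtain ⟨κ, hκ, i, hi, h1⟩ := restrict_monomial hA hn hdvd ha hb hAS hBS hδ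
  obtain ⟨κ', hκ', j, hj, h2⟩ := restrict_monomial hA hn hdvd ha hb hBS hAS
    (by rw [hsymm, hsymm]; exact Ne.symm hδ)
  have h := exponents_add hG hκ h1 h2
  have one : ∀ (A B : Fin 3 → ℝ) (κ : ℝ) (i : ℕ), κ ≠ 0 → i ≤ 2 → dirD G A B ≠ 0 → eval A G = 0 →
      (∀ t : ℝ, eval (A + t • B) G = κ * t ^ i) → i = 1 := by
    intro A B κ i hκ hi hD h0 h1
    have e : lineHom A B G = Polynomial.C κ * Polynomial.X ^ i :=
      Polynomial.funext fun t => by rw [eval_lineHom, h1]; simp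
    have hd := derivative_lineHom A B G
    rw [e] at hd
    interval_cases i
    · have := h1 0
      rw [zero_smul, add_zero, h0] at this
      simp at this
      exact absurd this.symm hκ
    · rfl
    · rw [← hd] at hD
      simp at hD
  have := one A B κ i hκ hi hGA hA0 h1
  have := one B A κ' j hκ' hj hGB hB0 h2
  omega

end Delta

lemma dt_comm (x y : Fin 3 → ℝ) : dt x y = dt y x := by
  unfold dt; ring

/-- A function given by a quadratic form. -/
def IsQuad (f : (Fin 3 → ℝ) → ℝ) : Prop := ∃ c : Fin 6 → ℝ, ∀ x, qf c x = f x

lemma IsQuad.add {f g : (Fin 3 → ℝ) → ℝ} (hf : IsQuad f) (hg : IsQuad g) :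
    IsQuad fun x => f x + g x := by
  obtain ⟨c, hc⟩ := hf
  obtain ⟨e, he⟩ := hg
  exact ⟨c + e, fun x => by
    change _ = f x + g x
    rw [← hc, ← he]
    simp only [qf, Pi.add_apply]
    ring⟩

lemma IsQuad.of_mul (r : ℝ) (k l : Fin 3 → ℝ) : IsQuad fun x => r * (dt k x * dt l x) :=
  ⟨![r * (k 0 * l 0), r * (k 1 * l 1), r * (k 2 * l 2), r * (k 0 * l 1 + k 1 * l 0),
    r * (k 0 * l 2 + k 2 * l 0), r * (k 1 * l 2 + k 2 * l 1)], fun x => by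
      simp only [qf, dt, Matrix.cons_val]; ring⟩

/-- The polar form of a quadratic form. -/
def qpolar (c : Fin 6 → ℝ) (x y : Fin 3 → ℝ) : ℝ := qf c (x + y) - qf c x - qf c y

lemma qf_comb (c : Fin 6 → ℝ) (x y : Fin 3 → ℝ) (s t : ℝ) :
    qf c (s • x + t • y) = s ^ 2 * qf c x + t ^ 2 * qf c y + s * t * qpolar c x y := by
  simp only [qpolar, qf, Pi.add_apply, Pi.smul_apply, smul_eq_mul]; ring

lemma qf_smul (c : Fin 6 → ℝ) (s : ℝ) (x : Fin 3 → ℝ) : qf c (s • x) = s ^ 2 * qf c x := by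
  simp only [qf, Pi.smul_apply, smul_eq_mul]; ring

/-- Three quadratic forms on planes through the origin that agree on the lines of intersection
extend to a common quadratic form. -/
lemma exists_common_form {A B C : Fin 3 → ℝ} (hD : det3 A B C ≠ 0) {a b c : Fin 6 → ℝ}
    (hab : qf a (cr A B) = qf b (cr A B)) (hac : qf a (cr A C) = qf c (cr A C))
    (hbc : qf b (cr B C) = qf c (cr B C)) :
    ∃ q : Fin 6 → ℝ, ∀ M, qf q (cr A M) = qf a (cr A M) ∧ qf q (cr B M) = qf b (cr B M) ∧
      qf q (cr C M) = qf c (cr C M) := by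
  set D := det3 A B C with hDdef
  obtain ⟨q, hq⟩ := ((((((IsQuad.of_mul (qf a (cr A B) / D ^ 2) C C).add
    (IsQuad.of_mul (qf a (cr A C) / D ^ 2) B B)).add
    (IsQuad.of_mul (qf b (cr B C) / D ^ 2) A A)).add
    (IsQuad.of_mul (-qpolar a (cr A B) (cr A C) / D ^ 2) C B)).add
    (IsQuad.of_mul (qpolar b (cr A B) (cr B C) / D ^ 2) C A)).add
    (IsQuad.of_mul (-qpolar c (cr A C) (cr B C) / D ^ 2) B A))
  beta_reduce at hq
  have eA : ∀ M, cr A M =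
      (dt C (cr A M) / D) • cr A B + (-dt B (cr A M) / D) • cr A C := by
    intro M
    have : D • cr A M = dt C (cr A M) • cr A B + (-dt B (cr A M)) • cr A C := by
      rw [hDdef]
      refine vec3_ext ?_ ?_ ?_ <;>
        simp only [det3, dt, cr_zero, cr_one, cr_two, Pi.add_apply, Pi.smul_apply, smul_eq_mul] <;>
        ring
    have h := congrArg (fun v => D⁻¹ • v) this
    simp only [inv_smul_smul₀ hD, smul_add, smul_smul] at h
    rw [div_eq_inv_mul, div_eq_inv_mul]
    exact h
  have eB : ∀ M, cr B M =
      (dt C (cr B M) / D) • cr A B + (dt A (cr B M) / D) • cr B C := by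
    intro M
    have : D • cr B M = dt C (cr B M) • cr A B + (dt A (cr B M)) • cr B C := by
      rw [hDdef]
      refine vec3_ext ?_ ?_ ?_ <;>
        simp only [det3, dt, cr_zero, cr_one, cr_two, Pi.add_apply, Pi.smul_apply, smul_eq_mul] <;>
        ring
    have h := congrArg (fun v => D⁻¹ • v) this
    simp only [inv_smul_smul₀ hD, smul_add, smul_smul] at h
    rw [div_eq_inv_mul, div_eq_inv_mul]
    exact h
  have eC : ∀ M, cr C M =
      (-dt B (cr C M) / D) • cr A C + (dt A (cr C M) / D) • cr B C := by
    intro M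
    have : D • cr C M = (-dt B (cr C M)) • cr A C + (dt A (cr C M)) • cr B C := by
      rw [hDdef]
      refine vec3_ext ?_ ?_ ?_ <;>
        simp only [det3, dt, cr_zero, cr_one, cr_two, Pi.add_apply, Pi.smul_apply, smul_eq_mul] <;>
        ring
    have h := congrArg (fun v => D⁻¹ • v) this
    simp only [inv_smul_smul₀ hD, smul_add, smul_smul] at h
    rw [div_eq_inv_mul, div_eq_inv_mul]
    exact h
  have self : ∀ L M, dt L (cr L M) = 0 := fun L M => by
    simp only [dt, cr_zero, cr_one, cr_two]; ring
  refine ⟨q, fun M => ⟨?_, ?_, ?_⟩⟩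
  · rw [hq, self, congrArg (qf a) (eA M), qf_comb]
    field_simp
    ring
  · rw [hq, self, congrArg (qf b) (eB M), qf_comb, ← hab]
    field_simp
    ring
  · rw [hq, self, congrArg (qf c) (eC M), qf_comb, ← hac, ← hbc]
    field_simp
    ring

/-- The common quadratic form determines the function at almost all points. -/
lemma eq_common_form {SA SB : Set (Fin 3 → ℝ)} {H : (Fin 3 → ℝ) → ℝ}
    {a b : (Fin 3 → ℝ) → Fin 6 → ℝ} {q : Fin 6 → ℝ} {A B C : Fin 3 → ℝ}
    (ha : ∀ L ∈ SA, ∀ M ∈ SB, H (cr L M) = qf (a L) (cr L M))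
    (hb : ∀ M ∈ SB, ∀ L ∈ SA, H (cr L M) = qf (b M) (cr L M))
    (hA : A ∈ SA) (hB : B ∈ SA) (hC : C ∈ SA)
    (hq : ∀ M, qf q (cr A M) = qf (a A) (cr A M) ∧ qf q (cr B M) = qf (a B) (cr B M) ∧
      qf q (cr C M) = qf (a C) (cr C M)) {M : Fin 3 → ℝ} (hM : M ∈ SB)
    (h : det3 M A B * det3 M A C * det3 M B C ≠ 0) : ∀ L ∈ SA, H (cr L M) = qf q (cr L M) := by
  intro L hL
  have h1 := qf_four_points (b M) M A B C L
  have h2 := qf_four_points q M A B C L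
  rw [← hb M hM A hA, ha A hA M hM, ← (hq M).1, ← hb M hM B hB, ha B hB M hM, ← (hq M).2.1,
    ← hb M hM C hC, ha C hC M hM, ← (hq M).2.2] at h1
  rw [hb M hM L hL]
  have : (qf (b M) (cr L M) - qf q (cr L M)) * (det3 M A B * det3 M A C * det3 M B C) = 0 := by
    linear_combination h2 - h1
  exact sub_eq_zero.1 ((mul_eq_zero.1 this).resolve_right h)

/-- Two families of lines on which a function is quadratic: either the function is quadratic,
or both families are tangent to a common conic. -/
theorem quadratic_or_common_conic {SA SB : Set (Fin 3 → ℝ)} {H : (Fin 3 → ℝ) → ℝ}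
    (hA : IrrCone SA) (hB : IrrCone SB) (hn : NonPencil SA) (hB2 : ∃ x ∈ SB, ∃ y ∈ SB, cr x y ≠ 0)
    (h1 : ∀ L ∈ SA, ∃ q, ∀ M ∈ SB, H (cr L M) = qf q (cr L M))
    (h2 : ∀ M ∈ SB, ∃ q, ∀ L ∈ SA, H (cr L M) = qf q (cr L M)) :
    (∃ (q : Fin 6 → ℝ) (h : (Fin 3 → ℝ) → ℝ), PolyFun h ∧ (∃ M ∈ SB, h M ≠ 0) ∧
      ∀ M ∈ SB, h M ≠ 0 → ∀ L ∈ SA, H (cr L M) = qf q (cr L M)) ∨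
    ∃ G : MvPolynomial (Fin 3) ℝ, G ≠ 0 ∧ G.IsHomogeneous 2 ∧ (∀ x ∈ SA, eval x G = 0) ∧
      ∀ x ∈ SB, eval x G = 0 := by
  classical
  choose! a ha using h1
  choose! b hb using h2
  obtain ⟨x0, hx0, y0, hy0, hxy⟩ := hB2
  have hx00 : x0 ≠ 0 := by
    rintro rfl
    exact hxy (by refine vec3_ext ?_ ?_ ?_ <;> simp)
  have hcon : ∀ (L : Fin 3 → ℝ) (i : Fin 3), PolyFun fun _ => L i := fun L i => PolyFun.const _
  -- it suffices to find a generic triple of lines on which the forms agree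
  have finish : (∃ L1 ∈ SA, ∃ L2 ∈ SA, ∃ L3 ∈ SA, det3 L1 L2 L3 ≠ 0 ∧ det3 x0 L1 L2 ≠ 0 ∧
      det3 x0 L1 L3 ≠ 0 ∧ det3 x0 L2 L3 ≠ 0 ∧ qf (a L1) (cr L1 L2) = qf (a L2) (cr L1 L2) ∧
      qf (a L1) (cr L1 L3) = qf (a L3) (cr L1 L3) ∧
      qf (a L2) (cr L2 L3) = qf (a L3) (cr L2 L3)) →
      ∃ (q : Fin 6 → ℝ) (h : (Fin 3 → ℝ) → ℝ), PolyFun h ∧ (∃ M ∈ SB, h M ≠ 0) ∧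
        ∀ M ∈ SB, h M ≠ 0 → ∀ L ∈ SA, H (cr L M) = qf q (cr L M) := by
    rintro ⟨L1, m1, L2, m2, L3, m3, hD, n12, n13, n23, e12, e13, e23⟩
    obtain ⟨q, hq⟩ := exists_common_form hD e12 e13 e23
    refine ⟨q, fun M => det3 M L1 L2 * det3 M L1 L3 * det3 M L2 L3, ?_, ⟨x0, hx0, ?_⟩, ?_⟩
    · exact ((PolyFun.det3 PolyFun.coord (hcon _) (hcon _)).mul
        (PolyFun.det3 PolyFun.coord (hcon _) (hcon _))).mul
        (PolyFun.det3 PolyFun.coord (hcon _) (hcon _))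
    · exact mul_ne_zero (mul_ne_zero n12 n13) n23
    · exact fun M hM hne => eq_common_form ha hb m1 m2 m3 hq hM hne
  -- a generic triple with prescribed generic pairwise conditions
  have triple : ∀ (u : (Fin 3 → ℝ) → ℝ) (v : (Fin 3 → ℝ) → (Fin 3 → ℝ) → ℝ), PolyFun u →
      (∀ X, PolyFun (v X)) → (∃ X ∈ SA, u X ≠ 0) →
      (∀ X ∈ SA, u X ≠ 0 → ∃ Y ∈ SA, v X Y ≠ 0) →
      (∀ X ∈ SA, ∀ Y ∈ SA, u X ≠ 0 → u Y ≠ 0 → v X Y ≠ 0 →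
        qf (a X) (cr X Y) = qf (a Y) (cr X Y)) →
      ∃ L1 ∈ SA, ∃ L2 ∈ SA, ∃ L3 ∈ SA, det3 L1 L2 L3 ≠ 0 ∧ det3 x0 L1 L2 ≠ 0 ∧
        det3 x0 L1 L3 ≠ 0 ∧ det3 x0 L2 L3 ≠ 0 ∧ qf (a L1) (cr L1 L2) = qf (a L2) (cr L1 L2) ∧
        qf (a L1) (cr L1 L3) = qf (a L3) (cr L1 L3) ∧
        qf (a L2) (cr L2 L3) = qf (a L3) (cr L2 L3) := by
    intro u v hu hv hu0 hv0 huv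
    have hlin : ∀ k : Fin 3 → ℝ, PolyFun fun x => dt k x := fun k =>
      PolyFun.dt (hcon k) PolyFun.coord
    have hcr : ∀ x y : Fin 3 → ℝ, x ≠ 0 → dt x y = 0 → y ≠ 0 → cr x y ≠ 0 := by
      intro x y hx hxy hy h
      have : dt x x * dt y y = 0 := by
        have e : dt x x * dt y y = dt (cr x y) (cr x y) + dt x y ^ 2 := by
          simp only [dt, cr_zero, cr_one, cr_two]; ring
        rw [e, h, hxy]; simp [dt]
      rcases mul_eq_zero.1 this with h | h
      · exact hx (dt_self_eq_zero h)
      · exact hy (dt_self_eq_zero h)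
    obtain ⟨k, hk, hk0⟩ : ∃ k : Fin 3 → ℝ, k ≠ 0 ∧ dt k x0 = 0 := by
      by_cases h : x0 0 = 0 ∧ x0 1 = 0
      · exact ⟨![1, 0, 0], fun h => by simpa using congrFun h 0, by simp [dt, h.1]⟩
      · exact ⟨![x0 1, - x0 0, 0], fun h' => h ⟨by simpa using congrFun h' 1,
          by simpa using congrFun h' 0⟩, by simp [dt]; ring⟩
    have hcr0 : ∀ X : Fin 3 → ℝ, dt k X ≠ 0 → cr x0 X ≠ 0 := by
      intro X hX h
      have e : cr k (cr x0 X) = dt k X • x0 - dt k x0 • X := by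
        refine vec3_ext ?_ ?_ ?_ <;> simp [dt] <;> ring
      rw [h, hk0, zero_smul, sub_zero] at e
      have e' : cr k 0 = 0 := by refine vec3_ext ?_ ?_ ?_ <;> simp
      rw [e', eq_comm, smul_eq_zero] at e
      exact e.elim hX hx00
    obtain ⟨L1, m1, u1, k1⟩ := hA.exists_ne hu (hlin k) hu0 (hn k hk)
    have c1 := hcr0 L1 k1
    obtain ⟨L2, m2, h2, n12⟩ := hA.exists_ne (hu.mul (hv L1)) (hlin (cr x0 L1))
      (by simpa using hA.exists_ne hu (hv L1) hu0 (hv0 L1 m1 u1)) (hn _ c1)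
    obtain ⟨u2, v12⟩ := mul_ne_zero_iff.1 h2
    have c12 : cr L1 L2 ≠ 0 := by
      intro h
      rw [← det3_eq_dt_cr] at n12
      exact n12 (by rw [det3, h]; simp [dt])
    have c2 : cr x0 L2 ≠ 0 := by
      intro h
      rw [← det3_eq_dt_cr] at n12
      apply n12
      have : det3 x0 L1 L2 = - dt L1 (cr x0 L2) := by
        simp only [det3, dt, cr_zero, cr_one, cr_two]; ring
      rw [this, h]; simp [dt]
    have hx : ∃ X ∈ SA, (u X * v L1 X) * v L2 X ≠ 0 := by
      obtain ⟨X, hX, h, h'⟩ := hA.exists_ne (hu.mul (hv L1)) (hv L2)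
        (by simpa using hA.exists_ne hu (hv L1) hu0 (hv0 L1 m1 u1)) (hv0 L2 m2 u2)
      exact ⟨X, hX, mul_ne_zero h h'⟩
    have hy : ∃ X ∈ SA, (dt (cr L1 L2) X * dt (cr x0 L1) X) * dt (cr x0 L2) X ≠ 0 := by
      obtain ⟨X, hX, h, h'⟩ := hA.exists_ne ((hlin (cr L1 L2)).mul (hlin (cr x0 L1)))
        (hlin (cr x0 L2))
        (by simpa using hA.exists_ne (hlin (cr L1 L2)) (hlin (cr x0 L1)) (hn _ c12) (hn _ c1))
        (hn _ c2)
      exact ⟨X, hX, mul_ne_zero h h'⟩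
    obtain ⟨L3, m3, h, h'⟩ := hA.exists_ne ((hu.mul (hv L1)).mul (hv L2))
      (((hlin (cr L1 L2)).mul (hlin (cr x0 L1))).mul (hlin (cr x0 L2))) hx hy
    obtain ⟨hh, v23⟩ := mul_ne_zero_iff.1 h
    obtain ⟨u3, v13⟩ := mul_ne_zero_iff.1 hh
    obtain ⟨hh', n23⟩ := mul_ne_zero_iff.1 h'
    obtain ⟨n123, n13⟩ := mul_ne_zero_iff.1 hh'
    rw [← det3_eq_dt_cr] at n12 n13 n23 n123
    exact ⟨L1, m1, L2, m2, L3, m3, n123, n12, n13, n23, huv L1 m1 L2 m2 u1 u2 v12,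
      huv L1 m1 L3 m3 u1 u3 v13, huv L2 m2 L3 m3 u2 u3 v23⟩
  by_cases hI : ∃ P : MvPolynomial (Fin 3) ℝ, P ≠ 0 ∧ ∀ x ∈ SB, eval x P = 0
  swap
  · push Not at hI
    refine Or.inl (finish (triple (fun _ => 1) (fun _ _ => 1) (PolyFun.const _)
      (fun _ => PolyFun.const _) ?_ ?_ ?_))
    · obtain ⟨X, hX⟩ := hA.nonempty
      exact ⟨X, hX, one_ne_zero⟩
    · exact fun X hX _ => ⟨X, hX, one_ne_zero⟩
    · intro X hX Y hY _ _ _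
      by_contra hδ
      have hdvd : ∀ P : MvPolynomial (Fin 3) ℝ, (∀ M ∈ SB, eval M P = 0) →
          (0 : MvPolynomial (Fin 3) ℝ) ∣ P := by
        intro P hP
        by_contra h
        obtain ⟨x, hx, hne⟩ := hI P (fun h0 => h (by rw [h0]))
        exact hne (hP x hx)
      obtain ⟨κ, hκ, i, -, h⟩ := restrict_monomial hA hn hdvd ha hb hX hY hδ
      have := h 1
      rw [map_zero, one_pow, mul_one] at this
      exact hκ this.symm
  obtain ⟨G, d, hG, hGd, hd1, hGB⟩ := hB.exists_irreducible hI
  have hdvd : ∀ P : MvPolynomial (Fin 3) ℝ, (∀ M ∈ SB, eval M P = 0) → G ∣ P := fun P hP =>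
    hB.dvd_of_vanish hx0 hy0 hxy hG hGB hP
  by_cases hGA : ∀ x ∈ SA, eval x G = 0
  swap
  · push Not at hGA
    refine Or.inl (finish (triple (fun x => eval x G) (fun _ _ => 1) (PolyFun.ofPoly G)
      (fun _ => PolyFun.const _) hGA (fun X hX _ => ⟨X, hX, one_ne_zero⟩) ?_))
    intro X hX Y hY hX0 hY0 _
    exact forms_agree_of_not_vanish hA hn hdvd ha hb hGd hd1 hX hY hX0 hY0
  by_cases hd2 : d = 2
  · subst hd2
    exact Or.inr ⟨G, hG.ne_zero, hGd, hGA, hGB⟩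
  -- the gradient of `G` does not vanish identically on `SA`
  have hgrad : ∃ k, ∃ x ∈ SA, eval x (pderiv k G) ≠ 0 := by
    by_contra! hc
    obtain ⟨L1, m1, k1⟩ := hn (![1, 0, 0]) (fun h => by simpa using congrFun h 0)
    have hL1 : L1 ≠ 0 := by rintro rfl; simp [dt] at k1
    obtain ⟨L2, m2, h12⟩ : ∃ L2 ∈ SA, cr L1 L2 ≠ 0 := by
      obtain ⟨k, hk, hk0⟩ : ∃ k : Fin 3 → ℝ, k ≠ 0 ∧ dt k L1 = 0 := by
        refine ⟨![L1 1, - L1 0, 0], fun h' => ?_, by simp [dt]; ring⟩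
        have : L1 0 = 0 := by simpa using congrFun h' 1
        exact k1 (by simp [dt, this])
      obtain ⟨L2, m2, k2⟩ := hn k hk
      refine ⟨L2, m2, fun h => ?_⟩
      have e : cr k (cr L1 L2) = dt k L2 • L1 - dt k L1 • L2 := by
        refine vec3_ext ?_ ?_ ?_ <;> simp [dt] <;> ring
      rw [h, hk0, zero_smul, sub_zero] at e
      have e' : cr k 0 = 0 := by refine vec3_ext ?_ ?_ ?_ <;> simp
      rw [e', eq_comm, smul_eq_zero] at e
      exact e.elim k2 hL1
    have hz : ∀ k, pderiv k G = 0 := by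
      intro k
      by_contra h0
      have hdv := hA.dvd_of_vanish m1 m2 h12 hG hGA (hc k)
      have h3 := totalDegree_le_of_dvd_of_isDomain hdv h0
      have h4 := (hGd.pderiv (i := k)).totalDegree_le
      rw [hGd.totalDegree hG.ne_zero] at h3
      omega
    have he := hGd.sum_X_mul_pderiv
    simp only [hz, mul_zero, Finset.sum_const_zero] at he
    rw [eq_comm, smul_eq_zero] at he
    rcases he with h | h
    · omega
    · exact hG.ne_zero h
  obtain ⟨k, z, hz, hzk⟩ := hgrad
  have hgz : (fun k => eval z (pderiv k G)) ≠ 0 := fun h => hzk (congrFun h k)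
  have hzD : ∃ X ∈ SA, dirD G z X ≠ 0 := by
    obtain ⟨X, hX, h⟩ := hn _ hgz
    exact ⟨X, hX, by rwa [dirD, dt_comm]⟩
  have hpD : ∀ X, PolyFun fun Y => dirD G X Y := fun X =>
    PolyFun.dt PolyFun.coord fun i => PolyFun.const _
  have hpD' : ∀ X, PolyFun fun Y => dirD G Y X := fun X =>
    PolyFun.dt (hcon X) fun i => PolyFun.ofPoly _
  refine Or.inl (finish (triple (fun x => eval x (pderiv k G) * dirD G z x)
    (fun X Y => dirD G X Y * dirD G Y X)
    ((PolyFun.ofPoly _).mul (hpD z)) (fun X => (hpD X).mul (hpD' X)) ?_ ?_ ?_))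
  · simpa using hA.exists_ne (PolyFun.ofPoly (pderiv k G)) (hpD z) ⟨z, hz, hzk⟩ hzD
  · intro X hX h
    obtain ⟨h1, h2⟩ := mul_ne_zero_iff.1 h
    have hgX : (fun k => eval X (pderiv k G)) ≠ 0 := fun h => h1 (congrFun h k)
    obtain ⟨Y, hY, hXY⟩ := hn _ hgX
    rw [dt_comm] at hXY
    simpa using hA.exists_ne (hpD X) (hpD' X) ⟨Y, hY, hXY⟩ ⟨z, hz, h2⟩
  · intro X hX Y hY _ _ hv
    obtain ⟨v1, v2⟩ := mul_ne_zero_iff.1 hv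
    exact forms_agree_of_vanish hA hn hdvd ha hb hGd hd2 hX hY v1 v2 (hGA X hX) (hGA Y hY)

lemma MvPolynomial.IsHomogeneous.isQuad {G : MvPolynomial (Fin 3) ℝ} (hG : G.IsHomogeneous 2) :
    IsQuad fun x => eval x G := by
  have hlin : ∀ p ∈ homogeneousSubmodule (Fin 3) ℝ 1, ∃ k, ∀ x, eval x p = dt k x := by
    intro p hp
    rw [homogeneousSubmodule_one_eq_span_X] at hp
    induction hp using Submodule.span_induction with
    | mem p hp =>
      obtain ⟨i, rfl⟩ := hp
      refine ⟨Pi.single i 1, fun x => ?_⟩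
      fin_cases i <;> simp [dt]
    | zero => exact ⟨0, fun x => by simp [dt]⟩
    | add p q _ _ hp hq =>
      obtain ⟨k, hk⟩ := hp
      obtain ⟨l, hl⟩ := hq
      exact ⟨k + l, fun x => by rw [map_add, hk, hl]; simp only [dt, Pi.add_apply]; ring⟩
    | smul a p _ hp =>
      obtain ⟨k, hk⟩ := hp
      exact ⟨a • k, fun x => by
        rw [smul_eval, hk]; simp only [dt, Pi.smul_apply, smul_eq_mul]; ring⟩
  have h2 : G ∈ homogeneousSubmodule (Fin 3) ℝ 1 * homogeneousSubmodule (Fin 3) ℝ 1 := by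
    rw [← pow_two, homogeneousSubmodule_one_pow]
    exact hG
  induction h2 using Submodule.mul_induction_on' with
  | mem_mul_mem p hp q hq =>
    obtain ⟨k, hk⟩ := hlin p hp
    obtain ⟨l, hl⟩ := hlin q hq
    simpa [hk, hl] using IsQuad.of_mul 1 k l
  | add p hp q hq h1 h2 =>
    have hsub : homogeneousSubmodule (Fin 3) ℝ 1 * homogeneousSubmodule (Fin 3) ℝ 1 =
      homogeneousSubmodule (Fin 3) ℝ 2 := by rw [← pow_two, homogeneousSubmodule_one_pow]
    rw [hsub] at hp hq
    simpa using (h1 hp).add (h2 hq)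

/-- The linear form polar to a vector with respect to a quadratic form. -/
def qgrad (c : Fin 6 → ℝ) (x : Fin 3 → ℝ) : Fin 3 → ℝ :=
  ![2 * c 0 * x 0 + c 3 * x 1 + c 4 * x 2, c 3 * x 0 + 2 * c 1 * x 1 + c 5 * x 2,
    c 4 * x 0 + c 5 * x 1 + 2 * c 2 * x 2]

lemma dt_qgrad_comm (c : Fin 6 → ℝ) (x y : Fin 3 → ℝ) :
    dt (qgrad c x) y = dt (qgrad c y) x := by
  simp only [qgrad, dt, Matrix.cons_val]; ring

/-- A conic containing an irreducible cone that is not a pencil has a standard equation. -/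
theorem exists_conic_normal_form {S : Set (Fin 3 → ℝ)} (hS : IrrCone S) (hn : NonPencil S)
    {c : Fin 6 → ℝ} (hc : ∃ x, qf c x ≠ 0) (hcS : ∀ x ∈ S, qf c x = 0) :
    ∃ e0 e1 e2 : Fin 3 → ℝ, det3 e0 e1 e2 ≠ 0 ∧
      ∀ s0 s1 s2 : ℝ, qf c (s0 • e0 + s1 • e1 + s2 • e2) = 0 → s1 ^ 2 = s0 * s2 := by
  obtain ⟨y, hy⟩ := hc
  have hself : ∀ x, dt (qgrad c x) x = 2 * qf c x := fun x => by
    simp only [qgrad, dt, qf, Matrix.cons_val]; ring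
  have hne : ∀ x z, dt (qgrad c x) z ≠ 0 → qgrad c z ≠ 0 := by
    intro x z h h0
    rw [dt_qgrad_comm, h0] at h
    simp [dt] at h
  have hy0 : qgrad c y ≠ 0 := hne y y (by rw [hself]; simpa using hy)
  obtain ⟨L1, m1, h1⟩ := hn _ hy0
  have g1 := hne _ _ h1
  obtain ⟨L2, m2, h2, h12⟩ := NonPencil.exists_ne_ne hS hn hy0 g1
  have g2 := hne _ _ h2
  have c12 : cr L1 L2 ≠ 0 := by
    intro h
    have hL1 : L1 ≠ 0 := by rintro rfl; simp [dt] at h1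
    have e : dt L1 L1 • L2 = dt L1 L2 • L1 - cr L1 (cr L1 L2) := by
      refine vec3_ext ?_ ?_ ?_ <;> simp [dt] <;> ring
    have e0 : cr L1 0 = 0 := by refine vec3_ext ?_ ?_ ?_ <;> simp
    rw [h, e0, sub_zero] at e
    have hsm : ∀ (r : ℝ) z, dt (qgrad c L1) (r • z) = r * dt (qgrad c L1) z := fun r z => by
      simp only [dt, Pi.smul_apply, smul_eq_mul]; ring
    have := congrArg (dt (qgrad c L1)) e
    rw [hsm, hsm, hself, hcS L1 m1, mul_zero, mul_zero, mul_eq_zero] at this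
    exact this.elim (fun h => hL1 (dt_self_eq_zero h)) h12
  have hlin : ∀ k : Fin 3 → ℝ, PolyFun fun x => dt k x := fun k =>
    PolyFun.dt (fun _ => PolyFun.const _) PolyFun.coord
  obtain ⟨L3, m3, hh, h23⟩ := hS.exists_ne ((hlin (cr L1 L2)).mul (hlin (qgrad c L1)))
    (hlin (qgrad c L2)) (by simpa using NonPencil.exists_ne_ne hS hn c12 g1) (hn _ g2)
  obtain ⟨hD, h13⟩ := mul_ne_zero_iff.1 hh
  set b12 := dt (qgrad c L1) L2 with hb12
  set b13 := dt (qgrad c L1) L3 with hb13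
  set b23 := dt (qgrad c L2) L3 with hb23
  have hq : ∀ x1 x2 x3 : ℝ, qf c (x1 • L1 + x2 • L2 + x3 • L3) =
      x1 * x2 * b12 + x1 * x3 * b13 + x2 * x3 * b23 := by
    intro x1 x2 x3
    have : qf c (x1 • L1 + x2 • L2 + x3 • L3) = x1 ^ 2 * qf c L1 + x2 ^ 2 * qf c L2 +
        x3 ^ 2 * qf c L3 + (x1 * x2 * b12 + x1 * x3 * b13 + x2 * x3 * b23) := by
      simp only [hb12, hb13, hb23, qgrad, dt, qf, Matrix.cons_val, Pi.add_apply, Pi.smul_apply,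
        smul_eq_mul]
      ring
    rw [this, hcS L1 m1, hcS L2 m2, hcS L3 m3]
    ring
  refine ⟨L1, (-(b23 / b12)) • L1 + (-(b13 / b12)) • L2 + L3, (b13 * b23 / b12 ^ 2) • L2, ?_, ?_⟩
  · have : det3 L1 ((-(b23 / b12)) • L1 + (-(b13 / b12)) • L2 + L3) ((b13 * b23 / b12 ^ 2) • L2) =
        -(b13 * b23 / b12 ^ 2) * dt (cr L1 L2) L3 := by
      simp only [det3, dt, cr_zero, cr_one, cr_two, Pi.add_apply, Pi.smul_apply, smul_eq_mul]
      ring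
    rw [this]
    exact mul_ne_zero (neg_ne_zero.2 (div_ne_zero (mul_ne_zero h13 h23) (pow_ne_zero 2 h12))) hD
  · intro s0 s1 s2 h
    have e : s0 • L1 + s1 • ((-(b23 / b12)) • L1 + (-(b13 / b12)) • L2 + L3) +
        s2 • ((b13 * b23 / b12 ^ 2) • L2) =
        (s0 - s1 * (b23 / b12)) • L1 + (s2 * (b13 * b23 / b12 ^ 2) - s1 * (b13 / b12)) • L2 +
          s1 • L3 := by
      refine vec3_ext ?_ ?_ ?_ <;> simp <;> ring
    rw [e, hq] at h
    have h' : (b13 * b23 / b12) * (s0 * s2 - s1 ^ 2) = 0 := by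
      rw [← h]
      field_simp
      ring
    have := (mul_eq_zero.1 h').resolve_left (div_ne_zero (mul_ne_zero h13 h23) h12)
    linarith

section

open Filter Topology

/-- An injectively parametrized analytic surface in `ℝ³`. -/
structure IsSurface (U : Set (ℝ × ℝ)) (φ : ℝ × ℝ → R3) : Prop where
  isOpen : IsOpen U
  isConnected : IsConnected U
  analytic : AnalyticOnNhd ℝ φ U
  injOn : InjOn φ U
  immersion : ∀ p ∈ U, Function.Injective (fderiv ℝ φ p)

/-- An analytic family of arcs of vertical parabolas on a surface. -/
structure IsArcFamily (U : Set (ℝ × ℝ)) (φ : ℝ × ℝ → R3) (γ : ℝ × ℝ → ℝ → R3)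
    (C : ℝ × ℝ → Set R3) : Prop where
  analytic : AnalyticOnNhd ℝ (fun q : (ℝ × ℝ) × ℝ => γ q.1 q.2) (U ×ˢ univ)
  zero : ∀ p ∈ U, γ p 0 = φ p
  parabola : ∀ p ∈ U, IsVerticalParabola (C p)
  subset : ∀ p ∈ U, γ p '' Ioo (-1 : ℝ) 1 ⊆ C p ∩ φ '' U
  deriv_ne : ∀ p ∈ U, deriv (γ p) 0 ≠ 0

section
variable {U : Set (ℝ × ℝ)} {φ : ℝ × ℝ → R3} {γ : ℝ × ℝ → ℝ → R3} {C : ℝ × ℝ → Set R3}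
  {p : ℝ × ℝ}

namespace IsSurface

lemma dimH_image_le (hS : IsSurface U φ) : dimH (φ '' U) ≤ 2 := by
  refine (dimH_image_le_of_locally_lipschitzOn (s := U) fun x hx => ?_).trans ?_
  · obtain ⟨K, s, hs, hK⟩ := (hS.analytic x hx).hasStrictFDerivAt.exists_lipschitzOnWith
    exact ⟨K, s, mem_nhdsWithin_of_mem_nhds hs, hK⟩
  · refine (dimH_mono (subset_univ U)).trans ?_
    rw [Real.dimH_univ_eq_finrank, Module.finrank_prod]
    simp

end IsSurface

namespace IsArcFamily

lemma analyticAt (hγ : IsArcFamily U φ γ C) (hp : p ∈ U) (t : ℝ) : 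
    AnalyticAt ℝ (fun q : (ℝ × ℝ) × ℝ => γ q.1 q.2) (p, t) :=
  hγ.analytic (p, t) ⟨hp, mem_univ t⟩

lemma analyticAt_arc (hγ : IsArcFamily U φ γ C) (hp : p ∈ U) (t : ℝ) : AnalyticAt ℝ (γ p) t :=
  AnalyticAt.comp_of_eq (f := fun s : ℝ => (p, s)) (hγ.analyticAt hp t)
    (AnalyticAt.prod analyticAt_const analyticAt_id) rfl

lemma hasDerivAt (hγ : IsArcFamily U φ γ C) (hp : p ∈ U) (t : ℝ) :
    HasDerivAt (γ p) (deriv (γ p) t) t :=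
  (hγ.analyticAt_arc hp t).differentiableAt.hasDerivAt

lemma fderiv_apply (hS : IsSurface U φ) (hγ : IsArcFamily U φ γ C) (hp : p ∈ U)
    (v : ℝ × ℝ) (s : ℝ) :
    fderiv ℝ (fun q : (ℝ × ℝ) × ℝ => γ q.1 q.2) (p, 0) (v, s) =
      fderiv ℝ φ p v + s • deriv (γ p) 0 := by
  have hF := (hγ.analyticAt hp 0).differentiableAt.hasFDerivAt
  have h1 : (fderiv ℝ (fun q : (ℝ × ℝ) × ℝ => γ q.1 q.2) (p, 0)).comp
      (ContinuousLinearMap.inl ℝ (ℝ × ℝ) ℝ) = fderiv ℝ φ p := by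
    have h := HasFDerivAt.comp p (f := fun x : ℝ × ℝ => (x, (0 : ℝ))) hF
      (hasFDerivAt_prodMk_left p 0)
    refine HasFDerivAt.unique h ?_
    refine (hS.analytic p hp).differentiableAt.hasFDerivAt.congr_of_eventuallyEq ?_
    filter_upwards [hS.isOpen.mem_nhds hp] with x hx using hγ.zero x hx
  have h2 : fderiv ℝ (fun q : (ℝ × ℝ) × ℝ => γ q.1 q.2) (p, 0) (0, 1) = deriv (γ p) 0 := by
    have h := HasFDerivAt.comp_hasDerivAt (0 : ℝ) (f := fun t : ℝ => (p, t)) hF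
      ((hasDerivAt_const (0 : ℝ) p).prodMk (hasDerivAt_id (0 : ℝ)))
    exact h.unique (hγ.hasDerivAt hp 0)
  have h3 : ((v, s) : (ℝ × ℝ) × ℝ) = ContinuousLinearMap.inl ℝ (ℝ × ℝ) ℝ v + s • (0, 1) := by
    simp
  rw [h3, map_add, map_smul, h2, ← h1]
  rfl

lemma deriv_mem_range (hS : IsSurface U φ) (hγ : IsArcFamily U φ γ C) (hp : p ∈ U) :
    ∃ v, fderiv ℝ φ p v = deriv (γ p) 0 := by
  by_contra! hne
  set F' := fderiv ℝ (fun q : (ℝ × ℝ) × ℝ => γ q.1 q.2) (p, 0) with hF'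
  have hinj : Function.Injective F'.toLinearMap := by
    rw [← LinearMap.ker_eq_bot, LinearMap.ker_eq_bot']
    rintro ⟨v, s⟩ h
    have h : fderiv ℝ φ p v + s • deriv (γ p) 0 = 0 := by
      rw [← fderiv_apply hS hγ hp]; exact h
    by_cases hs : s = 0
    · subst hs
      simp only [zero_smul, add_zero] at h
      rw [hS.immersion p hp (h.trans (map_zero _).symm)]
      rfl
    · refine absurd ?_ (hne (-(s⁻¹ • v)))
      rw [map_neg, map_smul, eq_neg_of_add_eq_zero_left h, smul_neg, neg_neg, smul_smul,
        inv_mul_cancel₀ hs, one_smul]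
  have hsurj : F'.toLinearMap.range = ⊤ := by
    rw [LinearMap.range_eq_top]
    refine (LinearMap.injective_iff_surjective_of_finrank_eq_finrank ?_).1 hinj
    simp [Module.finrank_prod]
  have hmap := (hγ.analyticAt hp 0).hasStrictFDerivAt.map_nhds_eq_of_surj hsurj
  have hmem : φ '' U ∈ 𝓝 (γ p 0) := by
    rw [← hmap, mem_map]
    filter_upwards [prod_mem_nhds (hS.isOpen.mem_nhds hp)
      (Ioo_mem_nhds (neg_one_lt_zero (R := ℝ)) zero_lt_one)] with q hq
    exact (hγ.subset q.1 hq.1 (mem_image_of_mem _ hq.2)).2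
  have h3 := Real.dimH_of_mem_nhds hmem
  have h2 := hS.dimH_image_le
  rw [h3] at h2
  simp only [Module.finrank_prod, Module.finrank_self] at h2
  norm_num at h2

end IsArcFamily
end

/-- The top view of a point of `ℝ³`, i.e. its projection to the plane `Oxy`. -/
def topView (w : R3) : ℝ × ℝ := (w.1, w.2.1)

/-- The two-dimensional determinant. -/
def det2 (v w : ℝ × ℝ) : ℝ := v.1 * w.2 - v.2 * w.1

section
variable {U : Set (ℝ × ℝ)} {φ : ℝ × ℝ → R3} {γ γ₁ γ₂ : ℝ × ℝ → ℝ → R3} {C C₁ C₂ : ℝ × ℝ → Set R3}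
  {p : ℝ × ℝ}

namespace IsArcFamily

lemma normal_form (hγ : IsArcFamily U φ γ C) (hp : p ∈ U) :
    topView (deriv (γ p) 0) ≠ 0 ∧ ∃ A B : ℝ, A ≠ 0 ∧ C p = range fun s : ℝ =>
      ((φ p).1 + s * (deriv (γ p) 0).1, (φ p).2.1 + s * (deriv (γ p) 0).2.1,
        A * s ^ 2 + B * s + (φ p).2.2) := by
  obtain ⟨x0, y0, dx, dy, a, b, c, ha, hd, hC⟩ := hγ.parabola p hp
  have hn : dx ^ 2 + dy ^ 2 ≠ 0 := by
    intro h
    apply hd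
    have h1 : dx = 0 := by nlinarith [sq_nonneg dx, sq_nonneg dy]
    have h2 : dy = 0 := by nlinarith [sq_nonneg dx, sq_nonneg dy]
    rw [h1, h2]
  set τ : ℝ → ℝ := fun t => (((γ p t).1 - x0) * dx + ((γ p t).2.1 - y0) * dy) / (dx ^ 2 + dy ^ 2)
    with hτ
  have hmem : ∀ t ∈ Ioo (-1 : ℝ) 1,
      γ p t = (x0 + τ t * dx, y0 + τ t * dy, a * τ t ^ 2 + b * τ t + c) := by
    intro t ht
    have h := (hγ.subset p hp (mem_image_of_mem _ ht)).1
    rw [hC] at h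
    obtain ⟨s, hs⟩ := h
    have : τ t = s := by
      simp only [hτ, ← hs]
      field_simp
      ring
    rw [this, ← hs]
  have hD := hγ.hasDerivAt hp 0
  set w := deriv (γ p) 0
  have hτd : HasDerivAt τ ((w.1 * dx + w.2.1 * dy) / (dx ^ 2 + dy ^ 2)) 0 := by
    have h1 : HasDerivAt (fun t => (γ p t).1) w.1 0 := hD.fst
    have h2 : HasDerivAt (fun t => (γ p t).2.1) w.2.1 0 := hD.snd.fst
    exact (((h1.sub_const x0).mul_const dx).add ((h2.sub_const y0).mul_const dy)).div_const _
  set τ' := (w.1 * dx + w.2.1 * dy) / (dx ^ 2 + dy ^ 2)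
  have hw : w = (τ' * dx, τ' * dy, (2 * a * τ 0 + b) * τ') := by
    refine hD.unique ?_
    have h : HasDerivAt (fun t => (x0 + τ t * dx, y0 + τ t * dy, a * τ t ^ 2 + b * τ t + c))
        (τ' * dx, τ' * dy, (2 * a * τ 0 + b) * τ') 0 := by
      refine ((hτd.mul_const dx).const_add x0).prodMk (((hτd.mul_const dy).const_add y0).prodMk ?_)
      have h2 : HasDerivAt (fun t => a * τ t ^ 2 + b * τ t + c) _ 0 :=
        (((hτd.fun_pow 2).const_mul a).add (hτd.const_mul b)).add_const c
      refine h2.congr_deriv ?_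
      norm_num; ring
    refine h.congr_of_eventuallyEq ?_
    filter_upwards [Ioo_mem_nhds (neg_one_lt_zero (R := ℝ)) zero_lt_one] with t ht using hmem t ht
  have hτ0 : τ' ≠ 0 := by
    intro h
    refine hγ.deriv_ne p hp ?_
    change w = 0
    rw [hw, h]; simp
  have hφ : φ p = (x0 + τ 0 * dx, y0 + τ 0 * dy, a * τ 0 ^ 2 + b * τ 0 + c) := by
    rw [← hγ.zero p hp]; exact hmem 0 (by norm_num)
  refine ⟨?_, a * τ' ^ 2, 2 * a * τ 0 * τ' + b * τ', mul_ne_zero ha (pow_ne_zero 2 hτ0), ?_⟩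
  · rw [hw]
    intro h
    rw [topView, Prod.mk_eq_zero] at h
    apply hd
    rw [Prod.mk_zero_zero, Prod.mk_eq_zero]
    exact ⟨(mul_eq_zero.1 h.1).resolve_left hτ0, (mul_eq_zero.1 h.2).resolve_left hτ0⟩
  · rw [hC, hw, hφ]
    ext q
    constructor
    · rintro ⟨t, rfl⟩
      refine ⟨(t - τ 0) / τ', ?_⟩
      simp only [Prod.mk.injEq]
      refine ⟨?_, ?_, ?_⟩ <;> field_simp <;> ring
    · rintro ⟨s, rfl⟩
      refine ⟨τ 0 + s * τ', ?_⟩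
      simp only [Prod.mk.injEq]
      refine ⟨?_, ?_, ?_⟩ <;> ring

/-- Two arcs not lying in a common plane have transversal top views. -/
lemma det2_ne_zero (h₁ : IsArcFamily U φ γ₁ C₁) (h₂ : IsArcFamily U φ γ₂ C₂) (hp : p ∈ U)
    (hns : ¬∃ S : Set R3, IsPlane3 S ∧
      γ₁ p '' Ioo (-1 : ℝ) 1 ⊆ S ∧ γ₂ p '' Ioo (-1 : ℝ) 1 ⊆ S) :
    det2 (topView (deriv (γ₁ p) 0)) (topView (deriv (γ₂ p) 0)) ≠ 0 := by
  intro h0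
  apply hns
  obtain ⟨hd, A, B, -, hC₁⟩ := h₁.normal_form hp
  obtain ⟨-, A', B', -, hC₂⟩ := h₂.normal_form hp
  set w := deriv (γ₁ p) 0
  set w' := deriv (γ₂ p) 0
  have h0 : w.1 * w'.2.1 - w.2.1 * w'.1 = 0 := h0
  refine ⟨{q | w.2.1 * q.1 + -w.1 * q.2.1 + 0 * q.2.2 = w.2.1 * (φ p).1 - w.1 * (φ p).2.1},
    ⟨_, _, _, _, ?_, rfl⟩, ?_, ?_⟩
  · intro h
    apply hd
    simp only [Prod.mk.injEq, neg_eq_zero] at h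
    rw [topView, Prod.mk_eq_zero]
    exact ⟨h.2.1, h.1⟩
  · intro q hq
    have := (h₁.subset p hp hq).1
    rw [hC₁] at this
    obtain ⟨s, rfl⟩ := this
    simp only [mem_ofPred_eq]; ring
  · intro q hq
    have := (h₂.subset p hp hq).1
    rw [hC₂] at this
    obtain ⟨s, rfl⟩ := this
    simp only [mem_ofPred_eq]; linear_combination -s * h0

end IsArcFamily
end

/-- The analytic inverse function theorem in finite dimension, with a Lipschitz inverse. -/
lemma AnalyticAt.exists_openPartialHomeomorph {E : Type*} [NormedAddCommGroup E] [NormedSpace ℝ E]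
    [FiniteDimensional ℝ E] [CompleteSpace E] {f : E → E} {a : E} (hf : AnalyticAt ℝ f a)
    (hinj : ∀ v, fderiv ℝ f a v = 0 → v = 0) {V : Set E} (hV : IsOpen V) (ha : a ∈ V) :
    ∃ e : OpenPartialHomeomorph E E, a ∈ e.source ∧ e.source ⊆ V ∧ ⇑e = f ∧
      ∃ K, LipschitzOnWith K e.symm e.target := by
  have hker : (fderiv ℝ f a).toLinearMap.ker = ⊥ := LinearMap.ker_eq_bot'.2 hinj
  have hrange : (fderiv ℝ f a).toLinearMap.range = ⊤ :=
    LinearMap.range_eq_top.2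
      ((LinearMap.injective_iff_surjective_of_finrank_eq_finrank rfl).1
        (LinearMap.ker_eq_bot.1 hker))
  set f' : E ≃L[ℝ] E := ContinuousLinearEquiv.ofBijective (fderiv ℝ f a) hker hrange
  have h : HasStrictFDerivAt f (f' : E →L[ℝ] E) a := by
    rw [ContinuousLinearEquiv.coe_ofBijective]
    exact hf.hasStrictFDerivAt
  set e := h.toOpenPartialHomeomorph f
  obtain ⟨K, s, hs, hK⟩ := h.to_localInverse.exists_lipschitzOnWith
  obtain ⟨t, hts, ht, hat⟩ := mem_nhds_iff.1 hs
  set e₁ := (e.symm.restrOpen t ht).symm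
  refine ⟨e₁.restrOpen V hV, ?_, ?_, rfl, K, hK.mono ?_⟩
  · have hat' : a ∈ e.source := h.mem_toOpenPartialHomeomorph_source
    rw [OpenPartialHomeomorph.restrOpen_source]
    refine ⟨?_, ha⟩
    have : e a ∈ e₁.target := by
      change e a ∈ (e.symm.restrOpen t ht).source
      rw [OpenPartialHomeomorph.restrOpen_source]
      exact ⟨e.map_source hat', hat⟩
    have h2 := e₁.map_target this
    have h3 : e₁.symm (e a) = a := e.left_inv hat'
    rwa [h3] at h2
  · rw [OpenPartialHomeomorph.restrOpen_source]
    exact inter_subset_right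
  · have h1 : (e₁.restrOpen V hV).target ⊆ e₁.target := by
      intro y hy
      have := (e₁.restrOpen V hV).map_target hy
      rw [OpenPartialHomeomorph.restrOpen_source] at this
      have h2 := e₁.map_source this.1
      have h3 := (e₁.restrOpen V hV).right_inv hy
      rw [← h3]; exact h2
    refine h1.trans ?_
    change (e.symm.restrOpen t ht).source ⊆ s
    rw [OpenPartialHomeomorph.restrOpen_source]
    exact inter_subset_right.trans hts

lemma AnalyticAt.topView {E : Type*} [NormedAddCommGroup E] [NormedSpace ℝ E] {f : E → R3} {a : E}
    (hf : AnalyticAt ℝ f a) : AnalyticAt ℝ (fun x => topView (f x)) a := by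
  have h1 : AnalyticAt ℝ (fun x => (f x).1) a := analyticAt_fst.comp_of_eq hf rfl
  have h2 : AnalyticAt ℝ (fun x => (f x).2) a := analyticAt_snd.comp_of_eq hf rfl
  exact h1.prod (analyticAt_fst.comp_of_eq h2 rfl)

/-- The top view as a continuous linear map. -/
def topViewL : R3 →L[ℝ] ℝ × ℝ :=
  (ContinuousLinearMap.fst ℝ ℝ (ℝ × ℝ)).prod
    ((ContinuousLinearMap.fst ℝ ℝ ℝ).comp (ContinuousLinearMap.snd ℝ ℝ (ℝ × ℝ)))

lemma continuous_topView : Continuous topView := topViewL.continuous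

/-- Two analytic families of arcs of vertical parabolas on a surface, with transversal top views. -/
structure IsDoubleArcFamily (U : Set (ℝ × ℝ)) (φ : ℝ × ℝ → R3) (γ₁ γ₂ : ℝ × ℝ → ℝ → R3)
    (C₁ C₂ : ℝ × ℝ → Set R3) : Prop where
  surface : IsSurface U φ
  left : IsArcFamily U φ γ₁ C₁
  right : IsArcFamily U φ γ₂ C₂
  det_ne : ∀ p ∈ U, det2 (topView (deriv (γ₁ p) 0)) (topView (deriv (γ₂ p) 0)) ≠ 0

namespace IsDoubleArcFamily
variable {U : Set (ℝ × ℝ)} {φ : ℝ × ℝ → R3} {γ₁ γ₂ : ℝ × ℝ → ℝ → R3} {C₁ C₂ : ℝ × ℝ → Set R3}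
  {p : ℝ × ℝ}

lemma symm (h : IsDoubleArcFamily U φ γ₁ γ₂ C₁ C₂) : IsDoubleArcFamily U φ γ₂ γ₁ C₂ C₁ where
  surface := h.surface
  left := h.right
  right := h.left
  det_ne p hp h0 := h.det_ne p hp (by unfold det2 at *; linarith)

lemma fderiv_topView (h : IsDoubleArcFamily U φ γ₁ γ₂ C₁ C₂) (hp : p ∈ U) (v : ℝ × ℝ) :
    fderiv ℝ (fun x => topView (φ x)) p v = topView (fderiv ℝ φ p v) := by
  have := topViewL.hasFDerivAt.comp p (h.surface.analytic p hp).differentiableAt.hasFDerivAt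
  have h2 : HasFDerivAt (fun x => topView (φ x)) (topViewL.comp (fderiv ℝ φ p)) p := this
  rw [h2.fderiv]; rfl

lemma fderiv_topView_injective (h : IsDoubleArcFamily U φ γ₁ γ₂ C₁ C₂) (hp : p ∈ U) (v : ℝ × ℝ)
    (hv : fderiv ℝ (fun x => topView (φ x)) p v = 0) : v = 0 := by
  set T := (fderiv ℝ (fun x => topView (φ x)) p).toLinearMap
  have hsurj : Function.Surjective T := by
    obtain ⟨v₁, h₁⟩ := h.left.deriv_mem_range h.surface hp
    obtain ⟨v₂, h₂⟩ := h.right.deriv_mem_range h.surface hp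
    have hd := h.det_ne p hp
    have e₁ : T v₁ = topView (deriv (γ₁ p) 0) := by rw [← h₁, ← h.fderiv_topView hp]; rfl
    have e₂ : T v₂ = topView (deriv (γ₂ p) 0) := by rw [← h₂, ← h.fderiv_topView hp]; rfl
    set d₁ := topView (deriv (γ₁ p) 0)
    set d₂ := topView (deriv (γ₂ p) 0)
    intro y
    refine ⟨(det2 y d₂ / det2 d₁ d₂) • v₁ + (det2 d₁ y / det2 d₁ d₂) • v₂, ?_⟩
    rw [map_add, map_smul, map_smul, e₁, e₂]
    ext <;> simp <;> field_simp <;> simp only [det2] <;> ring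
  have hinj := (LinearMap.injective_iff_surjective_of_finrank_eq_finrank rfl).2 hsurj
  exact hinj (hv.trans (map_zero T).symm)

/-- The top view is a local coordinate on the surface. -/
lemma exists_chart (h : IsDoubleArcFamily U φ γ₁ γ₂ C₁ C₂) (hp : p ∈ U) :
    ∃ e : OpenPartialHomeomorph (ℝ × ℝ) (ℝ × ℝ), p ∈ e.source ∧ e.source ⊆ U ∧
      (⇑e = fun x => topView (φ x)) ∧ ∃ K, LipschitzOnWith K e.symm e.target :=
  (h.surface.analytic p hp).topView.exists_openPartialHomeomorph
    (h.fderiv_topView_injective hp) h.surface.isOpen hp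

lemma countable_fiber (h : IsDoubleArcFamily U φ γ₁ γ₂ C₁ C₂) (q : ℝ × ℝ) :
    {x ∈ U | topView (φ x) = q}.Countable := by
  set S := {x ∈ U | topView (φ x) = q}
  have : ∀ x : ℝ × ℝ, ∃ s : Set (ℝ × ℝ), x ∈ S → s ∈ 𝓝[S] x ∧ s ∩ S ⊆ {x} := by
    intro x
    by_cases hx : x ∈ S
    · obtain ⟨e, hxe, -, he, -⟩ := h.exists_chart hx.1
      refine ⟨e.source, fun _ => ⟨mem_nhdsWithin_of_mem_nhds (e.open_source.mem_nhds hxe), ?_⟩⟩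
      rintro y ⟨hye, hy⟩
      refine e.injOn hye hxe ?_
      rw [he]; exact hy.2.trans hx.2.symm
    · exact ⟨∅, fun h => absurd h hx⟩
  choose s hs using this
  obtain ⟨t, htS, htc, ht⟩ := TopologicalSpace.countable_cover_nhdsWithin fun x hx => (hs x hx).1
  refine htc.mono fun x hx => ?_
  obtain ⟨y, hy, hxy⟩ := mem_iUnion₂.1 (ht hx)
  rw [(hs y (htS hy)).2 ⟨hxy, hx⟩]
  exact hy

/-- The arcs through nearby points stay in the graph of a function over the top view. -/
lemma eventually_arc_eq (h : IsDoubleArcFamily U φ γ₁ γ₂ C₁ C₂)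
    {e : OpenPartialHomeomorph (ℝ × ℝ) (ℝ × ℝ)} (hpe : p ∈ e.source) (heU : e.source ⊆ U)
    (he : ⇑e = fun x => topView (φ x)) :
    ∀ᶠ x : (ℝ × ℝ) × ℝ in 𝓝 (p, 0), γ₁ x.1 x.2 = φ (e.symm (topView (γ₁ x.1 x.2))) := by
  have hp := heU hpe
  set K : (ℝ × ℝ) × ℝ → (ℝ × ℝ) × ℝ := fun x => (topView (γ₁ x.1 x.2), x.2) with hK
  have hKan : AnalyticAt ℝ K (p, 0) := (h.left.analyticAt hp 0).topView.prod analyticAt_snd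
  have hKinj : ∀ v, fderiv ℝ K (p, 0) v = 0 → v = 0 := by
    rintro ⟨v, s⟩ hv
    have h1 : HasFDerivAt K ((topViewL.comp
        (fderiv ℝ (fun q : (ℝ × ℝ) × ℝ => γ₁ q.1 q.2) (p, 0))).prod
        (ContinuousLinearMap.snd ℝ (ℝ × ℝ) ℝ)) (p, 0) :=
      (topViewL.hasFDerivAt.comp (p, (0 : ℝ))
        (h.left.analyticAt hp 0).differentiableAt.hasFDerivAt).prodMk hasFDerivAt_snd
    rw [h1.fderiv] at hv
    have h2 := congrArg Prod.fst hv
    have h3 : s = 0 := congrArg Prod.snd hv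
    subst h3
    have h4 : topView (fderiv ℝ (fun q : (ℝ × ℝ) × ℝ => γ₁ q.1 q.2) (p, 0) (v, 0)) = 0 := h2
    rw [IsArcFamily.fderiv_apply h.surface h.left hp, zero_smul, add_zero,
      ← h.fderiv_topView hp] at h4
    rw [h.fderiv_topView_injective hp v h4]; rfl
  obtain ⟨k, hpk, hkV, hkK, -⟩ := hKan.exists_openPartialHomeomorph hKinj
    (V := e.source ×ˢ Ioo (-1 : ℝ) 1) (e.open_source.prod isOpen_Ioo) ⟨hpe, by norm_num⟩
  have hmem : k.target ∈ 𝓝 (K (p, 0)) := by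
    rw [← hkK]; exact k.open_target.mem_nhds (k.map_source hpk)
  rw [hK] at hmem
  simp only [nhds_prod_eq] at hmem
  obtain ⟨B, hB, J, hJ, hBJ⟩ := mem_prod_iff.1 hmem
  obtain ⟨δ, hδ, hδJ⟩ := Metric.mem_nhds_iff.1 hJ
  rw [Real.ball_eq_Ioo, zero_sub, zero_add] at hδJ
  have hcont := hKan.continuousAt.preimage_mem_nhds
    (prod_mem_nhds hB (Ioo_mem_nhds (neg_lt_zero.2 hδ) hδ))
  filter_upwards [hcont, k.open_source.mem_nhds hpk] with ⟨x, t⟩ hx hxk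
  set q := topView (γ₁ x t)
  have hqB : q ∈ B := hx.1
  have htJ : t ∈ Ioo (-δ) δ := hx.2
  have htar : ∀ s ∈ Ioo (-δ) δ, (q, s) ∈ k.target := fun s hs => hBJ ⟨hqB, hδJ hs⟩
  have hsrc : ∀ s ∈ Ioo (-δ) δ, k.symm (q, s) ∈ e.source ×ˢ Ioo (-1 : ℝ) 1 := fun s hs =>
    hkV (k.map_target (htar s hs))
  have hright : ∀ s ∈ Ioo (-δ) δ, topView (γ₁ (k.symm (q, s)).1 (k.symm (q, s)).2) = q ∧
      (k.symm (q, s)).2 = s := fun s hs => by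
    have := k.right_inv (htar s hs)
    rw [hkK] at this
    exact ⟨congrArg Prod.fst this, congrArg Prod.snd this⟩
  set ψ : ℝ → R3 := fun s => γ₁ (k.symm (q, s)).1 (k.symm (q, s)).2 with hψ
  have hψc : ContinuousOn ψ (Ioo (-δ) δ) := by
    intro s hs
    refine ContinuousAt.continuousWithinAt ?_
    have h1 : ContinuousAt (fun s => k.symm (q, s)) s :=
      ContinuousAt.comp (f := fun s : ℝ => (q, s)) (k.symm.continuousAt (htar s hs)) (by fun_prop)
    exact ContinuousAt.comp (g := fun y : (ℝ × ℝ) × ℝ => γ₁ y.1 y.2)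
      (h.left.analyticAt (heU (hsrc s hs).1) _).continuousAt h1
  have hcount : (ψ '' Ioo (-δ) δ).Countable := by
    refine ((h.countable_fiber q).image φ).mono ?_
    rintro _ ⟨s, hs, rfl⟩
    obtain ⟨r, hr, hrψ⟩ := (h.left.subset _ (heU (hsrc s hs).1)
      (mem_image_of_mem _ (hsrc s hs).2)).2
    refine ⟨r, ⟨hr, ?_⟩, hrψ⟩
    rw [hrψ]; exact (hright s hs).1
  have hconst := hcount.isTotallyDisconnected _ subset_rfl (isPreconnected_Ioo.image ψ hψc)
  have h0 : (0 : ℝ) ∈ Ioo (-δ) δ := ⟨neg_lt_zero.2 hδ, hδ⟩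
  have key := hconst (mem_image_of_mem ψ htJ) (mem_image_of_mem ψ h0)
  have hleft : k.symm (q, t) = (x, t) := by
    have := k.left_inv hxk
    rwa [hkK] at this
  have hψt : ψ t = γ₁ x t := by simp only [hψ, hleft]
  have hψ0 : ψ 0 = φ (k.symm (q, 0)).1 := by
    simp only [hψ, (hright 0 h0).2]
    exact h.left.zero _ (heU (hsrc 0 h0).1)
  have hq : e (k.symm (q, 0)).1 = q := by
    rw [he]
    change topView (φ (k.symm (q, 0)).1) = q
    rw [← hψ0]; exact (hright 0 h0).1
  change γ₁ x t = φ (e.symm q)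
  rw [← hψt, key, hψ0]
  conv_rhs => rw [← hq, e.left_inv (hsrc 0 h0).1]

end IsDoubleArcFamily

/-- Homogeneous coordinates of a point of the plane. -/
def hv (q : ℝ × ℝ) : Fin 3 → ℝ := ![q.1, q.2, 1]

/-- Homogeneous coordinates of the line through `q` in the direction `d`. -/
def lc (q d : ℝ × ℝ) : Fin 3 → ℝ := ![-d.2, d.1, q.1 * d.2 - q.2 * d.1]

lemma cr_lc_self (q d d' : ℝ × ℝ) : cr (lc q d) (lc q d') = det2 d d' • hv q := by
  refine vec3_ext ?_ ?_ ?_ <;> simp [lc, det2, hv] <;> ring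

lemma dt_lc_hv (q d : ℝ × ℝ) : dt (lc q d) (hv q) = 0 := by
  simp [lc, hv, dt]; ring

lemma dt_cr_self (x y : Fin 3 → ℝ) : dt x (cr x y) = 0 := by
  simp [dt]; ring

lemma dt_cr_self_right (x y : Fin 3 → ℝ) : dt y (cr x y) = 0 := by
  simp [dt]; ring

/-- The point of the plane with the given homogeneous coordinates. -/
noncomputable def affine (P : Fin 3 → ℝ) : ℝ × ℝ := (P 0 / P 2, P 1 / P 2)

lemma affine_smul {c : ℝ} (hc : c ≠ 0) (P : Fin 3 → ℝ) : affine (c • P) = affine P := by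
  simp [affine, mul_div_mul_left _ _ hc]

lemma affine_hv (q : ℝ × ℝ) : affine (hv q) = q := by simp [affine, hv]

/-- The coefficients of the linear form giving the parameter of a point of the line through `q` in
the direction `d`. -/
noncomputable def paramForm (q d : ℝ × ℝ) : Fin 3 → ℝ :=
  ![d.1 / (d.1 ^ 2 + d.2 ^ 2), d.2 / (d.1 ^ 2 + d.2 ^ 2),
    -(q.1 * d.1 + q.2 * d.2) / (d.1 ^ 2 + d.2 ^ 2)]

lemma sq_add_sq_ne_zero {d : ℝ × ℝ} (hd : d ≠ 0) : d.1 ^ 2 + d.2 ^ 2 ≠ 0 := by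
  intro h
  have h1 : d.1 = 0 := by nlinarith [sq_nonneg d.1, sq_nonneg d.2]
  have h2 : d.2 = 0 := by nlinarith [sq_nonneg d.1, sq_nonneg d.2]
  exact hd (Prod.ext h1 h2)

lemma affine_eq_of_dt_lc {q d : ℝ × ℝ} (hd : d ≠ 0) {P : Fin 3 → ℝ} (hP : P 2 ≠ 0)
    (h : dt (lc q d) P = 0) : affine P = q + (dt (paramForm q d) P / P 2) • d := by
  have hn := sq_add_sq_ne_zero hd
  simp only [dt, lc, Matrix.cons_val_zero, Matrix.cons_val_one, Matrix.cons_val] at h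
  ext <;> simp [affine, paramForm, dt] <;> field_simp
  · linear_combination -d.2 * h
  · linear_combination d.1 * h

lemma ContinuousAt.dt_paramForm {X : Type*} [TopologicalSpace X] {q d : X → ℝ × ℝ}
    {P : X → Fin 3 → ℝ} {x : X} (hq : ContinuousAt q x) (hd : ContinuousAt d x) (h : d x ≠ 0)
    (hP : ContinuousAt P x) : ContinuousAt (fun y => dt (paramForm (q y) (d y)) (P y)) x := by
  have hn := sq_add_sq_ne_zero h
  have hPi : ∀ i, ContinuousAt (fun y => P y i) x := continuousAt_pi.1 hP
  simp only [dt, paramForm, Matrix.cons_val_zero, Matrix.cons_val_one, Matrix.cons_val]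
  fun_prop (disch := exact hn)

lemma continuous_hv : Continuous hv :=
  continuous_pi fun i => by fin_cases i <;> simp [hv] <;> fun_prop

namespace IsArcFamily
variable {U : Set (ℝ × ℝ)} {φ : ℝ × ℝ → R3} {γ : ℝ × ℝ → ℝ → R3} {C : ℝ × ℝ → Set R3} {p : ℝ × ℝ}

lemma analyticAt_deriv (hS : IsSurface U φ) (hγ : IsArcFamily U φ γ C) (hp : p ∈ U) :
    AnalyticAt ℝ (fun x => deriv (γ x) 0) p := by
  have h1 : AnalyticAt ℝ (fun x : ℝ × ℝ =>
      fderiv ℝ (fun q : (ℝ × ℝ) × ℝ => γ q.1 q.2) (x, 0)) p :=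
    AnalyticAt.comp_of_eq (f := fun x : ℝ × ℝ => (x, (0 : ℝ))) (hγ.analyticAt hp 0).fderiv
      (AnalyticAt.prod analyticAt_id analyticAt_const) rfl
  have h2 : AnalyticAt ℝ (fun x : ℝ × ℝ =>
      fderiv ℝ (fun q : (ℝ × ℝ) × ℝ => γ q.1 q.2) (x, 0) (0, 1)) p :=
    ((ContinuousLinearMap.apply ℝ R3 ((0, 1) : (ℝ × ℝ) × ℝ)).analyticAt _).comp_of_eq h1 rfl
  refine h2.congr ?_
  filter_upwards [hS.isOpen.mem_nhds hp] with x hx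
  rw [hγ.fderiv_apply hS hx]
  simp

end IsArcFamily

/-- Homogeneous coordinates of the top view of the tangent line to the arc. -/
noncomputable def arcLine (φ : ℝ × ℝ → R3) (γ : ℝ × ℝ → ℝ → R3) (p : ℝ × ℝ) : Fin 3 → ℝ :=
  lc (topView (φ p)) (topView (deriv (γ p) 0))

namespace IsDoubleArcFamily
variable {U : Set (ℝ × ℝ)} {φ : ℝ × ℝ → R3} {γ₁ γ₂ : ℝ × ℝ → ℝ → R3} {C₁ C₂ : ℝ × ℝ → Set R3}
  {p : ℝ × ℝ}

/-- Over the lines of the first family the surface is the graph of a quadratic function. -/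
lemma eventually_quadratic (h : IsDoubleArcFamily U φ γ₁ γ₂ C₁ C₂)
    {e : OpenPartialHomeomorph (ℝ × ℝ) (ℝ × ℝ)} (hpe : p ∈ e.source) (heU : e.source ⊆ U)
    (he : ⇑e = fun x => topView (φ x)) :
    ∃ δ > 0, ∀ᶠ x in 𝓝 p, ∃ a b c : ℝ, ∀ s, |s| < δ →
      (φ (e.symm (topView (φ x) + s • topView (deriv (γ₁ x) 0)))).2.2 = a * s ^ 2 + b * s + c := by
  have hp := heU hpe
  have hgr := h.eventually_arc_eq hpe heU he
  rw [nhds_prod_eq, eventually_prod_iff] at hgr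
  obtain ⟨PB, hPB, PJ, hPJ, hBJ⟩ := hgr
  obtain ⟨ε', hε', hJ'⟩ := Metric.eventually_nhds_iff.1 hPJ
  set ε := min (ε' / 2) (1 / 2)
  have hε : 0 < ε := by positivity
  have hεε : ε < ε' := (min_le_left _ _).trans_lt (by linarith)
  have hε1 : ε < 1 := (min_le_right _ _).trans_lt (by norm_num)
  have hJ : ∀ t, |t| ≤ ε → PJ t := fun t ht => hJ' (by rw [Real.dist_0_eq_abs]; linarith)
  set σ : ℝ × ℝ → ℝ → ℝ := fun x t =>
    dt (paramForm (topView (φ x)) (topView (deriv (γ₁ x) 0))) (hv (topView (γ₁ x t))) with hσ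
  have harc : ∀ x ∈ U, ∃ A B : ℝ, ∀ t ∈ Ioo (-1 : ℝ) 1,
      topView (γ₁ x t) = topView (φ x) + σ x t • topView (deriv (γ₁ x) 0) ∧
      (γ₁ x t).2.2 = A * σ x t ^ 2 + B * σ x t + (φ x).2.2 := by
    intro x hx
    obtain ⟨hd, A, B, -, hC⟩ := h.left.normal_form hx
    refine ⟨A, B, fun t ht => ?_⟩
    have hm := (h.left.subset x hx (mem_image_of_mem _ ht)).1
    rw [hC] at hm
    obtain ⟨s, hs⟩ := hm
    have hn := sq_add_sq_ne_zero hd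
    have hst : σ x t = s := by
      simp only [hσ, ← hs, dt, paramForm, hv, topView] at hn ⊢
      simp
      field_simp
      ring
    rw [hst, ← hs]
    constructor
    · ext <;> simp [topView]
    · rfl
  have hσc : ∀ t, ContinuousAt (fun x => σ x t) p := by
    intro t
    have h1 : ContinuousAt (fun x => topView (φ x)) p :=
      (h.surface.analytic p hp).topView.continuousAt
    have h2 : ContinuousAt (fun x => topView (deriv (γ₁ x) 0)) p :=
      (h.left.analyticAt_deriv h.surface hp).topView.continuousAt
    have h3 : ContinuousAt (fun x => topView (γ₁ x t)) p :=
      continuous_topView.continuousAt.comp (ContinuousAt.comp (f := fun x : ℝ × ℝ => (x, t))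
        (h.left.analyticAt hp t).continuousAt (by fun_prop))
    exact h1.dt_paramForm h2 (h.left.normal_form hp).1 (continuous_hv.continuousAt.comp h3)
  have hσt : ∀ x ∈ U, Continuous (σ x) := by
    intro x hx
    have h3 : Continuous fun t => topView (γ₁ x t) := continuous_topView.comp
      (continuous_iff_continuousAt.2 fun t => (h.left.hasDerivAt hx t).continuousAt)
    exact continuous_iff_continuousAt.2 fun t => continuousAt_const.dt_paramForm continuousAt_const
      (h.left.normal_form hx).1 (continuous_hv.comp h3).continuousAt
  have hσd : HasDerivAt (σ p) 1 0 := by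
    have hD := h.left.hasDerivAt hp 0
    have hn := sq_add_sq_ne_zero (h.left.normal_form hp).1
    have h1 : HasDerivAt (fun t => (γ₁ p t).1) _ 0 := hD.fst
    have h2 : HasDerivAt (fun t => (γ₁ p t).2.1) _ 0 := hD.snd.fst
    set w := deriv (γ₁ p) 0
    have h3 := ((h1.const_mul (w.1 / (w.1 ^ 2 + w.2.1 ^ 2))).add
      (h2.const_mul (w.2.1 / (w.1 ^ 2 + w.2.1 ^ 2)))).add_const
        (-((φ p).1 * w.1 + (φ p).2.1 * w.2.1) / (w.1 ^ 2 + w.2.1 ^ 2) * 1)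
    refine (h3.congr_deriv ?_)
    simp only [topView] at hn
    field_simp
  have hσ0 : σ p 0 = 0 := by
    have hn := sq_add_sq_ne_zero (h.left.normal_form hp).1
    simp only [hσ, h.left.zero p hp, dt, paramForm, hv]
    simp
    field_simp
    ring
  have hpos : ∃ t₁ ∈ Ioo 0 ε, 0 < σ p t₁ := by
    have h1 := hσd.tendsto_slope_zero_right
    simp only [zero_add, hσ0, sub_zero, smul_eq_mul] at h1
    have h2 : ∀ᶠ t in 𝓝[>] (0 : ℝ), 0 < t⁻¹ * σ p t := h1.eventually (lt_mem_nhds one_pos)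
    obtain ⟨t, ht, ht'⟩ := (h2.and (Ioo_mem_nhdsGT hε)).exists
    exact ⟨t, ht', (mul_pos_iff_of_pos_left (inv_pos.2 ht'.1)).1 ht⟩
  have hneg : ∃ t₂ ∈ Ioo (-ε) 0, σ p t₂ < 0 := by
    have h1 := hσd.tendsto_slope_zero_left
    simp only [zero_add, hσ0, sub_zero, smul_eq_mul] at h1
    have h2 : ∀ᶠ t in 𝓝[<] (0 : ℝ), 0 < t⁻¹ * σ p t := h1.eventually (lt_mem_nhds one_pos)
    obtain ⟨t, ht, ht'⟩ := (h2.and (Ioo_mem_nhdsLT (neg_lt_zero.2 hε))).exists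
    exact ⟨t, ht', neg_of_mul_pos_right ht (inv_nonpos.2 ht'.2.le)⟩
  obtain ⟨t₁, ht₁, hs₁⟩ := hpos
  obtain ⟨t₂, ht₂, hs₂⟩ := hneg
  set δ := min (σ p t₁ / 2) (-σ p t₂ / 2)
  have hδ : 0 < δ := lt_min (by linarith) (by linarith)
  have hδ₁ : δ < σ p t₁ := (min_le_left _ _).trans_lt (by linarith)
  have hδ₂ : σ p t₂ < -δ := by
    have : δ ≤ -σ p t₂ / 2 := min_le_right _ _
    linarith
  refine ⟨δ, hδ, ?_⟩
  filter_upwards [hPB, h.surface.isOpen.mem_nhds hp, (hσc t₁).eventually (lt_mem_nhds hδ₁),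
    (hσc t₂).eventually (gt_mem_nhds hδ₂)] with x hxB hxU hx₁ hx₂
  obtain ⟨A, B, hAB⟩ := harc x hxU
  refine ⟨A, B, (φ x).2.2, fun s hs => ?_⟩
  obtain ⟨t, ht, rfl⟩ : s ∈ σ x '' Icc t₂ t₁ :=
    intermediate_value_Icc (ht₂.2.trans ht₁.1).le (hσt x hxU).continuousOn
      ⟨hx₂.le.trans (abs_lt.1 hs).1.le, (abs_lt.1 hs).2.le.trans hx₁.le⟩
  have htε : |t| ≤ ε := abs_le.2 ⟨ht₂.1.le.trans ht.1, ht.2.trans ht₁.2.le⟩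
  have ht1 : t ∈ Ioo (-1 : ℝ) 1 := abs_lt.1 (htε.trans_lt hε1)
  obtain ⟨h1, h2⟩ := hAB t ht1
  rw [← h1, ← h2]
  exact congrArg (fun w : R3 => w.2.2) (hBJ hxB (hJ t htε)).symm

end IsDoubleArcFamily

lemma dt_paramForm_hv (q d : ℝ × ℝ) : dt (paramForm q d) (hv q) = 0 := by
  simp [dt, paramForm, hv]; ring

lemma dt_smul (c : ℝ) (x y : Fin 3 → ℝ) : dt x (c • y) = c * dt x y := by
  simp [dt]; ring

lemma smul_dt (c : ℝ) (x y : Fin 3 → ℝ) : dt (c • x) y = c * dt x y := by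
  simp [dt]; ring

lemma cr_smul_smul (s t : ℝ) (x y : Fin 3 → ℝ) : cr (s • x) (t • y) = (s * t) • cr x y := by
  refine vec3_ext ?_ ?_ ?_ <;> simp <;> ring

lemma cr_swap (x y : Fin 3 → ℝ) : cr x y = (-1 : ℝ) • cr y x := by
  refine vec3_ext ?_ ?_ ?_ <;> simp <;> ring

lemma continuous_cr : Continuous fun x : (Fin 3 → ℝ) × (Fin 3 → ℝ) => cr x.1 x.2 :=
  continuous_pi fun i => by fin_cases i <;> simp [cr] <;> fun_prop

/-- A homogeneous function that is quadratic along a line in an affine parameter is given by a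
quadratic form on this line. -/
lemma exists_qf_of_quadratic {F : ℝ × ℝ → ℝ} {q d : ℝ × ℝ} (hd : d ≠ 0) {δ a b c : ℝ}
    (hF : ∀ s, |s| < δ → F (q + s • d) = a * s ^ 2 + b * s + c) :
    ∃ r, ∀ P, P 2 ≠ 0 → dt (lc q d) P = 0 → |dt (paramForm q d) P / P 2| < δ →
      P 2 ^ 2 * F (affine P) = qf r P := by
  set k := paramForm q d
  obtain ⟨r, hr⟩ := ((IsQuad.of_mul a k k).add (IsQuad.of_mul b k ![0, 0, 1])).add
    (IsQuad.of_mul c ![0, 0, 1] ![0, 0, 1])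
  beta_reduce at hr
  refine ⟨r, fun P hP hl hs => ?_⟩
  have h2 : dt ![0, 0, 1] P = P 2 := by simp [dt]
  rw [affine_eq_of_dt_lc hd hP hl, hF _ hs, hr, h2]
  change P 2 ^ 2 * (a * (dt k P / P 2) ^ 2 + b * (dt k P / P 2) + c) = _
  field_simp

namespace IsDoubleArcFamily
variable {U : Set (ℝ × ℝ)} {φ : ℝ × ℝ → R3} {γ₁ γ₂ : ℝ × ℝ → ℝ → R3} {C₁ C₂ : ℝ × ℝ → Set R3}
  {p : ℝ × ℝ}

lemma analyticAt_arcLine (h : IsDoubleArcFamily U φ γ₁ γ₂ C₁ C₂) (hp : p ∈ U) :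
    AnalyticAt ℝ (arcLine φ γ₁) p := by
  have h1 := (h.surface.analytic p hp).topView
  have h2 := (h.left.analyticAt_deriv h.surface hp).topView
  have h11 : AnalyticAt ℝ (fun x => (topView (φ x)).1) p := analyticAt_fst.comp_of_eq h1 rfl
  have h12 : AnalyticAt ℝ (fun x => (topView (φ x)).2) p := analyticAt_snd.comp_of_eq h1 rfl
  have h21 : AnalyticAt ℝ (fun x => (topView (deriv (γ₁ x) 0)).1) p :=
    analyticAt_fst.comp_of_eq h2 rfl
  have h22 : AnalyticAt ℝ (fun x => (topView (deriv (γ₁ x) 0)).2) p :=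
    analyticAt_snd.comp_of_eq h2 rfl
  refine AnalyticAt.pi fun i => ?_
  fin_cases i
  · exact h22.neg
  · exact h21
  · exact (h11.mul h22).sub (h12.mul h21)

lemma cr_arcLine (_ : IsDoubleArcFamily U φ γ₁ γ₂ C₁ C₂) (p : ℝ × ℝ) :
    cr (arcLine φ γ₁ p) (arcLine φ γ₂ p) =
      det2 (topView (deriv (γ₁ p) 0)) (topView (deriv (γ₂ p) 0)) • hv (topView (φ p)) :=
  cr_lc_self _ _ _

lemma eventually_good_param (h : IsDoubleArcFamily U φ γ₁ γ₂ C₁ C₂) (hp : p ∈ U) {δ : ℝ}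
    (hδ : 0 < δ) : ∀ᶠ x : (ℝ × ℝ) × (ℝ × ℝ) in 𝓝 (p, p),
      cr (arcLine φ γ₁ x.1) (arcLine φ γ₂ x.2) 2 ≠ 0 ∧
      |dt (paramForm (topView (φ x.1)) (topView (deriv (γ₁ x.1) 0)))
        (cr (arcLine φ γ₁ x.1) (arcLine φ γ₂ x.2)) /
          cr (arcLine φ γ₁ x.1) (arcLine φ γ₂ x.2) 2| < δ := by
  have h1 : ContinuousAt (fun x : (ℝ × ℝ) × (ℝ × ℝ) => arcLine φ γ₁ x.1) (p, p) :=
    ContinuousAt.comp (f := Prod.fst) (g := arcLine φ γ₁) (h.analyticAt_arcLine hp).continuousAt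
      continuousAt_fst
  have h2 : ContinuousAt (fun x : (ℝ × ℝ) × (ℝ × ℝ) => arcLine φ γ₂ x.2) (p, p) :=
    ContinuousAt.comp (f := Prod.snd) (g := arcLine φ γ₂) (h.symm.analyticAt_arcLine hp).continuousAt
      continuousAt_snd
  have h3 : ContinuousAt (fun x : (ℝ × ℝ) × (ℝ × ℝ) =>
      cr (arcLine φ γ₁ x.1) (arcLine φ γ₂ x.2)) (p, p) :=
    continuous_cr.continuousAt.comp (h1.prodMk h2)
  have h4 : ContinuousAt (fun x : (ℝ × ℝ) × (ℝ × ℝ) => topView (φ x.1)) (p, p) :=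
    ContinuousAt.comp (f := Prod.fst) (g := fun y => topView (φ y))
      (h.surface.analytic p hp).topView.continuousAt
      continuousAt_fst
  have h5 : ContinuousAt (fun x : (ℝ × ℝ) × (ℝ × ℝ) => topView (deriv (γ₁ x.1) 0)) (p, p) :=
    ContinuousAt.comp (f := Prod.fst) (g := fun y => topView (deriv (γ₁ y) 0))
      (h.left.analyticAt_deriv h.surface hp).topView.continuousAt
      continuousAt_fst
  have h6 := h4.dt_paramForm h5 (h.left.normal_form hp).1 h3
  have h7 := continuousAt_pi.1 h3 2
  have h8 : cr (arcLine φ γ₁ p) (arcLine φ γ₂ p) 2 ≠ 0 := by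
    rw [h.cr_arcLine]; simpa [hv] using h.det_ne p hp
  have h9 := (h6.div h7 h8).abs
  refine (h7.eventually_ne h8).and (h9.eventually (gt_mem_nhds ?_))
  change |dt _ (cr (arcLine φ γ₁ p) (arcLine φ γ₂ p)) / _| < δ
  rw [h.cr_arcLine, dt_smul, dt_paramForm_hv]
  simpa using hδ

/-- Near each point the surface is the graph of a homogeneous function that is quadratic along the
lines of both families. -/
lemma exists_local_form (h : IsDoubleArcFamily U φ γ₁ γ₂ C₁ C₂) (hp : p ∈ U) :
    ∃ (r : ℝ) (H : (Fin 3 → ℝ) → ℝ), 0 < r ∧ Metric.ball p r ⊆ U ∧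
      (∀ c P, H (c • P) = c ^ 2 * H P) ∧
      (∀ x ∈ Metric.ball p r, H (hv (topView (φ x))) = (φ x).2.2) ∧
      (∀ x ∈ Metric.ball p r, ∀ y ∈ Metric.ball p r,
        cr (arcLine φ γ₁ x) (arcLine φ γ₂ y) 2 ≠ 0) ∧
      (∀ x ∈ Metric.ball p r, ∃ q, ∀ y ∈ Metric.ball p r,
        H (cr (arcLine φ γ₁ x) (arcLine φ γ₂ y)) = qf q (cr (arcLine φ γ₁ x) (arcLine φ γ₂ y))) ∧
      (∀ y ∈ Metric.ball p r, ∃ q, ∀ x ∈ Metric.ball p r,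
        H (cr (arcLine φ γ₁ x) (arcLine φ γ₂ y)) = qf q (cr (arcLine φ γ₁ x) (arcLine φ γ₂ y))) := by
  obtain ⟨e, hpe, heU, he, -⟩ := h.exists_chart hp
  obtain ⟨δ₁, hδ₁, hq₁⟩ := h.eventually_quadratic hpe heU he
  obtain ⟨δ₂, hδ₂, hq₂⟩ := h.symm.eventually_quadratic hpe heU he
  have hg₁ := h.eventually_good_param hp hδ₁
  have hg₂ := (continuous_swap.tendsto (p, p)).eventually (h.symm.eventually_good_param hp hδ₂)
  have hg := hg₁.and hg₂
  rw [nhds_prod_eq] at hg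
  obtain ⟨V, hV, V', hV', hVV⟩ := mem_prod_iff.1 hg
  obtain ⟨r, hr, hball⟩ := Metric.mem_nhds_iff.1
    (inter_mem (inter_mem hV hV') (inter_mem (hq₁.and hq₂) (e.open_source.mem_nhds hpe)))
  set F : ℝ × ℝ → ℝ := fun q => (φ (e.symm q)).2.2
  have hgood : ∀ x ∈ Metric.ball p r, ∀ y ∈ Metric.ball p r, _ := fun x hx y hy =>
    hVV (mk_mem_prod (hball hx).1.1 (hball hy).1.2)
  refine ⟨r, fun P => P 2 ^ 2 * F (affine P), hr, fun x hx => heU (hball hx).2.2, ?_, ?_, ?_, ?_, ?_⟩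
  · intro c P
    rcases eq_or_ne c 0 with rfl | hc
    · simp
    · simp only [affine_smul hc, Pi.smul_apply, smul_eq_mul]; ring
  · intro x hx
    have : e.symm (topView (φ x)) = x := by
      have := e.left_inv (hball hx).2.2
      rwa [he] at this
    simp only [affine_hv, F, this]
    simp [hv]
  · exact fun x hx y hy => (hgood x hx y hy).1.1
  · intro x hx
    obtain ⟨a, b, c, habc⟩ := (hball hx).2.1.1
    obtain ⟨q, hq⟩ := exists_qf_of_quadratic (F := F)
      (h.left.normal_form (heU (hball hx).2.2)).1 habc
    exact ⟨q, fun y hy => hq _ (hgood x hx y hy).1.1 (dt_cr_self _ _) (hgood x hx y hy).1.2⟩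
  · intro y hy
    obtain ⟨a, b, c, habc⟩ := (hball hy).2.1.2
    obtain ⟨q, hq⟩ := exists_qf_of_quadratic (F := F)
      (h.right.normal_form (heU (hball hy).2.2)).1 habc
    refine ⟨q, fun x hx => hq _ (hgood x hx y hy).1.1 (dt_cr_self_right _ _) ?_⟩
    have h2 := (hgood x hx y hy).2.2
    simp only [Prod.fst_swap, Prod.snd_swap] at h2
    rw [cr_swap, dt_smul, Pi.smul_apply, smul_eq_mul, mul_div_mul_left _ _ (by norm_num)]
    exact h2

/-- Near no point the top view of the surface is contained in a line. -/
lemma exists_dt_hv_ne (h : IsDoubleArcFamily U φ γ₁ γ₂ C₁ C₂) (hp : p ∈ U) {l : Fin 3 → ℝ}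
    (hl : l ≠ 0) {N : Set (ℝ × ℝ)} (hN : N ∈ 𝓝 p) : ∃ x ∈ N, dt l (hv (topView (φ x))) ≠ 0 := by
  by_contra! hc
  obtain ⟨e, hpe, -, he, -⟩ := h.exists_chart hp
  have h1 : ∀ᶠ q in 𝓝 (e p), dt l (hv q) = 0 := by
    rw [← e.map_nhds_eq hpe, eventually_map, he]
    filter_upwards [hN] with x hx using hc x hx
  obtain ⟨ε, hε, hball⟩ := Metric.eventually_nhds_iff.1 h1
  set q := e p
  have h0 := hball (y := q) (by simpa using hε)
  have hx := hball (y := (q.1 + ε / 2, q.2)) (by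
    rw [Prod.dist_eq]; simp [abs_of_pos hε]; exact hε)
  have hy := hball (y := (q.1, q.2 + ε / 2)) (by
    rw [Prod.dist_eq]; simp [abs_of_pos hε]; exact hε)
  simp only [dt, hv, Matrix.cons_val_zero, Matrix.cons_val_one, Matrix.cons_val] at h0 hx hy
  have hl0 : l 0 = 0 := by
    have : l 0 * (ε / 2) = 0 := by linarith
    exact (mul_eq_zero.1 this).resolve_right (by positivity)
  have hl1 : l 1 = 0 := by
    have : l 1 * (ε / 2) = 0 := by linarith
    exact (mul_eq_zero.1 this).resolve_right (by positivity)
  rw [hl0, hl1] at h0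
  exact hl (vec3_ext hl0 hl1 (by simpa using h0))

end IsDoubleArcFamily

/-- The cone over the values of a map on a set. -/
def coneOver (L : ℝ × ℝ → Fin 3 → ℝ) (N : Set (ℝ × ℝ)) : Set (Fin 3 → ℝ) :=
  {x | ∃ s : ℝ, ∃ p ∈ N, x = s • L p}

lemma mem_coneOver {L : ℝ × ℝ → Fin 3 → ℝ} {N : Set (ℝ × ℝ)} {p : ℝ × ℝ} (hp : p ∈ N) :
    L p ∈ coneOver L N := ⟨1, p, hp, (one_smul _ _).symm⟩

lemma AnalyticOnNhd.eqOn_zero_or_eqOn_zero_of_mul {E : Type*} [NormedAddCommGroup E]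
    [NormedSpace ℝ E] {f g : E → ℝ} {V : Set E} (hg : AnalyticOnNhd ℝ g V) (hV : IsPreconnected V)
    (hf : AnalyticOnNhd ℝ f V) (hVo : IsOpen V) (hfg : ∀ x ∈ V, f x * g x = 0) :
    (∀ x ∈ V, f x = 0) ∨ ∀ x ∈ V, g x = 0 := by
  by_contra! hc
  obtain ⟨⟨x, hx, hfx⟩, y, hy, hgy⟩ := hc
  refine hgy (hg.eqOn_zero_of_preconnected_of_eventuallyEq_zero hV hx ?_ hy)
  filter_upwards [(hf x hx).continuousAt.eventually_ne hfx, hVo.mem_nhds hx] with z hz hzV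
  exact (mul_eq_zero.1 (hfg z hzV)).resolve_left hz

lemma AnalyticOnNhd.irrCone_coneOver {L : ℝ × ℝ → Fin 3 → ℝ} {N : Set (ℝ × ℝ)}
    (hL : AnalyticOnNhd ℝ L N) (hN : IsOpen N) (hc : IsConnected N) : IrrCone (coneOver L N) where
  nonempty := let ⟨_, hp⟩ := hc.nonempty; ⟨_, mem_coneOver hp⟩
  smul_mem := by
    rintro _ ⟨s, p, hp, rfl⟩ c
    exact ⟨c * s, p, hp, (mul_smul _ _ _).symm⟩
  prime P Q hPQ := by
    have han : ∀ P : MvPolynomial (Fin 3) ℝ,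
        AnalyticOnNhd ℝ (fun x : ℝ × (ℝ × ℝ) => eval (x.1 • L x.2) P) (univ ×ˢ N) := by
      intro P x hx
      have h1 : AnalyticAt ℝ (fun x : ℝ × (ℝ × ℝ) => L x.2) x :=
        AnalyticAt.comp_of_eq (f := Prod.snd) (hL x.2 hx.2) analyticAt_snd rfl
      have h2 : AnalyticAt ℝ (fun x : ℝ × (ℝ × ℝ) => x.1 • L x.2) x := analyticAt_fst.smul h1
      exact AnalyticAt.aeval_mvPolynomial (fun i => analyticAt_pi_iff.1 h2 i) P
    rcases (han Q).eqOn_zero_or_eqOn_zero_of_mul (isPreconnected_univ.prod hc.isPreconnected) (han P)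
      (isOpen_univ.prod hN) (fun x hx => hPQ _ ⟨x.1, x.2, hx.2, rfl⟩) with h | h
    · left
      rintro _ ⟨s, p, hp, rfl⟩
      exact h (s, p) ⟨mem_univ _, hp⟩
    · right
      rintro _ ⟨s, p, hp, rfl⟩
      exact h (s, p) ⟨mem_univ _, hp⟩

lemma dt_eq_zero_of_cr_eq_zero {x y z : Fin 3 → ℝ} (hxy : cr x y = 0) (hy : y ≠ 0)
    (hyz : dt y z = 0) : dt x z = 0 := by
  by_contra hxz
  apply hy
  have h0 := congrFun hxy 0
  have h1 := congrFun hxy 1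
  have h2 := congrFun hxy 2
  simp only [cr_zero, cr_one, cr_two, Pi.zero_apply] at h0 h1 h2
  have h : dt x z • y = 0 := by
    unfold dt at hyz ⊢
    refine vec3_ext ?_ ?_ ?_ <;> simp only [Pi.smul_apply, smul_eq_mul, Pi.zero_apply]
    · linear_combination x 0 * hyz - z 1 * h2 + z 2 * h1
    · linear_combination x 1 * hyz + z 0 * h2 - z 2 * h0
    · linear_combination x 2 * hyz - z 0 * h1 + z 1 * h0
  exact (smul_eq_zero.1 h).resolve_left hxz

namespace IsDoubleArcFamily
variable {U : Set (ℝ × ℝ)} {φ : ℝ × ℝ → R3} {γ₁ γ₂ : ℝ × ℝ → ℝ → R3} {C₁ C₂ : ℝ × ℝ → Set R3}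
  {p : ℝ × ℝ}

lemma cr_arcLine_ne_zero (h : IsDoubleArcFamily U φ γ₁ γ₂ C₁ C₂) (hp : p ∈ U) :
    cr (arcLine φ γ₁ p) (arcLine φ γ₂ p) ≠ 0 := by
  intro h0
  have h1 := congrFun h0 2
  rw [h.cr_arcLine] at h1
  exact h.det_ne p hp (by simpa [hv] using h1)

lemma arcLine_ne_zero (h : IsDoubleArcFamily U φ γ₁ γ₂ C₁ C₂) (hp : p ∈ U) :
    arcLine φ γ₁ p ≠ 0 := by
  intro h0
  apply h.cr_arcLine_ne_zero hp
  rw [h0]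
  refine vec3_ext ?_ ?_ ?_ <;> simp

lemma exists_cr_ne_zero (h : IsDoubleArcFamily U φ γ₁ γ₂ C₁ C₂) (hp : p ∈ U) {N : Set (ℝ × ℝ)}
    (hN : N ∈ 𝓝 p) (hNU : N ⊆ U) :
    ∃ x ∈ coneOver (arcLine φ γ₁) N, ∃ y ∈ coneOver (arcLine φ γ₁) N, cr x y ≠ 0 := by
  obtain ⟨x, hx, hne⟩ := h.exists_dt_hv_ne hp (h.arcLine_ne_zero hp) hN
  refine ⟨_, mem_coneOver (mem_of_mem_nhds hN), _, mem_coneOver hx, fun h0 => hne ?_⟩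
  exact dt_eq_zero_of_cr_eq_zero h0 (h.arcLine_ne_zero (hNU hx)) (dt_lc_hv _ _)

/-- A surface that is locally the graph of a quadratic function contains infinitely many arcs of
vertical parabolas and line segments through each point. -/
lemma infinite_arcs (h : IsDoubleArcFamily U φ γ₁ γ₂ C₁ C₂) (hp : p ∈ U) {q : Fin 6 → ℝ}
    (hq : ∀ x ∈ U, (φ x).2.2 = qf q (hv (topView (φ x)))) :
    {C : Set R3 | (IsIsotropicCircle C ∨ IsLine3 C) ∧ ArcThroughIn C (φ p) (φ '' U)}.Infinite := by
  set x := (φ p).1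
  set y := (φ p).2.1
  set c : ℝ → ℝ → R3 := fun s σ => (x + σ, y + s * σ, qf q (hv (x + σ, y + s * σ))) with hc
  refine infinite_of_injective_forall_mem (f := fun s => range (c s)) ?_ fun s => ⟨?_, ?_⟩
  · intro s s' hss
    have h1 : c s 1 ∈ range (c s') := by
      have : range (c s) = range (c s') := hss
      rw [← this]; exact mem_range_self _
    obtain ⟨σ, hσ⟩ := h1
    simp only [hc, Prod.mk.injEq] at hσ
    have h2 : σ = 1 := by linarith [hσ.1]
    have h3 := hσ.2.1
    rw [h2] at h3
    linarith
  · set a := q 0 + q 1 * s ^ 2 + q 3 * s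
    set b := 2 * q 0 * x + 2 * q 1 * y * s + q 3 * (x * s + y) + q 4 + q 5 * s
    have hexp : ∀ σ, c s σ = (x + σ * 1, y + σ * s, a * σ ^ 2 + b * σ + qf q (hv (x, y))) := by
      intro σ
      simp only [hc, Prod.mk.injEq, qf, hv, Matrix.cons_val_zero, Matrix.cons_val_one,
        Matrix.cons_val, a, b]
      refine ⟨?_, ?_, ?_⟩ <;> ring
    rcases eq_or_ne a 0 with ha | ha
    · right
      refine ⟨(x, y, qf q (hv (x, y))), (1, s, b), by simp, ?_⟩
      congr 1
      ext1 σ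
      rw [hexp, ha]
      simp only [Prod.smul_mk, Prod.mk_add_mk, smul_eq_mul, Prod.mk.injEq]
      exact ⟨trivial, trivial, by ring⟩
    · left; left
      refine ⟨x, y, 1, s, a, b, qf q (hv (x, y)), ha, by simp, ?_⟩
      congr 1
      ext1 σ
      rw [hexp]
  · obtain ⟨e, hpe, heU, he, -⟩ := h.exists_chart hp
    have hcont : Continuous fun σ => (x + σ, y + s * σ) := by fun_prop
    have hmem : ∀ᶠ σ in 𝓝 (0 : ℝ), (x + σ, y + s * σ) ∈ e.target := by
      refine hcont.continuousAt.eventually (e.open_target.mem_nhds ?_)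
      simp only [add_zero, mul_zero]
      have := e.map_source hpe
      rwa [he] at this
    obtain ⟨δ, hδ, hball⟩ := Metric.eventually_nhds_iff.1 hmem
    refine ⟨fun t => c s (δ * t), ?_, ?_, ?_, ?_⟩
    · refine Continuous.continuousOn ?_
      simp only [hc, qf, hv, Matrix.cons_val_zero, Matrix.cons_val_one, Matrix.cons_val]
      fun_prop
    · intro t _ t' _ htt
      have := congrArg Prod.fst htt
      simp only [hc, add_right_inj] at this
      exact mul_left_cancel₀ hδ.ne' this
    · have h1 : qf q (hv (x, y)) = (φ p).2.2 := (hq p hp).symm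
      simp only [hc, mul_zero, add_zero, h1]
      rfl
    · rintro _ ⟨t, ht, rfl⟩
      refine ⟨mem_range_self _, ?_⟩
      have h1 : (x + δ * t, y + s * (δ * t)) ∈ e.target := by
        apply hball
        rw [Real.dist_0_eq_abs, abs_mul, abs_of_pos hδ]
        have := abs_lt.2 ht
        nlinarith
      have h2 := e.right_inv h1
      have h3 := heU (e.map_target h1)
      set z := e.symm (x + δ * t, y + s * (δ * t))
      rw [he] at h2
      refine ⟨z, h3, ?_⟩
      have h4 := hq z h3
      rw [show topView (φ z) = _ from h2] at h4
      have h5 := congrArg Prod.fst h2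
      have h6 := congrArg Prod.snd h2
      exact Prod.ext h5 (Prod.ext h6 h4)

/-- The finiteness of the set of arcs excludes quadratic graphs. -/
lemma not_eventually_quadratic (h : IsDoubleArcFamily U φ γ₁ γ₂ C₁ C₂)
    (hfin : ∃ D : Set R3, D ⊆ φ '' U ∧ φ '' U ⊆ closure D ∧ ∀ q ∈ D,
      {C : Set R3 | (IsIsotropicCircle C ∨ IsLine3 C) ∧ ArcThroughIn C q (φ '' U)}.Finite)
    (hp : p ∈ U) (q : Fin 6 → ℝ) : ¬∀ᶠ x in 𝓝 p, (φ x).2.2 = qf q (hv (topView (φ x))) := by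
  intro hev
  obtain ⟨D, hDU, hD, hfin⟩ := hfin
  obtain ⟨w, hw⟩ : D.Nonempty := closure_nonempty_iff.1 ⟨φ p, hD (mem_image_of_mem _ hp)⟩
  obtain ⟨x, hx, rfl⟩ := hDU hw
  refine h.infinite_arcs hx (fun y hy => sub_eq_zero.1 ?_) (hfin _ hw) (q := q)
  refine AnalyticOnNhd.eqOn_zero_of_preconnected_of_eventuallyEq_zero (𝕜 := ℝ)
    (f := fun y => (φ y).2.2 - qf q (hv (topView (φ y)))) (fun y hy => ?_)
    h.surface.isConnected.isPreconnected hp (hev.mono fun y hy => sub_eq_zero.2 hy) hy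
  have h1 := h.surface.analytic y hy
  have h2 : AnalyticAt ℝ (fun x => (φ x).1) y := (analyticAt_fst (𝕜 := ℝ)).comp_of_eq h1 rfl
  have h3 : AnalyticAt ℝ (fun x => (φ x).2) y := analyticAt_snd.comp_of_eq h1 rfl
  have h4 : AnalyticAt ℝ (fun x => (φ x).2.1) y := analyticAt_fst.comp_of_eq h3 rfl
  have h5 : AnalyticAt ℝ (fun x => (φ x).2.2) y := analyticAt_snd.comp_of_eq h3 rfl
  simp only [qf, hv, topView, Matrix.cons_val_zero, Matrix.cons_val_one, Matrix.cons_val]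
  fun_prop

end IsDoubleArcFamily

lemma PolyFun.continuous {f : (Fin 3 → ℝ) → ℝ} (hf : PolyFun f) : Continuous f := by
  obtain ⟨P, hP⟩ := hf
  have : f = fun x => eval x P := funext fun x => (hP x).symm
  rw [this]
  exact MvPolynomial.continuous_eval P

namespace IsDoubleArcFamily
variable {U : Set (ℝ × ℝ)} {φ : ℝ × ℝ → R3} {γ₁ γ₂ : ℝ × ℝ → ℝ → R3} {C₁ C₂ : ℝ × ℝ → Set R3}
  {p : ℝ × ℝ}

lemma arcLine_analytic (h : IsDoubleArcFamily U φ γ₁ γ₂ C₁ C₂) : AnalyticOnNhd ℝ (arcLine φ γ₁) U :=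
  fun _ hx => h.analyticAt_arcLine hx

lemma polyFun_arcLine_eq_zero (h : IsDoubleArcFamily U φ γ₁ γ₂ C₁ C₂) {f : (Fin 3 → ℝ) → ℝ}
    (hf : PolyFun f) (hp : p ∈ U) (h0 : ∀ᶠ x in 𝓝 p, f (arcLine φ γ₁ x) = 0) {x : ℝ × ℝ}
    (hx : x ∈ U) : f (arcLine φ γ₁ x) = 0 := by
  obtain ⟨P, hP⟩ := hf
  have han : AnalyticOnNhd ℝ (fun x => f (arcLine φ γ₁ x)) U := by
    simp only [← hP]
    exact AnalyticOnNhd.aeval_mvPolynomial (fun i => analyticOnNhd_pi_iff.1 h.arcLine_analytic i) P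
  exact han.eqOn_zero_of_preconnected_of_eventuallyEq_zero h.surface.isConnected.isPreconnected
    hp h0 hx

/-- If the lines of the first family are not concurrent, then the lines of both families are tangent
to a common conic. -/
lemma exists_common_conic (h : IsDoubleArcFamily U φ γ₁ γ₂ C₁ C₂)
    (hfin : ∃ D : Set R3, D ⊆ φ '' U ∧ φ '' U ⊆ closure D ∧ ∀ q ∈ D,
      {C : Set R3 | (IsIsotropicCircle C ∨ IsLine3 C) ∧ ArcThroughIn C q (φ '' U)}.Finite)
    (hp : p ∈ U) {k₀ : Set (Fin 3 → ℝ)} (hk₀ : k₀ = {k | ∀ x ∈ U, dt k (arcLine φ γ₁ x) = 0})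
    (hn : k₀ ⊆ {0}) :
    ∃ c e0 e1 e2, det3 e0 e1 e2 ≠ 0 ∧
      (∀ s0 s1 s2 : ℝ, qf c (s0 • e0 + s1 • e1 + s2 • e2) = 0 → s1 ^ 2 = s0 * s2) ∧
      ∀ x ∈ U, qf c (arcLine φ γ₁ x) = 0 ∧ qf c (arcLine φ γ₂ x) = 0 := by
  obtain ⟨r, H, hr, hrU, hH, hHz, hdet, hq₁, hq₂⟩ := h.exists_local_form hp
  set N := Metric.ball p r
  have hNo : IsOpen N := Metric.isOpen_ball
  have hNp : N ∈ 𝓝 p := Metric.ball_mem_nhds p hr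
  have hNc : IsConnected N :=
    ⟨⟨p, Metric.mem_ball_self hr⟩, (convex_ball p r).isPreconnected⟩
  set SA := coneOver (arcLine φ γ₁) N
  set SB := coneOver (arcLine φ γ₂) N
  have hA : IrrCone SA := (h.arcLine_analytic.mono hrU).irrCone_coneOver hNo hNc
  have hB : IrrCone SB := (h.symm.arcLine_analytic.mono hrU).irrCone_coneOver hNo hNc
  have hnA : NonPencil SA := by
    intro k hk
    by_contra! hc
    refine hk (hn ?_)
    rw [hk₀]
    intro x hx
    refine h.polyFun_arcLine_eq_zero (f := dt k)
      (PolyFun.dt (fun i => .const (k i)) (fun i => .coord i)) hp ?_ hx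
    filter_upwards [hNp] with y hy using hc _ (mem_coneOver hy)
  have h1 : ∀ L ∈ SA, ∃ q, ∀ M ∈ SB, H (cr L M) = qf q (cr L M) := by
    rintro _ ⟨s, x, hx, rfl⟩
    obtain ⟨q, hq⟩ := hq₁ x hx
    refine ⟨q, ?_⟩
    rintro _ ⟨t, y, hy, rfl⟩
    rw [cr_smul_smul, hH, qf_smul, hq y hy]
  have h2 : ∀ M ∈ SB, ∃ q, ∀ L ∈ SA, H (cr L M) = qf q (cr L M) := by
    rintro _ ⟨t, y, hy, rfl⟩
    obtain ⟨q, hq⟩ := hq₂ y hy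
    refine ⟨q, ?_⟩
    rintro _ ⟨s, x, hx, rfl⟩
    rw [cr_smul_smul, hH, qf_smul, hq x hx]
  rcases quadratic_or_common_conic hA hB hnA (h.symm.exists_cr_ne_zero hp hNp hrU) h1 h2 with
    ⟨q, f, hf, ⟨_, ⟨t, y, hy, rfl⟩, hne⟩, hq⟩ | ⟨G, hG0, hG, hGA, hGB⟩
  · exfalso
    obtain ⟨s, hs, hs0⟩ : ∃ s : ℝ, f (s • arcLine φ γ₂ y) ≠ 0 ∧ s ≠ 0 := by
      have hc : Continuous fun s : ℝ => f (s • arcLine φ γ₂ y) :=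
        hf.continuous.comp (by fun_prop)
      obtain ⟨s, hs⟩ := (dense_compl_singleton (0 : ℝ)).inter_nhds_nonempty
        (hc.continuousAt.eventually_ne hne)
      exact ⟨s, hs.2, hs.1⟩
    refine h.not_eventually_quadratic hfin (hrU hy) q ?_
    have hc : ContinuousAt (fun x => f (s • arcLine φ γ₂ x)) y :=
      ContinuousAt.comp (g := f) (f := fun x => s • arcLine φ γ₂ x) hf.continuous.continuousAt
        ((h.symm.analyticAt_arcLine (hrU hy)).continuousAt.const_smul s)
    filter_upwards [hc.eventually_ne hs, hNo.mem_nhds hy] with x hx hxN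
    have key := hq (s • arcLine φ γ₂ x) ⟨s, x, hxN, rfl⟩ hx _ (mem_coneOver hxN)
    have hone : cr (arcLine φ γ₁ x) (s • arcLine φ γ₂ x) = (1 * s) • cr (arcLine φ γ₁ x) (arcLine φ γ₂ x) := by
      rw [← cr_smul_smul, one_smul]
    rw [hone, one_mul, h.cr_arcLine, hH, hH, qf_smul, qf_smul, hHz x hxN] at key
    have hd := h.det_ne x (hrU hxN)
    exact mul_left_cancel₀ (pow_ne_zero 2 hd) (mul_left_cancel₀ (pow_ne_zero 2 hs0) key)
  · obtain ⟨c, hc⟩ := hG.isQuad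
    beta_reduce at hc
    have hc0 : ∃ x, qf c x ≠ 0 := by
      by_contra! h0
      exact hG0 (MvPolynomial.funext fun x => by rw [← hc, h0, map_zero])
    obtain ⟨e0, e1, e2, he, hnf⟩ := exists_conic_normal_form hA hnA hc0
      (fun x hx => (hc x).trans (hGA x hx))
    have hpf : PolyFun (qf c) := PolyFun.qf c fun i => .coord i
    refine ⟨c, e0, e1, e2, he, hnf, fun x hx => ⟨h.polyFun_arcLine_eq_zero hpf hp ?_ hx,
      h.symm.polyFun_arcLine_eq_zero hpf hp ?_ hx⟩⟩
    · filter_upwards [hNp] with y hy using (hc _).trans (hGA _ (mem_coneOver hy))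
    · filter_upwards [hNp] with y hy using (hc _).trans (hGB _ (mem_coneOver hy))

/-- The lines of the two families form two pencils, or are tangent to a common conic. -/
theorem pencils_or_common_conic (h : IsDoubleArcFamily U φ γ₁ γ₂ C₁ C₂)
    (hfin : ∃ D : Set R3, D ⊆ φ '' U ∧ φ '' U ⊆ closure D ∧ ∀ q ∈ D,
      {C : Set R3 | (IsIsotropicCircle C ∨ IsLine3 C) ∧ ArcThroughIn C q (φ '' U)}.Finite) :
    (∃ k k' : Fin 3 → ℝ, k ≠ 0 ∧ k' ≠ 0 ∧
      ∀ x ∈ U, dt k (arcLine φ γ₁ x) = 0 ∧ dt k' (arcLine φ γ₂ x) = 0) ∨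
    ∃ c e0 e1 e2, det3 e0 e1 e2 ≠ 0 ∧
      (∀ s0 s1 s2 : ℝ, qf c (s0 • e0 + s1 • e1 + s2 • e2) = 0 → s1 ^ 2 = s0 * s2) ∧
      ∀ x ∈ U, qf c (arcLine φ γ₁ x) = 0 ∧ qf c (arcLine φ γ₂ x) = 0 := by
  obtain ⟨p, hp⟩ := h.surface.isConnected.nonempty
  by_cases h₁ : {k | ∀ x ∈ U, dt k (arcLine φ γ₁ x) = 0} ⊆ {0}
  · exact Or.inr (h.exists_common_conic hfin hp rfl h₁)
  by_cases h₂ : {k | ∀ x ∈ U, dt k (arcLine φ γ₂ x) = 0} ⊆ {0}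
  · obtain ⟨c, e0, e1, e2, he, hnf, hc⟩ := h.symm.exists_common_conic hfin hp rfl h₂
    exact Or.inr ⟨c, e0, e1, e2, he, hnf, fun x hx => (hc x hx).symm⟩
  · obtain ⟨k, hk, hk0⟩ := not_subset.1 h₁
    obtain ⟨k', hk', hk0'⟩ := not_subset.1 h₂
    exact Or.inl ⟨k, k', hk0, hk0', fun x hx => ⟨hk x hx, hk' x hx⟩⟩

end IsDoubleArcFamily

/-- A parametrization of two families of lines by rational functions `u = s₁ / s₀` and
`v = t₁ / t₀`, such that the intersection point of two lines is a biaffine function of `u`, `v`. -/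
structure LineParam (U : Set (ℝ × ℝ)) (L₁ L₂ : ℝ × ℝ → Fin 3 → ℝ) where
  (a₀ a₁ a₂ a₃ l₁ l₂ : Fin 3 → ℝ)
  (s₀ s₁ t₀ t₁ : ℝ × ℝ → ℝ)
  analytic_s₀ : AnalyticOnNhd ℝ s₀ U
  analytic_s₁ : AnalyticOnNhd ℝ s₁ U
  analytic_t₀ : AnalyticOnNhd ℝ t₀ U
  analytic_t₁ : AnalyticOnNhd ℝ t₁ U
  l₁_ne : l₁ ≠ 0
  l₂_ne : l₂ ≠ 0
  s₀_ne : ∀ p ∈ U, dt l₁ (cr (L₁ p) (L₂ p)) ≠ 0 → s₀ p ≠ 0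
  t₀_ne : ∀ p ∈ U, dt l₂ (cr (L₁ p) (L₂ p)) ≠ 0 → t₀ p ≠ 0
  cr_eq : ∀ p ∈ U, ∀ q ∈ U, s₀ p ≠ 0 → t₀ q ≠ 0 → ∃ c : ℝ, cr (L₁ p) (L₂ q) =
    c • (a₀ + (s₁ p / s₀ p) • a₁ + (t₁ q / t₀ q) • a₂ + (s₁ p / s₀ p * (t₁ q / t₀ q)) • a₃)
  dt_left : ∀ p ∈ U, dt l₁ (cr (L₁ p) (L₂ p)) ≠ 0 → dt l₂ (cr (L₁ p) (L₂ p)) ≠ 0 →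
    ∃ w₀ w₁ : ℝ, w₀ + w₁ * (t₁ p / t₀ p) ≠ 0 ∧ ∀ u v : ℝ,
      dt (L₁ p) (a₀ + u • a₁ + v • a₂ + (u * v) • a₃) = (u - s₁ p / s₀ p) * (w₀ + w₁ * v)
  dt_right : ∀ p ∈ U, dt l₁ (cr (L₁ p) (L₂ p)) ≠ 0 → dt l₂ (cr (L₁ p) (L₂ p)) ≠ 0 →
    ∃ w₀ w₁ : ℝ, w₀ + w₁ * (s₁ p / s₀ p) ≠ 0 ∧ ∀ u v : ℝ,
      dt (L₂ p) (a₀ + u • a₁ + v • a₂ + (u * v) • a₃) = (v - t₁ p / t₀ p) * (w₀ + w₁ * u)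
  smul_left : ∀ p ∈ U, ∀ q ∈ U, s₀ p ≠ 0 → s₀ q ≠ 0 → s₁ p / s₀ p = s₁ q / s₀ q →
    s₀ q • L₁ p = s₀ p • L₁ q
  smul_right : ∀ p ∈ U, ∀ q ∈ U, t₀ p ≠ 0 → t₀ q ≠ 0 → t₁ p / t₀ p = t₁ q / t₀ q →
    t₀ q • L₂ p = t₀ p • L₂ q

lemma dt_cr_swap (l x y : Fin 3 → ℝ) : dt l (cr x y) = -dt l (cr y x) := by
  rw [cr_swap, dt_smul, neg_one_mul]

/-- The parametrization with the two families interchanged. -/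
def LineParam.symm {U : Set (ℝ × ℝ)} {L₁ L₂ : ℝ × ℝ → Fin 3 → ℝ} (D : LineParam U L₁ L₂) :
    LineParam U L₂ L₁ where
  a₀ := D.a₀
  a₁ := D.a₂
  a₂ := D.a₁
  a₃ := D.a₃
  l₁ := D.l₂
  l₂ := D.l₁
  s₀ := D.t₀
  s₁ := D.t₁
  t₀ := D.s₀
  t₁ := D.s₁
  analytic_s₀ := D.analytic_t₀
  analytic_s₁ := D.analytic_t₁
  analytic_t₀ := D.analytic_s₀
  analytic_t₁ := D.analytic_s₁
  l₁_ne := D.l₂_ne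
  l₂_ne := D.l₁_ne
  s₀_ne p hp h := D.t₀_ne p hp (by rwa [dt_cr_swap, neg_ne_zero] at h)
  t₀_ne p hp h := D.s₀_ne p hp (by rwa [dt_cr_swap, neg_ne_zero] at h)
  cr_eq p hp q hq hs ht := by
    obtain ⟨c, hc⟩ := D.cr_eq q hq p hp ht hs
    refine ⟨-c, ?_⟩
    rw [cr_swap, hc, smul_smul, neg_one_mul, mul_comm (D.s₁ q / D.s₀ q)]
    congr 2
    abel
  dt_left p hp h₁ h₂ := by
    rw [dt_cr_swap, neg_ne_zero] at h₁ h₂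
    obtain ⟨w₀, w₁, hw, h⟩ := D.dt_right p hp h₂ h₁
    refine ⟨w₀, w₁, hw, fun u v => ?_⟩
    rw [← h, mul_comm v]
    congr 2
    abel
  dt_right p hp h₁ h₂ := by
    rw [dt_cr_swap, neg_ne_zero] at h₁ h₂
    obtain ⟨w₀, w₁, hw, h⟩ := D.dt_left p hp h₂ h₁
    refine ⟨w₀, w₁, hw, fun u v => ?_⟩
    rw [← h, mul_comm v]
    congr 2
    abel
  smul_left := D.smul_right
  smul_right := D.smul_left

lemma exists_basis_of_dt_eq_zero {k : Fin 3 → ℝ} (hk : k ≠ 0) : ∃ e₀ e₁ σ₀ σ₁ : Fin 3 → ℝ,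
    e₁ ≠ 0 ∧ ∀ x, dt k x = 0 → x = dt σ₀ x • e₀ + dt σ₁ x • e₁ := by
  by_cases h0 : k 0 = 0
  · by_cases h1 : k 1 = 0
    · have h2 : k 2 ≠ 0 := fun h2 => hk (vec3_ext h0 h1 h2)
      refine ⟨![1, 0, 0], ![0, 1, 0], ![1, 0, 0], ![0, 1, 0], fun h => by simpa using congr_fun h 1,
        fun x hx => ?_⟩
      simp only [dt, h0, h1, zero_mul, zero_add] at hx
      have := (mul_eq_zero.1 hx).resolve_left h2
      refine vec3_ext ?_ ?_ ?_ <;> simp [dt, this]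
    · refine ⟨![1, 0, 0], ![0, -(k 2 / k 1), 1], ![1, 0, 0], ![0, 0, 1],
        fun h => by simpa using congr_fun h 2, fun x hx => ?_⟩
      simp only [dt, h0] at hx
      refine vec3_ext ?_ ?_ ?_ <;> simp [dt]
      field_simp
      linear_combination hx
  · refine ⟨![-(k 1 / k 0), 1, 0], ![-(k 2 / k 0), 0, 1], ![0, 1, 0], ![0, 0, 1],
      fun h => by simpa using congr_fun h 2, fun x hx => ?_⟩
    simp only [dt] at hx
    refine vec3_ext ?_ ?_ ?_ <;> simp [dt]
    field_simp
    linear_combination hx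

lemma exists_dual_basis {e₀ e₁ e₂ : Fin 3 → ℝ} (he : det3 e₀ e₁ e₂ ≠ 0) :
    ∃ σ₀ σ₁ σ₂ : Fin 3 → ℝ, ∀ x, x = dt σ₀ x • e₀ + dt σ₁ x • e₁ + dt σ₂ x • e₂ := by
  refine ⟨(det3 e₀ e₁ e₂)⁻¹ • cr e₁ e₂, (det3 e₀ e₁ e₂)⁻¹ • cr e₂ e₀,
    (det3 e₀ e₁ e₂)⁻¹ • cr e₀ e₁, fun x => ?_⟩
  simp only [smul_dt, mul_smul, ← smul_add]
  rw [eq_inv_smul_iff₀ he]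
  refine vec3_ext ?_ ?_ ?_ <;>
    simp only [det3, dt, cr_zero, cr_one, cr_two, Pi.add_apply, Pi.smul_apply, smul_eq_mul] <;> ring

lemma AnalyticOnNhd.dt {U : Set (ℝ × ℝ)} {L : ℝ × ℝ → Fin 3 → ℝ} (hL : AnalyticOnNhd ℝ L U)
    (σ : Fin 3 → ℝ) : AnalyticOnNhd ℝ (fun p => dt σ (L p)) U := by
  have h i := analyticOnNhd_pi_iff.1 hL i
  exact (((analyticOnNhd_const.mul (h 0)).add (analyticOnNhd_const.mul (h 1))).add
    (analyticOnNhd_const.mul (h 2)))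

section
variable {U : Set (ℝ × ℝ)} {L₁ L₂ : ℝ × ℝ → Fin 3 → ℝ}

/-- Two families of lines, each with a common point, admit a parametrization. -/
theorem exists_lineParam_of_pencils (hL₁ : AnalyticOnNhd ℝ L₁ U) (hL₂ : AnalyticOnNhd ℝ L₂ U)
    {k₁ k₂ : Fin 3 → ℝ} (hk₁ : k₁ ≠ 0) (hk₂ : k₂ ≠ 0) (h₁ : ∀ p ∈ U, dt k₁ (L₁ p) = 0)
    (h₂ : ∀ p ∈ U, dt k₂ (L₂ p) = 0) : Nonempty (LineParam U L₁ L₂) := by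
  obtain ⟨e₀, e₁, σ₀, σ₁, he, hσ⟩ := exists_basis_of_dt_eq_zero hk₁
  obtain ⟨f₀, f₁, τ₀, τ₁, hf, hτ⟩ := exists_basis_of_dt_eq_zero hk₂
  replace h₁ p hp := hσ _ (h₁ p hp)
  replace h₂ p hp := hτ _ (h₂ p hp)
  have hs {p} (hp : p ∈ U) (h : dt e₁ (cr (L₁ p) (L₂ p)) ≠ 0) : dt σ₀ (L₁ p) ≠ 0 := by
    intro h0
    rw [h₁ p hp, h0] at h
    exact h (by simp [dt]; ring)
  have ht {p} (hp : p ∈ U) (h : dt f₁ (cr (L₁ p) (L₂ p)) ≠ 0) : dt τ₀ (L₂ p) ≠ 0 := by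
    intro h0
    rw [h₂ p hp, h0] at h
    exact h (by simp [dt]; ring)
  have hL {p} (hp : p ∈ U) (h : dt σ₀ (L₁ p) ≠ 0) :
      L₁ p = dt σ₀ (L₁ p) • (e₀ + (dt σ₁ (L₁ p) / dt σ₀ (L₁ p)) • e₁) := by
    rw [smul_add, smul_smul, mul_div_cancel₀ _ h]
    exact h₁ p hp
  have hM {p} (hp : p ∈ U) (h : dt τ₀ (L₂ p) ≠ 0) :
      L₂ p = dt τ₀ (L₂ p) • (f₀ + (dt τ₁ (L₂ p) / dt τ₀ (L₂ p)) • f₁) := by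
    rw [smul_add, smul_smul, mul_div_cancel₀ _ h]
    exact h₂ p hp
  refine ⟨{
    a₀ := cr e₀ f₀, a₁ := cr e₁ f₀, a₂ := cr e₀ f₁, a₃ := cr e₁ f₁, l₁ := e₁, l₂ := f₁
    s₀ := fun p => dt σ₀ (L₁ p), s₁ := fun p => dt σ₁ (L₁ p)
    t₀ := fun p => dt τ₀ (L₂ p), t₁ := fun p => dt τ₁ (L₂ p)
    analytic_s₀ := hL₁.dt _, analytic_s₁ := hL₁.dt _
    analytic_t₀ := hL₂.dt _, analytic_t₁ := hL₂.dt _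
    l₁_ne := he, l₂_ne := hf
    s₀_ne := fun p hp => hs hp
    t₀_ne := fun p hp => ht hp
    cr_eq := ?_, dt_left := ?_, dt_right := ?_, smul_left := ?_, smul_right := ?_ }⟩
  · intro p hp q hq h h'
    refine ⟨dt σ₀ (L₁ p) * dt τ₀ (L₂ q), ?_⟩
    have h1 := hL hp h
    have h2 := hM hq h'
    generalize dt σ₁ (L₁ p) / dt σ₀ (L₁ p) = u at *
    generalize dt τ₁ (L₂ q) / dt τ₀ (L₂ q) = v at *
    generalize dt σ₀ (L₁ p) = s at *
    generalize dt τ₀ (L₂ q) = t at *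
    rw [h1, h2]
    refine vec3_ext ?_ ?_ ?_ <;> simp <;> ring
  · intro p hp hg hg'
    have h1 := hL hp (hs hp hg)
    have h2 := hM hp (ht hp hg')
    generalize dt σ₁ (L₁ p) / dt σ₀ (L₁ p) = u₀ at *
    generalize dt τ₁ (L₂ p) / dt τ₀ (L₂ p) = v₀ at *
    generalize dt σ₀ (L₁ p) = s at *
    generalize dt τ₀ (L₂ p) = t at *
    rw [h1, h2] at hg
    refine ⟨s * det3 e₀ e₁ f₀, s * det3 e₀ e₁ f₁, fun h0 => hg ?_, fun u v => ?_⟩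
    · simp only [det3, dt, cr_zero, cr_one, cr_two, Pi.add_apply, Pi.smul_apply, smul_eq_mul] at h0 ⊢
      linear_combination -t * h0
    · rw [h1]
      simp only [det3, dt, cr_zero, cr_one, cr_two, Pi.add_apply, Pi.smul_apply, smul_eq_mul]
      ring
  · intro p hp hg hg'
    have h1 := hL hp (hs hp hg)
    have h2 := hM hp (ht hp hg')
    generalize dt σ₁ (L₁ p) / dt σ₀ (L₁ p) = u₀ at *
    generalize dt τ₁ (L₂ p) / dt τ₀ (L₂ p) = v₀ at *
    generalize dt σ₀ (L₁ p) = s at *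
    generalize dt τ₀ (L₂ p) = t at *
    rw [h1, h2] at hg'
    refine ⟨-t * det3 f₀ f₁ e₀, -t * det3 f₀ f₁ e₁, fun h0 => hg' ?_, fun u v => ?_⟩
    · simp only [det3, dt, cr_zero, cr_one, cr_two, Pi.add_apply, Pi.smul_apply, smul_eq_mul] at h0 ⊢
      linear_combination -s * h0
    · rw [h2]
      simp only [det3, dt, cr_zero, cr_one, cr_two, Pi.add_apply, Pi.smul_apply, smul_eq_mul]
      ring
  · intro p hp q hq h h' huv
    have h1 := hL hp h
    have h2 := hL hq h'
    rw [← huv] at h2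
    generalize dt σ₁ (L₁ p) / dt σ₀ (L₁ p) = u at *
    generalize dt σ₀ (L₁ p) = s at *
    generalize dt σ₀ (L₁ q) = t at *
    rw [h1, h2, smul_comm]
  · intro p hp q hq h h' huv
    have h1 := hM hp h
    have h2 := hM hq h'
    rw [← huv] at h2
    generalize dt τ₁ (L₂ p) / dt τ₀ (L₂ p) = u at *
    generalize dt τ₀ (L₂ p) = s at *
    generalize dt τ₀ (L₂ q) = t at *
    rw [h1, h2, smul_comm]

/-- Two families of tangents to a common conic admit a parametrization. -/
theorem exists_lineParam_of_conic (hL₁ : AnalyticOnNhd ℝ L₁ U) (hL₂ : AnalyticOnNhd ℝ L₂ U)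
    {e₀ e₁ e₂ : Fin 3 → ℝ} (he : det3 e₀ e₁ e₂ ≠ 0) {c : Fin 6 → ℝ}
    (hc : ∀ s₀ s₁ s₂ : ℝ, qf c (s₀ • e₀ + s₁ • e₁ + s₂ • e₂) = 0 → s₁ ^ 2 = s₀ * s₂)
    (h₁ : ∀ p ∈ U, qf c (L₁ p) = 0) (h₂ : ∀ p ∈ U, qf c (L₂ p) = 0) :
    Nonempty (LineParam U L₁ L₂) := by
  obtain ⟨σ₀, σ₁, σ₂, hσ⟩ := exists_dual_basis he
  have he₂ : e₂ ≠ 0 := by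
    rintro rfl
    exact he (by simp [det3, dt])
  have hx {x} (hx : qf c x = 0) : dt σ₁ x ^ 2 = dt σ₀ x * dt σ₂ x := by
    rw [hσ x] at hx
    exact hc _ _ _ hx
  have h0 {x} (hq : qf c x = 0) (h : dt σ₀ x = 0) : x = dt σ₂ x • e₂ := by
    have h1 := hx hq
    rw [h, zero_mul] at h1
    have h2 := hσ x
    rwa [h, pow_eq_zero_iff two_ne_zero |>.1 h1, zero_smul, zero_smul, zero_add, zero_add] at h2
  have hL {x} (hq : qf c x = 0) (h : dt σ₀ x ≠ 0) : x = dt σ₀ x • (e₀ + (dt σ₁ x / dt σ₀ x) • e₁ +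
      (dt σ₁ x / dt σ₀ x) ^ 2 • e₂) := by
    have h2 : dt σ₀ x * (dt σ₁ x / dt σ₀ x) ^ 2 = dt σ₂ x := by
      field_simp
      exact hx hq
    rw [smul_add, smul_add, smul_smul, smul_smul, mul_div_cancel₀ _ h, h2]
    exact hσ x
  have hs {x y} (hq : qf c x = 0) (h : dt e₂ (cr x y) ≠ 0) : dt σ₀ x ≠ 0 := by
    intro hz
    rw [h0 hq hz] at h
    exact h (by simp [dt]; ring)
  have ht {x y} (hq : qf c y = 0) (h : dt e₂ (cr x y) ≠ 0) : dt σ₀ y ≠ 0 :=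
    hs (y := x) hq (by rwa [dt_cr_swap, neg_ne_zero])
  have hne {x y} (hqx : qf c x = 0) (hqy : qf c y = 0) (h : dt e₂ (cr x y) ≠ 0) :
      dt σ₁ x / dt σ₀ x ≠ dt σ₁ y / dt σ₀ y := by
    intro huv
    have h1 := hL hqx (hs hqx h)
    have h2 := hL hqy (ht hqy h)
    rw [← huv] at h2
    rw [h1, h2] at h
    exact h (by simp [dt]; ring)
  have hdt {x} (hq : qf c x = 0) (h : dt σ₀ x ≠ 0) (u v : ℝ) :
      dt x (cr e₀ e₁ + u • cr e₀ e₂ + v • cr e₀ e₂ + (u * v) • cr e₁ e₂) =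
        (u - dt σ₁ x / dt σ₀ x) * (v - dt σ₁ x / dt σ₀ x) * (dt σ₀ x * det3 e₀ e₁ e₂) := by
    have h1 := hL hq h
    generalize dt σ₁ x / dt σ₀ x = u₀ at *
    generalize dt σ₀ x = s at *
    rw [h1]
    simp only [det3, dt, cr_zero, cr_one, cr_two, Pi.add_apply, Pi.smul_apply, smul_eq_mul]
    ring
  have hsm {x y} (hqx : qf c x = 0) (hqy : qf c y = 0) (h : dt σ₀ x ≠ 0) (h' : dt σ₀ y ≠ 0)
      (huv : dt σ₁ x / dt σ₀ x = dt σ₁ y / dt σ₀ y) : dt σ₀ y • x = dt σ₀ x • y := by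
    have h1 := hL hqx h
    have h2 := hL hqy h'
    rw [← huv] at h2
    generalize dt σ₁ x / dt σ₀ x = u at *
    generalize dt σ₀ x = s at *
    generalize dt σ₀ y = t at *
    rw [h1, h2, smul_comm]
  refine ⟨{
    a₀ := cr e₀ e₁, a₁ := cr e₀ e₂, a₂ := cr e₀ e₂, a₃ := cr e₁ e₂, l₁ := e₂, l₂ := e₂
    s₀ := fun p => dt σ₀ (L₁ p), s₁ := fun p => dt σ₁ (L₁ p)
    t₀ := fun p => dt σ₀ (L₂ p), t₁ := fun p => dt σ₁ (L₂ p)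
    analytic_s₀ := hL₁.dt _, analytic_s₁ := hL₁.dt _
    analytic_t₀ := hL₂.dt _, analytic_t₁ := hL₂.dt _
    l₁_ne := he₂, l₂_ne := he₂
    s₀_ne := fun p hp => hs (h₁ p hp)
    t₀_ne := fun p hp => ht (h₂ p hp)
    cr_eq := ?_, dt_left := ?_, dt_right := ?_
    smul_left := fun p hp q hq => hsm (h₁ p hp) (h₁ q hq)
    smul_right := fun p hp q hq => hsm (h₂ p hp) (h₂ q hq) }⟩
  · intro p hp q hq h h'
    have h1 := hL (h₁ p hp) h
    have h2 := hL (h₂ q hq) h'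
    refine ⟨dt σ₀ (L₁ p) * dt σ₀ (L₂ q) *
      (dt σ₁ (L₂ q) / dt σ₀ (L₂ q) - dt σ₁ (L₁ p) / dt σ₀ (L₁ p)), ?_⟩
    generalize dt σ₁ (L₁ p) / dt σ₀ (L₁ p) = u at *
    generalize dt σ₁ (L₂ q) / dt σ₀ (L₂ q) = v at *
    generalize dt σ₀ (L₁ p) = s at *
    generalize dt σ₀ (L₂ q) = t at *
    rw [h1, h2]
    refine vec3_ext ?_ ?_ ?_ <;> simp <;> ring
  · intro p hp h _
    have h0 := hs (h₁ p hp) h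
    refine ⟨-(dt σ₁ (L₁ p) / dt σ₀ (L₁ p)) * (dt σ₀ (L₁ p) * det3 e₀ e₁ e₂),
      dt σ₀ (L₁ p) * det3 e₀ e₁ e₂, ?_, fun u v => ?_⟩
    · have := mul_ne_zero (sub_ne_zero.2 (hne (h₁ p hp) (h₂ p hp) h)) (mul_ne_zero h0 he)
      refine fun hz => this ?_
      linear_combination -hz
    · rw [hdt (h₁ p hp) h0]
      ring
  · intro p hp h _
    have h0 := ht (h₂ p hp) h
    refine ⟨-(dt σ₁ (L₂ p) / dt σ₀ (L₂ p)) * (dt σ₀ (L₂ p) * det3 e₀ e₁ e₂),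
      dt σ₀ (L₂ p) * det3 e₀ e₁ e₂, ?_, fun u v => ?_⟩
    · have := mul_ne_zero (sub_ne_zero.2 (hne (h₁ p hp) (h₂ p hp) h)) (mul_ne_zero h0 he)
      refine fun hz => this ?_
      linear_combination hz
    · rw [hdt (h₂ p hp) h0]
      ring

end

/-- A polynomial of degree at most two in each of the variables, evaluated at `(u, v)`. -/
def biquad (z : Fin 3 → Fin 3 → ℝ) (u v : ℝ) : ℝ :=
  (z 0 0 + z 0 1 * v + z 0 2 * v ^ 2) + (z 1 0 + z 1 1 * v + z 1 2 * v ^ 2) * u +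
    (z 2 0 + z 2 1 * v + z 2 2 * v ^ 2) * u ^ 2

/-- A function quadratic in each of two variables is a polynomial. -/
lemma exists_biquad {S T : Set ℝ} (hT : T.Infinite) {F : ℝ → ℝ → ℝ}
    (h₁ : ∀ u ∈ S, ∃ a b c : ℝ, ∀ v ∈ T, F u v = a + b * v + c * v ^ 2)
    (h₂ : ∀ v ∈ T, ∃ a b c : ℝ, ∀ u ∈ S, F u v = a + b * u + c * u ^ 2) :
    ∃ z, ∀ u ∈ S, ∀ v ∈ T, F u v = biquad z u v := by
  obtain ⟨x, hx⟩ := hT.nonempty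
  obtain ⟨y, hy, hyx⟩ := hT.exists_notMem_finset {x}
  obtain ⟨w, hw, hwx⟩ := hT.exists_notMem_finset {x, y}
  simp only [Finset.mem_insert, Finset.mem_singleton, not_or] at hyx hwx
  have hxy := sub_ne_zero.2 hyx
  have hxw := sub_ne_zero.2 hwx.1
  have hyw := sub_ne_zero.2 hwx.2
  obtain ⟨a, b, c, ha⟩ := h₂ x hx
  obtain ⟨a', b', c', ha'⟩ := h₂ y hy
  obtain ⟨a'', b'', c'', ha''⟩ := h₂ w hw
  set k := ((y - x) * (w - x))⁻¹ with hk
  set k' := ((y - x) * (w - y))⁻¹ with hk'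
  set k'' := ((w - x) * (w - y))⁻¹ with hk''
  refine ⟨![![a * k * (y * w) - a' * k' * (x * w) + a'' * k'' * (x * y),
      -(a * k * (y + w)) + a' * k' * (x + w) - a'' * k'' * (x + y), a * k - a' * k' + a'' * k''],
    ![b * k * (y * w) - b' * k' * (x * w) + b'' * k'' * (x * y),
      -(b * k * (y + w)) + b' * k' * (x + w) - b'' * k'' * (x + y), b * k - b' * k' + b'' * k''],
    ![c * k * (y * w) - c' * k' * (x * w) + c'' * k'' * (x * y),
      -(c * k * (y + w)) + c' * k' * (x + w) - c'' * k'' * (x + y), c * k - c' * k' + c'' * k'']],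
    fun u hu v hv => ?_⟩
  obtain ⟨p, q, r, hF⟩ := h₁ u hu
  have hL : F u v = F u x * (k * ((v - y) * (v - w))) - F u y * (k' * ((v - x) * (v - w))) +
      F u w * (k'' * ((v - x) * (v - y))) := by
    rw [hF v hv, hF x hx, hF y hy, hF w hw, hk, hk', hk'']
    field_simp
    ring
  rw [hL, ha u hu, ha' u hu, ha'' u hu]
  simp only [biquad, Matrix.cons_val_zero, Matrix.cons_val_one, Matrix.cons_val]
  ring

lemma qf_add_smul (q : Fin 6 → ℝ) (x y : Fin 3 → ℝ) (v : ℝ) :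
    qf q (x + v • y) = qf q x + qpolar q x y * v + qf q y * v ^ 2 := by
  have := qf_comb q x y 1 v
  rw [one_smul] at this
  rw [this]
  ring

namespace LineParam
variable {U : Set (ℝ × ℝ)} {L₁ L₂ : ℝ × ℝ → Fin 3 → ℝ} (D : LineParam U L₁ L₂) {p q : ℝ × ℝ}

/-- The first parameter of a point. -/
noncomputable def u (p : ℝ × ℝ) : ℝ := D.s₁ p / D.s₀ p

/-- The second parameter of a point. -/
noncomputable def v (p : ℝ × ℝ) : ℝ := D.t₁ p / D.t₀ p

/-- The point with given parameters. -/
def pt (u v : ℝ) : Fin 3 → ℝ := D.a₀ + u • D.a₁ + v • D.a₂ + (u * v) • D.a₃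

/-- The points where the parameters are well-defined. -/
def good : Set (ℝ × ℝ) :=
  {p | p ∈ U ∧ dt D.l₁ (cr (L₁ p) (L₂ p)) ≠ 0 ∧ dt D.l₂ (cr (L₁ p) (L₂ p)) ≠ 0}

variable {D}

lemma s₀_ne_zero (hp : p ∈ D.good) : D.s₀ p ≠ 0 := D.s₀_ne p hp.1 hp.2.1

lemma t₀_ne_zero (hp : p ∈ D.good) : D.t₀ p ≠ 0 := D.t₀_ne p hp.1 hp.2.2

lemma good_symm : D.symm.good = D.good := by
  ext p
  simp only [good, mem_ofPred_eq, symm, dt_cr_swap _ (L₂ p), neg_ne_zero]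
  tauto

lemma pt_symm (u v : ℝ) : D.symm.pt v u = D.pt u v := by
  simp only [pt, symm, mul_comm v]
  abel

lemma analyticAt_u (hp : p ∈ D.good) : AnalyticAt ℝ D.u p :=
  (D.analytic_s₁ p hp.1).div (D.analytic_s₀ p hp.1) (s₀_ne_zero hp)

lemma analyticAt_v (hp : p ∈ D.good) : AnalyticAt ℝ D.v p :=
  (D.analytic_t₁ p hp.1).div (D.analytic_t₀ p hp.1) (t₀_ne_zero hp)

lemma exists_cr_eq (hp : p ∈ D.good) (hq : q ∈ D.good) :
    ∃ c : ℝ, cr (L₁ p) (L₂ q) = c • D.pt (D.u p) (D.v q) :=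
  D.cr_eq p hp.1 q hq.1 (s₀_ne_zero hp) (t₀_ne_zero hq)

lemma exists_qf_pt_eq_left (D : LineParam U L₁ L₂) (q : Fin 6 → ℝ) (u : ℝ) :
    ∃ a b c : ℝ, ∀ v, qf q (D.pt u v) = a + b * v + c * v ^ 2 := by
  refine ⟨qf q (D.a₀ + u • D.a₁), qpolar q (D.a₀ + u • D.a₁) (D.a₂ + u • D.a₃),
    qf q (D.a₂ + u • D.a₃), fun v => ?_⟩
  have h : D.pt u v = (D.a₀ + u • D.a₁) + v • (D.a₂ + u • D.a₃) := by
    rw [pt, smul_add, smul_smul, mul_comm v, add_assoc _ (v • _)]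
  rw [h, qf_add_smul]

lemma exists_qf_pt_eq_right (D : LineParam U L₁ L₂) (q : Fin 6 → ℝ) (v : ℝ) :
    ∃ a b c : ℝ, ∀ u, qf q (D.pt u v) = a + b * u + c * u ^ 2 := by
  simp only [← pt_symm (D := D)]
  exact D.symm.exists_qf_pt_eq_left q v

end LineParam

namespace IsDoubleArcFamily
variable {U : Set (ℝ × ℝ)} {φ : ℝ × ℝ → R3} {γ₁ γ₂ : ℝ × ℝ → ℝ → R3} {C₁ C₂ : ℝ × ℝ → Set R3}
  {p : ℝ × ℝ}

lemma dt_cr_arcLine_ne_zero (h : IsDoubleArcFamily U φ γ₁ γ₂ C₁ C₂) (hp : p ∈ U) (l : Fin 3 → ℝ) :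
    dt l (cr (arcLine φ γ₁ p) (arcLine φ γ₂ p)) ≠ 0 ↔ dt l (hv (topView (φ p))) ≠ 0 := by
  rw [h.cr_arcLine, dt_smul, mul_ne_zero_iff, and_iff_right (h.det_ne p hp)]

lemma mem_good (h : IsDoubleArcFamily U φ γ₁ γ₂ C₁ C₂)
    {D : LineParam U (arcLine φ γ₁) (arcLine φ γ₂)} : p ∈ D.good ↔
      p ∈ U ∧ dt D.l₁ (hv (topView (φ p))) ≠ 0 ∧ dt D.l₂ (hv (topView (φ p))) ≠ 0 :=
  and_congr_right fun hp => and_congr (h.dt_cr_arcLine_ne_zero hp _) (h.dt_cr_arcLine_ne_zero hp _)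

lemma continuousAt_dt_hv (h : IsDoubleArcFamily U φ γ₁ γ₂ C₁ C₂) (hp : p ∈ U) (l : Fin 3 → ℝ) :
    ContinuousAt (fun x => dt l (hv (topView (φ x)))) p := by
  have h1 : ContinuousAt (fun x => hv (topView (φ x))) p :=
    ContinuousAt.comp (g := fun w => hv (topView w)) (f := φ)
      (continuous_hv.comp continuous_topView).continuousAt (h.surface.analytic p hp).continuousAt
  have h2 := continuousAt_pi.1 h1
  unfold dt
  exact ((continuousAt_const.mul (h2 0)).add (continuousAt_const.mul (h2 1))).add
    (continuousAt_const.mul (h2 2))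

variable {D : LineParam U (arcLine φ γ₁) (arcLine φ γ₂)}

lemma isOpen_good (h : IsDoubleArcFamily U φ γ₁ γ₂ C₁ C₂) : IsOpen D.good := by
  refine isOpen_iff_eventually.2 fun x hx => ?_
  rw [h.mem_good] at hx
  filter_upwards [h.surface.isOpen.mem_nhds hx.1,
    (h.continuousAt_dt_hv hx.1 D.l₁).eventually_ne hx.2.1,
    (h.continuousAt_dt_hv hx.1 D.l₂).eventually_ne hx.2.2] with y h1 h2 h3
  exact h.mem_good.2 ⟨h1, h2, h3⟩

lemma exists_good (h : IsDoubleArcFamily U φ γ₁ γ₂ C₁ C₂) : D.good.Nonempty := by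
  obtain ⟨p, hp⟩ := h.surface.isConnected.nonempty
  obtain ⟨x, hxU, hx⟩ := h.exists_dt_hv_ne hp D.l₁_ne (h.surface.isOpen.mem_nhds hp)
  have hN : ∀ᶠ y in 𝓝 x, y ∈ U ∧ dt D.l₁ (hv (topView (φ y))) ≠ 0 :=
    (h.surface.isOpen.eventually_mem hxU).and ((h.continuousAt_dt_hv hxU D.l₁).eventually_ne hx)
  obtain ⟨y, hy, hy₂⟩ := h.exists_dt_hv_ne hxU D.l₂_ne hN
  exact ⟨y, h.mem_good.2 ⟨hy.1, hy.2, hy₂⟩⟩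

/-- The first parameter is not locally constant. -/
lemma infinite_u (h : IsDoubleArcFamily U φ γ₁ γ₂ C₁ C₂) {N : Set (ℝ × ℝ)} (hNo : IsOpen N)
    (hN : IsPreconnected N) (hNg : N ⊆ D.good) (hp : p ∈ N) : (D.u '' N).Infinite := by
  refine (hN.image _ fun x hx =>
    (LineParam.analyticAt_u (hNg hx)).continuousAt.continuousWithinAt).infinite_of_nontrivial ?_
  by_contra hc
  rw [not_nontrivial_iff] at hc
  obtain ⟨x, hx, hne⟩ := h.exists_dt_hv_ne (hNg hp).1 (h.arcLine_ne_zero (hNg hp).1)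
    (hNo.mem_nhds hp)
  have huv : D.u p = D.u x := hc (mem_image_of_mem _ hp) (mem_image_of_mem _ hx)
  have hs := D.smul_left p (hNg hp).1 x (hNg hx).1 (LineParam.s₀_ne_zero (hNg hp))
    (LineParam.s₀_ne_zero (hNg hx)) huv
  have h0 : dt (arcLine φ γ₁ x) (hv (topView (φ x))) = 0 := dt_lc_hv _ _
  have h1 := congrArg (dt · (hv (topView (φ x)))) hs
  simp only [smul_dt, h0, mul_zero] at h1
  exact mul_ne_zero (LineParam.s₀_ne_zero (hNg hx)) hne h1

/-- The point with parameters `u`, `v` in homogeneous coordinates. -/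
lemma pt_eq (h : IsDoubleArcFamily U φ γ₁ γ₂ C₁ C₂) (hp : p ∈ D.good) :
    D.pt (D.u p) (D.v p) 2 ≠ 0 ∧
      D.pt (D.u p) (D.v p) = D.pt (D.u p) (D.v p) 2 • hv (topView (φ p)) := by
  obtain ⟨c, hc⟩ := LineParam.exists_cr_eq hp hp
  rw [h.cr_arcLine] at hc
  have hd := h.det_ne p hp.1
  have h2 := congr_fun hc 2
  simp only [hv, Pi.smul_apply, Matrix.cons_val, smul_eq_mul, mul_one] at h2
  have hcR : c ≠ 0 ∧ D.pt (D.u p) (D.v p) 2 ≠ 0 := mul_ne_zero_iff.1 (h2 ▸ hd)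
  refine ⟨hcR.2, ?_⟩
  rw [h2, mul_smul] at hc
  exact (smul_right_injective _ hcR.1 hc).symm

/-- The height of the surface is a rational function of the parameters. -/
lemma exists_height_eq (h : IsDoubleArcFamily U φ γ₁ γ₂ C₁ C₂)
    (D : LineParam U (arcLine φ γ₁) (arcLine φ γ₂)) :
    ∃ z, ∀ x ∈ D.good, (φ x).2.2 * D.pt (D.u x) (D.v x) 2 ^ 2 = biquad z (D.u x) (D.v x) := by
  obtain ⟨p, hpg⟩ := h.exists_good (D := D)
  obtain ⟨r, H, hr, -, hH, hHz, hcr, hq₁, hq₂⟩ := h.exists_local_form hpg.1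
  obtain ⟨r', hr', hg⟩ := Metric.isOpen_iff.1 h.isOpen_good p hpg
  obtain ⟨N, hNo, hN, hNg, hpN, hNr⟩ : ∃ N : Set (ℝ × ℝ), IsOpen N ∧ IsPreconnected N ∧
      N ⊆ D.good ∧ p ∈ N ∧ N ⊆ Metric.ball p r :=
    ⟨Metric.ball p (min r r'), Metric.isOpen_ball, (convex_ball _ _).isPreconnected,
      (Metric.ball_subset_ball (min_le_right _ _)).trans hg, Metric.mem_ball_self (lt_min hr hr'),
      Metric.ball_subset_ball (min_le_left _ _)⟩
  have hT : (D.v '' N).Infinite :=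
    h.symm.infinite_u (D := D.symm) hNo hN (LineParam.good_symm.symm ▸ hNg) hpN
  have hform {x y} (hx : x ∈ N) (hy : y ∈ N) {q : Fin 6 → ℝ}
      (hq : H (cr (arcLine φ γ₁ x) (arcLine φ γ₂ y)) = qf q (cr (arcLine φ γ₁ x) (arcLine φ γ₂ y))) :
      H (D.pt (D.u x) (D.v y)) = qf q (D.pt (D.u x) (D.v y)) := by
    obtain ⟨c, hc⟩ := LineParam.exists_cr_eq (hNg hx) (hNg hy)
    have hc0 : c ≠ 0 := by
      rintro rfl
      exact hcr x (hNr hx) y (hNr hy) (by rw [hc, zero_smul]; rfl)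
    rw [hc, hH, qf_smul] at hq
    exact mul_left_cancel₀ (pow_ne_zero 2 hc0) hq
  obtain ⟨z, hz⟩ := exists_biquad (S := D.u '' N) hT (F := fun u v => H (D.pt u v)) (by
    rintro _ ⟨x, hx, rfl⟩
    obtain ⟨q, hq⟩ := hq₁ x (hNr hx)
    obtain ⟨a, b, c, hv⟩ := D.exists_qf_pt_eq_left q (D.u x)
    refine ⟨a, b, c, ?_⟩
    rintro _ ⟨y, hy, rfl⟩
    rw [← hv]
    exact hform hx hy (hq y (hNr hy))) (by
    rintro _ ⟨y, hy, rfl⟩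
    obtain ⟨q, hq⟩ := hq₂ y (hNr hy)
    obtain ⟨a, b, c, hv⟩ := D.exists_qf_pt_eq_right q (D.v y)
    refine ⟨a, b, c, ?_⟩
    rintro _ ⟨x, hx, rfl⟩
    rw [← hv]
    exact hform hx hy (hq x (hNr hx)))
  refine ⟨z, ?_⟩
  set ρ : ℝ × ℝ → ℝ := fun x => D.s₀ x * D.t₀ x * D.a₀ 2 + D.s₁ x * D.t₀ x * D.a₁ 2 +
    D.s₀ x * D.t₁ x * D.a₂ 2 + D.s₁ x * D.t₁ x * D.a₃ 2
  set ζ : ℝ × ℝ → ℝ := fun x =>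
    (z 0 0 * D.t₀ x ^ 2 + z 0 1 * (D.t₁ x * D.t₀ x) + z 0 2 * D.t₁ x ^ 2) * D.s₀ x ^ 2 +
    (z 1 0 * D.t₀ x ^ 2 + z 1 1 * (D.t₁ x * D.t₀ x) + z 1 2 * D.t₁ x ^ 2) * (D.s₁ x * D.s₀ x) +
    (z 2 0 * D.t₀ x ^ 2 + z 2 1 * (D.t₁ x * D.t₀ x) + z 2 2 * D.t₁ x ^ 2) * D.s₁ x ^ 2
  have hρ {x} (hx : x ∈ D.good) : ρ x = D.s₀ x * D.t₀ x * D.pt (D.u x) (D.v x) 2 := by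
    have h1 := LineParam.s₀_ne_zero hx
    have h2 := LineParam.t₀_ne_zero hx
    simp only [ρ, LineParam.pt, LineParam.u, LineParam.v, Pi.add_apply, Pi.smul_apply, smul_eq_mul]
    field_simp
  have hζ {x} (hx : x ∈ D.good) : ζ x = (D.s₀ x * D.t₀ x) ^ 2 * biquad z (D.u x) (D.v x) := by
    have h1 := LineParam.s₀_ne_zero hx
    have h2 := LineParam.t₀_ne_zero hx
    simp only [ζ, biquad, LineParam.u, LineParam.v]
    field_simp
  have han : AnalyticOnNhd ℝ (fun x => (φ x).2.2 * ρ x ^ 2 - ζ x) U := by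
    intro x hx
    have h0 := h.surface.analytic x hx
    have hz' : AnalyticAt ℝ (fun x => (φ x).2.2) x :=
      analyticAt_snd.comp_of_eq (f := fun x => (φ x).2) (analyticAt_snd.comp_of_eq h0 rfl) rfl
    have h1 := D.analytic_s₀ x hx
    have h2 := D.analytic_s₁ x hx
    have h3 := D.analytic_t₀ x hx
    have h4 := D.analytic_t₁ x hx
    simp only [ρ, ζ]
    fun_prop
  have hloc {x} (hx : x ∈ N) :
      (φ x).2.2 * D.pt (D.u x) (D.v x) 2 ^ 2 = biquad z (D.u x) (D.v x) := by
    rw [← hz _ (mem_image_of_mem _ hx) _ (mem_image_of_mem _ hx), (h.pt_eq (hNg hx)).2, hH,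
      hHz x (hNr hx), Pi.smul_apply, smul_eq_mul, mul_comm]
    simp [hv]
  have h0 : EqOn (fun x => (φ x).2.2 * ρ x ^ 2 - ζ x) 0 U := by
    refine han.eqOn_zero_of_preconnected_of_eventuallyEq_zero h.surface.isConnected.isPreconnected
      hpg.1 ?_
    filter_upwards [hNo.mem_nhds hpN] with x hx
    rw [hρ (hNg hx), hζ (hNg hx), ← hloc hx, Pi.zero_apply]
    ring
  intro x hx
  have h1 := h0 hx.1
  beta_reduce at h1
  rw [hρ hx, hζ hx, Pi.zero_apply, mul_pow, mul_left_comm, ← mul_sub] at h1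
  exact sub_eq_zero.1 ((mul_eq_zero.1 h1).resolve_left
    (pow_ne_zero 2 (mul_ne_zero (LineParam.s₀_ne_zero hx) (LineParam.t₀_ne_zero hx))))

end IsDoubleArcFamily

namespace IsDoubleArcFamily
variable {U : Set (ℝ × ℝ)} {φ : ℝ × ℝ → R3} {γ₁ γ₂ : ℝ × ℝ → ℝ → R3} {C₁ C₂ : ℝ × ℝ → Set R3}
  {p : ℝ × ℝ} {D : LineParam U (arcLine φ γ₁) (arcLine φ γ₂)}

lemma affine_pt (h : IsDoubleArcFamily U φ γ₁ γ₂ C₁ C₂) (hp : p ∈ D.good) :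
    affine (D.pt (D.u p) (D.v p)) = topView (φ p) := by
  rw [(h.pt_eq hp).2, affine_smul (h.pt_eq hp).1, affine_hv]

/-- Along a parabola of the first family the first parameter is locally constant and the second
one is not. -/
lemma infinite_v_of_arc (h : IsDoubleArcFamily U φ γ₁ γ₂ C₁ C₂) (hp : p ∈ D.good) :
    {v | ∃ x ∈ D.good, φ x ∈ C₁ p ∧ D.u x = D.u p ∧ D.v x = v}.Infinite := by
  obtain ⟨e, hpe, heU, he, -⟩ := h.exists_chart hp.1
  obtain ⟨hd, A, B, -, hC⟩ := h.left.normal_form hp.1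
  obtain ⟨w₀, w₁, hw, hdt⟩ := D.dt_left p hp.1 hp.2.1 hp.2.2
  set x : ℝ → ℝ × ℝ := fun t => e.symm (topView (γ₁ p t)) with hx
  have hγ0 : topView (γ₁ p 0) = e p := by rw [h.left.zero p hp.1, he]
  have hx0 : x 0 = p := by rw [hx]; beta_reduce; rw [hγ0, e.left_inv hpe]
  have hγc : ∀ t, ContinuousAt (fun t => topView (γ₁ p t)) t := fun t =>
    ContinuousAt.comp (g := topView) (f := γ₁ p) continuous_topView.continuousAt
      (h.left.analyticAt_arc hp.1 t).continuousAt
  have htgt : ∀ᶠ t in 𝓝 (0 : ℝ), topView (γ₁ p t) ∈ e.target := by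
    refine (hγc 0).eventually_mem (e.open_target.mem_nhds ?_)
    rw [hγ0]
    exact e.map_source hpe
  have hxc : ∀ {t}, topView (γ₁ p t) ∈ e.target → ContinuousAt x t := fun ht =>
    ContinuousAt.comp (g := e.symm) (f := fun t => topView (γ₁ p t)) (e.continuousAt_symm ht)
      (hγc _)
  have hx0c : ContinuousAt x 0 := hxc htgt.self_of_nhds
  have hgood : ∀ᶠ t in 𝓝 (0 : ℝ), x t ∈ D.good :=
    hx0c.eventually_mem (h.isOpen_good.mem_nhds (hx0.symm ▸ hp))
  have hvne : ∀ᶠ t in 𝓝 (0 : ℝ), w₀ + w₁ * D.v (x t) ≠ 0 := by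
    have hv : ContinuousAt (fun t => D.v (x t)) 0 := by
      refine ContinuousAt.comp (g := D.v) (f := x) ?_ hx0c
      rw [hx0]
      exact (LineParam.analyticAt_v hp).continuousAt
    refine ContinuousAt.eventually_ne (continuousAt_const.add (continuousAt_const.mul hv)) ?_
    rwa [hx0]
  have harc : ∀ᶠ t in 𝓝 (0 : ℝ), γ₁ p t = φ (x t) :=
    (Continuous.tendsto' (f := fun t : ℝ => (p, t)) (by fun_prop) 0 _ rfl).eventually
      (h.eventually_arc_eq hpe heU he)
  obtain ⟨ε, hε, hall⟩ := Metric.eventually_nhds_iff_ball.1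
    (htgt.and (hgood.and (hvne.and (harc.and (Ioo_mem_nhds (by norm_num : (-1 : ℝ) < 0) one_pos)))))
  have hmem : ∀ t ∈ Metric.ball (0 : ℝ) ε, φ (x t) ∈ C₁ p := fun t ht => by
    obtain ⟨-, -, -, h4, h5⟩ := hall t ht
    rw [← h4]
    exact (h.left.subset p hp.1 (mem_image_of_mem _ h5)).1
  have hu : ∀ t ∈ Metric.ball (0 : ℝ) ε, D.u (x t) = D.u p := by
    intro t ht
    obtain ⟨-, h2, h3, -, -⟩ := hall t ht
    have hm := hmem t ht
    rw [hC] at hm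
    obtain ⟨s, hs⟩ := hm
    have h0 : dt (arcLine φ γ₁ p) (D.pt (D.u (x t)) (D.v (x t))) = 0 := by
      rw [(h.pt_eq h2).2, dt_smul, ← hs]
      simp [dt, arcLine, lc, hv, topView]
      right
      ring
    rw [LineParam.pt, hdt] at h0
    exact sub_eq_zero.1 ((mul_eq_zero.1 h0).resolve_right h3)
  have hinf : ((fun t => D.v (x t)) '' Metric.ball (0 : ℝ) ε).Infinite := by
    have hcon : ContinuousOn (fun t => D.v (x t)) (Metric.ball (0 : ℝ) ε) := fun t ht =>
      (ContinuousAt.comp (g := D.v) (f := x)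
        (LineParam.analyticAt_v (hall t ht).2.1).continuousAt
        (hxc (hall t ht).1)).continuousWithinAt
    refine ((convex_ball _ _).isPreconnected.image _ hcon).infinite_of_nontrivial ?_
    by_contra hc
    rw [not_nontrivial_iff] at hc
    have hball := Metric.mem_ball_self (x := (0 : ℝ)) hε
    have hconst : ∀ᶠ t in 𝓝 (0 : ℝ), topView (γ₁ p t) = topView (φ p) := by
      filter_upwards [Metric.ball_mem_nhds _ hε] with t ht
      obtain ⟨-, h2, -, h4, -⟩ := hall t ht
      have hv : D.v (x t) = D.v (x 0) := hc (mem_image_of_mem _ ht) (mem_image_of_mem _ hball)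
      rw [h4, ← h.affine_pt h2, hu t ht, hv, hx0, h.affine_pt hp]
    have hder : HasDerivAt (fun t => topView (γ₁ p t)) (topView (deriv (γ₁ p) 0)) 0 := by
      have := (h.left.analyticAt_arc hp.1 0).differentiableAt.hasDerivAt
      exact topViewL.hasFDerivAt.comp_hasDerivAt (f := γ₁ p) 0 this
    exact hd (hder.unique ((hasDerivAt_const (0 : ℝ) _).congr_of_eventuallyEq hconst))
  refine hinf.mono ?_
  rintro _ ⟨t, ht, rfl⟩
  exact ⟨x t, (hall t ht).2.1, hmem t ht, hu t ht, rfl⟩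

/-- The points with the same first parameter lie on one parabola of the first family. -/
lemma mem_of_u_eq (h : IsDoubleArcFamily U φ γ₁ γ₂ C₁ C₂) (hp : p ∈ D.good) {x : ℝ × ℝ}
    (hx : x ∈ D.good) (hux : D.u x = D.u p) : φ x ∈ C₁ p := by
  obtain ⟨hd, A, B, -, hC⟩ := h.left.normal_form hp.1
  obtain ⟨w₀, w₁, -, hdt⟩ := D.dt_left p hp.1 hp.2.1 hp.2.2
  obtain ⟨z, hz⟩ := h.exists_height_eq D
  set q := topView (φ p) with hq
  set d := topView (deriv (γ₁ p) 0) with hd'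
  set κ := paramForm q d
  set u := D.u p
  obtain ⟨P, hP⟩ : ∃ P : Polynomial ℝ, ∀ v, P.eval v = biquad z u v - (A * dt κ (D.pt u v) ^ 2 +
      B * (dt κ (D.pt u v) * D.pt u v 2) + (φ p).2.2 * D.pt u v 2 ^ 2) := by
    set R : Fin 3 → Polynomial ℝ := fun i => Polynomial.C (D.a₀ i + u * D.a₁ i) +
      Polynomial.X * Polynomial.C (D.a₂ i + u * D.a₃ i)
    have hR v i : (R i).eval v = D.pt u v i := by
      simp only [R, LineParam.pt, Polynomial.eval_add, Polynomial.eval_mul, Polynomial.eval_C,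
        Polynomial.eval_X, Pi.add_apply, Pi.smul_apply, smul_eq_mul]
      ring
    set K := Polynomial.C (κ 0) * R 0 + Polynomial.C (κ 1) * R 1 + Polynomial.C (κ 2) * R 2
    refine ⟨Polynomial.C (z 0 0 + z 1 0 * u + z 2 0 * u ^ 2) +
      Polynomial.C (z 0 1 + z 1 1 * u + z 2 1 * u ^ 2) * Polynomial.X +
      Polynomial.C (z 0 2 + z 1 2 * u + z 2 2 * u ^ 2) * Polynomial.X ^ 2 -
      (Polynomial.C A * K ^ 2 + Polynomial.C B * (K * R 2) + Polynomial.C (φ p).2.2 * R 2 ^ 2),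
      fun v => ?_⟩
    simp only [K, Polynomial.eval_add, Polynomial.eval_sub, Polynomial.eval_mul, Polynomial.eval_C,
      Polynomial.eval_X, Polynomial.eval_pow, hR, biquad, dt]
    ring
  have hP0 : P = 0 := by
    refine Polynomial.eq_zero_of_infinite_isRoot P ((h.infinite_v_of_arc hp).mono ?_)
    rintro _ ⟨y, hy, hyC, huy, rfl⟩
    change P.eval _ = 0
    rw [hC] at hyC
    obtain ⟨s, hs⟩ := hyC
    have hzy := hz y hy
    obtain ⟨-, hpt⟩ := h.pt_eq hy
    rw [huy] at hzy hpt
    have hs' : dt κ (D.pt u (D.v y)) = D.pt u (D.v y) 2 * s := by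
      rw [hpt, dt_smul, ← hs]
      have := sq_add_sq_ne_zero hd
      simp only [hd', topView] at this
      simp [κ, dt, paramForm, hv, topView, hq, hd']
      left
      field_simp
      ring
    rw [hP, ← hzy, hs', ← hs]
    ring
  have hzx := hz x hx
  have haff := h.affine_pt hx
  obtain ⟨hne, -⟩ := h.pt_eq hx
  have h0 := hP (D.v x)
  rw [hux] at hzx haff hne
  rw [hP0, Polynomial.eval_zero, ← hzx] at h0
  have hL : dt (lc q d) (D.pt u (D.v x)) = 0 := by
    have := hdt u (D.v x)
    rwa [show D.s₁ p / D.s₀ p = u from rfl, sub_self, zero_mul] at this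
  rw [affine_eq_of_dt_lc hd hne hL] at haff
  rw [hC]
  refine ⟨dt κ (D.pt u (D.v x)) / D.pt u (D.v x) 2, ?_⟩
  have h1 := congrArg Prod.fst haff
  have h2 := congrArg Prod.snd haff
  refine Prod.ext h1 (Prod.ext h2 ?_)
  refine mul_right_cancel₀ (pow_ne_zero 2 hne) ?_
  field_simp
  linear_combination h0

end IsDoubleArcFamily

lemma dimH_line_le {l : Fin 3 → ℝ} (hl : l ≠ 0) : dimH {q : ℝ × ℝ | dt l (hv q) = 0} ≤ 1 := by
  by_cases h0 : l 0 ^ 2 + l 1 ^ 2 = 0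
  · have h1 : l 0 = 0 := by nlinarith [sq_nonneg (l 0), sq_nonneg (l 1)]
    have h2 : l 1 = 0 := by nlinarith [sq_nonneg (l 0), sq_nonneg (l 1)]
    have : {q : ℝ × ℝ | dt l (hv q) = 0} = ∅ := by
      refine eq_empty_of_forall_notMem fun q hq => hl (vec3_ext h1 h2 ?_)
      simpa [dt, hv, h1, h2] using hq
    simp [this]
  · have hsub : {q : ℝ × ℝ | dt l (hv q) = 0} ⊆ range fun t : ℝ =>
        ((-(l 2 * l 0) / (l 0 ^ 2 + l 1 ^ 2) - t * l 1,
          -(l 2 * l 1) / (l 0 ^ 2 + l 1 ^ 2) + t * l 0) : ℝ × ℝ) := by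
      intro q hq
      simp only [mem_ofPred_eq, dt, hv, Matrix.cons_val_zero, Matrix.cons_val_one,
        Matrix.cons_val] at hq
      refine ⟨(q.2 * l 0 - q.1 * l 1) / (l 0 ^ 2 + l 1 ^ 2), Prod.ext ?_ ?_⟩ <;> dsimp only <;>
        field_simp
      · linear_combination -l 0 * hq
      · linear_combination -l 1 * hq
    refine (dimH_mono hsub).trans ?_
    simpa using ContDiff.dimH_range_le (f := fun t : ℝ =>
        ((-(l 2 * l 0) / (l 0 ^ 2 + l 1 ^ 2) - t * l 1,
          -(l 2 * l 1) / (l 0 ^ 2 + l 1 ^ 2) + t * l 0) : ℝ × ℝ)) (by fun_prop)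

namespace IsDoubleArcFamily
variable {U : Set (ℝ × ℝ)} {φ : ℝ × ℝ → R3} {γ₁ γ₂ : ℝ × ℝ → ℝ → R3} {C₁ C₂ : ℝ × ℝ → Set R3}
  {p : ℝ × ℝ} {D : LineParam U (arcLine φ γ₁) (arcLine φ γ₂)}

/-- The part of the surface above a line is at most one-dimensional. -/
lemma dimH_image_line_le (h : IsDoubleArcFamily U φ γ₁ γ₂ C₁ C₂) {l : Fin 3 → ℝ} (hl : l ≠ 0) :
    dimH (φ '' {x | x ∈ U ∧ dt l (hv (topView (φ x))) = 0}) ≤ 1 := by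
  set S := {x | x ∈ U ∧ dt l (hv (topView (φ x))) = 0}
  refine (dimH_image_le_of_locally_lipschitzOn (f := φ) (s := S) fun x hx => ?_).trans ?_
  · obtain ⟨K, t, ht, hK⟩ := (h.surface.analytic x hx.1).contDiffAt.exists_lipschitzOnWith (𝕂 := ℝ)
    exact ⟨K, t, mem_nhdsWithin_of_mem_nhds ht, hK⟩
  by_contra! hlt
  obtain ⟨x, hx, ht⟩ := exists_mem_nhdsWithin_lt_dimH_of_lt_dimH hlt
  obtain ⟨e, hxe, -, he, K, hK⟩ := h.exists_chart hx.1
  refine (ht (S ∩ e.source)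
    (inter_mem_nhdsWithin _ (e.open_source.mem_nhds hxe))).not_ge ?_
  have hsub : S ∩ e.source ⊆ e.symm '' (e.target ∩ {q | dt l (hv q) = 0}) := by
    rintro y ⟨hy, hye⟩
    refine ⟨e y, ⟨e.map_source hye, ?_⟩, e.left_inv hye⟩
    rw [he]
    exact hy.2
  exact (dimH_mono hsub).trans (((hK.mono inter_subset_left).dimH_image_le).trans
    ((dimH_mono inter_subset_right).trans (dimH_line_le hl)))

lemma dimH_not_good_le (h : IsDoubleArcFamily U φ γ₁ γ₂ C₁ C₂)
    (D : LineParam U (arcLine φ γ₁) (arcLine φ γ₂)) : dimH (φ '' (U \ D.good)) ≤ 1 := by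
  have hsub : φ '' (U \ D.good) ⊆ φ '' {x | x ∈ U ∧ dt D.l₁ (hv (topView (φ x))) = 0} ∪
      φ '' {x | x ∈ U ∧ dt D.l₂ (hv (topView (φ x))) = 0} := by
    rw [← image_union]
    refine image_mono fun x ⟨hx, hxg⟩ => ?_
    rw [h.mem_good] at hxg
    by_contra hc
    simp only [mem_union, mem_ofPred_eq, hx, true_and, not_or] at hc
    exact hxg ⟨hx, hc⟩
  refine (dimH_mono hsub).trans ?_
  rw [dimH_union]
  exact max_le (h.dimH_image_line_le D.l₁_ne) (h.dimH_image_line_le D.l₂_ne)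

end IsDoubleArcFamily

/-- The biaffine polynomial with the given coefficients. -/
noncomputable def biaffinePoly (a b c d : ℝ) : RP2 :=
  C a + C b * X 0 + C c * X 1 + C d * (X 0 * X 1)

/-- The polynomial of degree at most two in each variable with the given coefficients. -/
noncomputable def biquadPoly (z : Fin 3 → Fin 3 → ℝ) : RP2 :=
  (C (z 0 0) + C (z 0 1) * X 1 + C (z 0 2) * X 1 ^ 2) +
    (C (z 1 0) + C (z 1 1) * X 1 + C (z 1 2) * X 1 ^ 2) * X 0 +
    (C (z 2 0) + C (z 2 1) * X 1 + C (z 2 2) * X 1 ^ 2) * X 0 ^ 2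

lemma pev_biaffinePoly (a b c d u v : ℝ) :
    pev (biaffinePoly a b c d) u v = a + u * b + v * c + u * v * d := by
  simp [pev, biaffinePoly]
  ring

lemma pev_biquadPoly (z : Fin 3 → Fin 3 → ℝ) (u v : ℝ) : pev (biquadPoly z) u v = biquad z u v := by
  simp [pev, biquadPoly, biquad]

lemma MemR.add {i j : ℕ} {F G : RP2} (hF : MemR i j F) (hG : MemR i j G) : MemR i j (F + G) :=
  ⟨(degreeOf_add_le _ _ _).trans (max_le hF.1 hG.1),
    (degreeOf_add_le _ _ _).trans (max_le hF.2 hG.2)⟩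

lemma MemR.mul {i j i' j' : ℕ} {F G : RP2} (hF : MemR i j F) (hG : MemR i' j' G) :
    MemR (i + i') (j + j') (F * G) :=
  ⟨(degreeOf_mul_le _ _ _).trans (add_le_add hF.1 hG.1),
    (degreeOf_mul_le _ _ _).trans (add_le_add hF.2 hG.2)⟩

lemma MemR.mono {i j i' j' : ℕ} {F : RP2} (hF : MemR i j F) (hi : i ≤ i') (hj : j ≤ j') :
    MemR i' j' F := ⟨hF.1.trans hi, hF.2.trans hj⟩

lemma memR_C (a : ℝ) : MemR 0 0 (C a) := by simp [MemR]

lemma memR_X_zero_pow (n : ℕ) : MemR n 0 (X 0 ^ n) := by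
  constructor <;> exact (degreeOf_pow_le _ _ _).trans (by simp [degreeOf_X])

lemma memR_X_one_pow (n : ℕ) : MemR 0 n (X 1 ^ n) := by
  constructor <;> exact (degreeOf_pow_le _ _ _).trans (by simp [degreeOf_X])

lemma memR_biaffinePoly (a b c d : ℝ) : MemR 1 1 (biaffinePoly a b c d) := by
  have h0 := memR_X_zero_pow 1
  have h1 := memR_X_one_pow 1
  rw [pow_one] at h0 h1
  exact (((memR_C a).mono zero_le_one zero_le_one).add
    (((memR_C b).mul h0).mono le_rfl zero_le_one)).add
    (((memR_C c).mul h1).mono zero_le_one le_rfl) |>.add ((memR_C d).mul (h0.mul h1))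

lemma memR_biquadPoly (z : Fin 3 → Fin 3 → ℝ) : MemR 2 2 (biquadPoly z) := by
  have h a b c : MemR 0 2 (C a + C b * X 1 + C c * X 1 ^ 2) := by
    have h1 := memR_X_one_pow 1
    rw [pow_one] at h1
    exact (((memR_C a).mono le_rfl zero_le_two).add
      (((memR_C b).mul h1).mono le_rfl one_le_two)).add ((memR_C c).mul (memR_X_one_pow 2))
  have h0 := memR_X_zero_pow 1
  rw [pow_one] at h0
  exact (((h _ _ _).mono zero_le_two le_rfl).add
    (((h _ _ _).mul h0).mono one_le_two le_rfl)).add ((h _ _ _).mul (memR_X_zero_pow 2))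

/-- A surface with a parametrization of the two families of lines below the parabolas is
rationally parametrized. -/
theorem IsDoubleArcFamily.exists_rational_param {U : Set (ℝ × ℝ)} {φ : ℝ × ℝ → R3}
    {γ₁ γ₂ : ℝ × ℝ → ℝ → R3} {C₁ C₂ : ℝ × ℝ → Set R3} (h : IsDoubleArcFamily U φ γ₁ γ₂ C₁ C₂)
    (D : LineParam U (arcLine φ γ₁) (arcLine φ γ₂)) :
    ∃ P Q R Z : RP2, MemR 1 1 P ∧ MemR 1 1 Q ∧ MemR 1 1 R ∧ MemR 2 2 Z ∧ R ≠ 0 ∧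
      ∃ (E : Set R3) (W : Set (ℝ × ℝ)),
        dimH E ≤ 1 ∧
        (∀ w ∈ W, pev R w.1 w.2 ≠ 0) ∧
        φ '' U \ E = Phi3 P Q R Z '' W ∧
        (∀ w ∈ W, ∃ C : Set R3, IsVerticalParabola C ∧
          Phi3 P Q R Z '' {w' ∈ W | w'.1 = w.1} ⊆ C) ∧
        (∀ w ∈ W, ∃ C : Set R3, IsVerticalParabola C ∧
          Phi3 P Q R Z '' {w' ∈ W | w'.2 = w.2} ⊆ C) := by
  obtain ⟨z, hz⟩ := h.exists_height_eq D
  set F : Fin 3 → RP2 := fun i => biaffinePoly (D.a₀ i) (D.a₁ i) (D.a₂ i) (D.a₃ i)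
  have hF i u v : pev (F i) u v = D.pt u v i := by
    simp only [F, pev_biaffinePoly, LineParam.pt, Pi.add_apply, Pi.smul_apply, smul_eq_mul]
  have hmem i : MemR 1 1 (F i) := memR_biaffinePoly _ _ _ _
  have hΦ {x} (hx : x ∈ D.good) :
      Phi3 (F 0) (F 1) (F 2) (biquadPoly z) (D.u x, D.v x) = φ x := by
    have haff := h.affine_pt hx
    have hne := pow_ne_zero 2 (h.pt_eq hx).1
    refine Prod.ext ?_ (Prod.ext ?_ ?_)
    · simp only [Phi3, hF]
      exact congrArg Prod.fst haff
    · simp only [Phi3, hF]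
      exact congrArg Prod.snd haff
    · simp only [Phi3, hF, pev_biquadPoly, ← hz x hx]
      exact mul_div_cancel_right₀ _ hne
  refine ⟨F 0, F 1, F 2, biquadPoly z, hmem 0, hmem 1, hmem 2, memR_biquadPoly z, ?_,
    φ '' (U \ D.good), (fun x => (D.u x, D.v x)) '' D.good, h.dimH_not_good_le D, ?_, ?_, ?_, ?_⟩
  · obtain ⟨p, hp⟩ := h.exists_good (D := D)
    intro h0
    exact (h.pt_eq hp).1 (by rw [← hF, h0, pev, map_zero])
  · rintro _ ⟨x, hx, rfl⟩
    rw [hF]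
    exact (h.pt_eq hx).1
  · rw [← h.surface.injOn.image_sdiff_subset sdiff_subset, sdiff_sdiff_cancel_left fun x hx => hx.1,
      image_image]
    exact image_congr fun x hx => (hΦ hx).symm
  · rintro _ ⟨x, hx, rfl⟩
    refine ⟨C₁ x, h.left.parabola x hx.1, ?_⟩
    rintro _ ⟨_, ⟨⟨y, hy, rfl⟩, huv⟩, rfl⟩
    rw [hΦ hy]
    exact h.mem_of_u_eq hx hy huv
  · rintro _ ⟨x, hx, rfl⟩
    refine ⟨C₂ x, h.right.parabola x hx.1, ?_⟩
    rintro _ ⟨_, ⟨⟨y, hy, rfl⟩, huv⟩, rfl⟩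
    rw [hΦ hy]
    exact h.symm.mem_of_u_eq (D := D.symm) (LineParam.good_symm.symm ▸ hx)
      (LineParam.good_symm.symm ▸ hy) huv

end

/-- If through each point of an analytic surface in `ℝ³` one can draw two
transversal parabolic arcs with vertical axes, fully contained in the surface and analytically
depending on the point, lying neither in a common isotropic sphere nor in a common plane, and
through each point of some dense subset of the surface only finitely many arcs of isotropic
circles and line segments pass, then the surface, possibly besides a one-dimensional subset,
has a parametrization `(P/R, Q/R, Z/R²)` with `P, Q, R ∈ ℝ_{1,1}`, `Z ∈ ℝ_{2,2}`, `R ≠ 0`,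
such that the parabolic arcs are the curves `u = const` and `v = const`. -/
theorem stmt_0
    -- an analytic surface in ℝ³ :
    (U : Set (ℝ × ℝ)) (hUopen : IsOpen U) (hUconn : IsConnected U)
    (φ : ℝ × ℝ → R3)
    (hφan : AnalyticOnNhd ℝ φ U)
    (hφinj : Set.InjOn φ U)
    (hφdiff : ∀ p ∈ U, Function.Injective (fderiv ℝ φ p))
    -- two arcs through each point, analytically depending on the point :
    (γ₁ γ₂ : ℝ × ℝ → ℝ → R3)
    (hγan : AnalyticOnNhd ℝ (fun q : (ℝ × ℝ) × ℝ => (γ₁ q.1 q.2, γ₂ q.1 q.2))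
      (U ×ˢ Set.univ))
    (hγ0 : ∀ p ∈ U, γ₁ p 0 = φ p ∧ γ₂ p 0 = φ p)
    -- the arcs are arcs of parabolas with vertical axes, fully contained in the surface :
    (C₁ C₂ : ℝ × ℝ → Set R3)
    (hC₁ : ∀ p ∈ U, IsVerticalParabola (C₁ p))
    (hC₂ : ∀ p ∈ U, IsVerticalParabola (C₂ p))
    (harc₁ : ∀ p ∈ U, γ₁ p '' Set.Ioo (-1 : ℝ) 1 ⊆ C₁ p ∩ φ '' U)
    (harc₂ : ∀ p ∈ U, γ₂ p '' Set.Ioo (-1 : ℝ) 1 ⊆ C₂ p ∩ φ '' U)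
    -- the two arcs are transversal :
    (htrans : ∀ p ∈ U, LinearIndependent ℝ ![deriv (γ₁ p) 0, deriv (γ₂ p) 0])
    -- the two arcs lie neither in the same isotropic sphere nor in the same plane :
    (hnotsp : ∀ p ∈ U, ¬∃ S : Set R3, (IsIsotropicSphere S ∨ IsPlane3 S) ∧
      γ₁ p '' Set.Ioo (-1 : ℝ) 1 ⊆ S ∧ γ₂ p '' Set.Ioo (-1 : ℝ) 1 ⊆ S)
    -- finitely many arcs of isotropic circles and line segments through each point
    -- of some dense subset of the surface :
    (hfin : ∃ D : Set R3, D ⊆ φ '' U ∧ φ '' U ⊆ closure D ∧ ∀ q ∈ D,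
      {C : Set R3 | (IsIsotropicCircle C ∨ IsLine3 C) ∧ ArcThroughIn C q (φ '' U)}.Finite) :
    -- conclusion :
    ∃ P Q R Z : RP2, MemR 1 1 P ∧ MemR 1 1 Q ∧ MemR 1 1 R ∧ MemR 2 2 Z ∧ R ≠ 0 ∧
      ∃ (E : Set R3) (W : Set (ℝ × ℝ)),
        dimH E ≤ 1 ∧
        (∀ w ∈ W, pev R w.1 w.2 ≠ 0) ∧
        φ '' U \ E = Phi3 P Q R Z '' W ∧
        (∀ w ∈ W, ∃ C : Set R3, IsVerticalParabola C ∧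
          Phi3 P Q R Z '' {w' ∈ W | w'.1 = w.1} ⊆ C) ∧
        (∀ w ∈ W, ∃ C : Set R3, IsVerticalParabola C ∧
          Phi3 P Q R Z '' {w' ∈ W | w'.2 = w.2} ⊆ C) := by
  have hγ₁ : IsArcFamily U φ γ₁ C₁ :=
    { analytic := fun q hq => analyticAt_fst.comp_of_eq (hγan q hq) rfl
      zero := fun p hp => (hγ0 p hp).1
      parabola := hC₁
      subset := harc₁
      deriv_ne := fun p hp => (htrans p hp).ne_zero 0 }
  have hγ₂ : IsArcFamily U φ γ₂ C₂ :=
    { analytic := fun q hq => analyticAt_snd.comp_of_eq (hγan q hq) rfl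
      zero := fun p hp => (hγ0 p hp).2
      parabola := hC₂
      subset := harc₂
      deriv_ne := fun p hp => (htrans p hp).ne_zero 1 }
  have h : IsDoubleArcFamily U φ γ₁ γ₂ C₁ C₂ :=
    { surface := ⟨hUopen, hUconn, hφan, hφinj, hφdiff⟩
      left := hγ₁
      right := hγ₂
      det_ne := fun p hp => hγ₁.det2_ne_zero hγ₂ hp fun ⟨S, hS, hS₁, hS₂⟩ =>
        hnotsp p hp ⟨S, Or.inr hS, hS₁, hS₂⟩ }
  have hD : Nonempty (LineParam U (arcLine φ γ₁) (arcLine φ γ₂)) := by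
    rcases h.pencils_or_common_conic hfin with ⟨k, k', hk, hk', hL⟩ | ⟨c, e₀, e₁, e₂, he, hc, hL⟩
    · exact exists_lineParam_of_pencils h.arcLine_analytic h.symm.arcLine_analytic hk hk'
        (fun p hp => (hL p hp).1) fun p hp => (hL p hp).2
    · exact exists_lineParam_of_conic h.arcLine_analytic h.symm.arcLine_analytic he hc
        (fun p hp => (hL p hp).1) fun p hp => (hL p hp).2
  exact h.exists_rational_param hD.some
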